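/- Let K be a finite class of finite similar idempotent affine free algebras omitting type 1. Then every (2,3)-minimal instance of the CSP over K has a solution. -/

import Mathlib

/-! Common framework: universal algebras over a fixed signature, terms,
subalgebras, congruences, quotients, edges and their types (Bulatov's
coloured-graph approach), thin edges, connectivity, products, etc. -/

/-- A (functional) signature: a type of operation symbols with arities. -/
structure Signature where
  ops : Type
  arity : ops → ℕ

/-- An algebra of a given signature. -/
structure UAlgebra (σ : Signature) where
  carrier : Type
  interp : ∀ f : σ.ops, (Fin (σ.arity f) → carrier) → carrier

/-- Terms over the signature `σ` in `n` variables. -/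
inductive Term (σ : Signature) (n : ℕ) where
  | var : Fin n → Term σ n
  | app : (f : σ.ops) → (Fin (σ.arity f) → Term σ n) → Term σ n

/-- Evaluation of a term in an algebra; term operations of an algebra are
exactly the operations of the form `Term.eval A t`. -/
def Term.eval {σ : Signature} {n : ℕ} (A : UAlgebra σ) :
    Term σ n → (Fin n → A.carrier) → A.carrier
  | .var i, x => x i
  | .app f ts, x => A.interp f fun j => Term.eval A (ts j) x

namespace UAlgebra

variable {σ : Signature}

/-- An algebra is idempotent if all its basic operations are. -/
def Idempotent (A : UAlgebra σ) : Prop :=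
  ∀ (f : σ.ops) (a : A.carrier), A.interp f (fun _ => a) = a

/-- A set closed under all basic operations. -/
def IsClosed (A : UAlgebra σ) (S : Set A.carrier) : Prop :=
  ∀ (f : σ.ops) (x : Fin (σ.arity f) → A.carrier), (∀ j, x j ∈ S) → A.interp f x ∈ S

/-- Closure of a set under the basic operations. -/
inductive Closure (A : UAlgebra σ) (S : Set A.carrier) : A.carrier → Prop
  | base {a : A.carrier} : a ∈ S → Closure A S a
  | app (f : σ.ops) (x : Fin (σ.arity f) → A.carrier) :
      (∀ j, Closure A S (x j)) → Closure A S (A.interp f x)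

def ClosureSet (A : UAlgebra σ) (S : Set A.carrier) : Set A.carrier := {x | Closure A S x}

theorem closureSet_isClosed (A : UAlgebra σ) (S : Set A.carrier) :
    A.IsClosed (A.ClosureSet S) := fun f x h => Closure.app f x h

/-- The subalgebra of `A` on a closed subset `S`. -/
def subalg (A : UAlgebra σ) (S : Set A.carrier) (hS : A.IsClosed S) : UAlgebra σ where
  carrier := {x : A.carrier // x ∈ S}
  interp f x := ⟨A.interp f fun j => (x j : A.carrier), hS f _ fun j => (x j).2⟩

/-- The subalgebra generated by a set `S`. -/
def Sg (A : UAlgebra σ) (S : Set A.carrier) : UAlgebra σ :=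
  A.subalg (A.ClosureSet S) (A.closureSet_isClosed S)

/-- `a` as an element of `Sg {a, b}`. -/
def sgA (A : UAlgebra σ) (a b : A.carrier) : (A.Sg {a, b}).carrier :=
  ⟨a, Closure.base (Set.mem_insert a {b})⟩

/-- `b` as an element of `Sg {a, b}`. -/
def sgB (A : UAlgebra σ) (a b : A.carrier) : (A.Sg {a, b}).carrier :=
  ⟨b, Closure.base (Set.mem_insert_iff.mpr (Or.inr rfl))⟩

/-- A congruence of an algebra. -/
structure Congruence (A : UAlgebra σ) where
  rel : A.carrier → A.carrier → Prop
  refl : ∀ x, rel x x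
  symm : ∀ {x y}, rel x y → rel y x
  trans : ∀ {x y z}, rel x y → rel y z → rel x z
  compat : ∀ (f : σ.ops) (x y : Fin (σ.arity f) → A.carrier),
      (∀ j, rel (x j) (y j)) → rel (A.interp f x) (A.interp f y)

def Congruence.toSetoid {A : UAlgebra σ} (θ : Congruence A) : Setoid A.carrier :=
  ⟨θ.rel, ⟨θ.refl, θ.symm, θ.trans⟩⟩

/-- The full congruence. -/
def Congruence.IsFull {A : UAlgebra σ} (θ : Congruence A) : Prop := ∀ x y, θ.rel x y

def Congruence.le {A : UAlgebra σ} (θ η : Congruence A) : Prop :=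
  ∀ x y, θ.rel x y → η.rel x y

/-- A maximal congruence: proper, and any congruence above it is full or below it. -/
def Congruence.IsMaximal {A : UAlgebra σ} (θ : Congruence A) : Prop :=
  ¬ θ.IsFull ∧ ∀ η : Congruence A, θ.le η → ¬ η.IsFull → η.le θ

/-- The quotient (factor) algebra. -/
noncomputable def quot (A : UAlgebra σ) (θ : Congruence A) : UAlgebra σ where
  carrier := Quotient θ.toSetoid
  interp f x := Quotient.mk θ.toSetoid (A.interp f fun j => (x j).out)

/-- The class of `a` in the quotient of `Sg {a,b}` by `θ`. -/
def qa (A : UAlgebra σ) (a b : A.carrier) (θ : Congruence (A.Sg {a, b})) :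
    ((A.Sg {a, b}).quot θ).carrier :=
  Quotient.mk θ.toSetoid (A.sgA a b)

def qb (A : UAlgebra σ) (a b : A.carrier) (θ : Congruence (A.Sg {a, b})) :
    ((A.Sg {a, b}).quot θ).carrier :=
  Quotient.mk θ.toSetoid (A.sgB a b)

end UAlgebra

/-- A binary operation is a semilattice operation on a set `B`. -/
def IsSemilatticeOn {α : Type} (f : α → α → α) (B : Set α) : Prop :=
  (∀ x ∈ B, f x x = x) ∧ (∀ x ∈ B, ∀ y ∈ B, f x y = f y x) ∧
    (∀ x ∈ B, ∀ y ∈ B, ∀ z ∈ B, f x (f y z) = f (f x y) z)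

/-- A ternary operation is a majority operation on a set `B`. -/
def IsMajorityOn {α : Type} (g : α → α → α → α) (B : Set α) : Prop :=
  ∀ x ∈ B, ∀ y ∈ B, g x x y = x ∧ g x y x = x ∧ g y x x = x

/-- A ternary operation is a Mal'tsev operation on a set `B`. -/
def IsMaltsevOn {α : Type} (h : α → α → α → α) (B : Set α) : Prop :=
  ∀ x ∈ B, ∀ y ∈ B, h x y y = x ∧ h y y x = x

namespace UAlgebra

variable {σ : Signature}

/-- An algebra is "a set": every term operation is a projection. -/
def IsSetAlgebra (Q : UAlgebra σ) : Prop :=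
  ∀ (n : ℕ) (t : Term σ n), ∃ i : Fin n, ∀ x : Fin n → Q.carrier, t.eval Q x = x i

/-- An algebra is the full idempotent reduct of a module over some finite ring:
its term operations are exactly the idempotent affine combinations; in
particular the affine operation `x - y + z` is a term operation. -/
def IsAffineAlgebra (Q : UAlgebra σ) : Prop :=
  ∃ (R : Type) (_ : Ring R) (_ : Finite R) (_ : AddCommGroup Q.carrier)
    (_ : Module R Q.carrier),
    (∀ (n : ℕ) (g : (Fin n → Q.carrier) → Q.carrier),
      (∃ t : Term σ n, ∀ x, t.eval Q x = g x) ↔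
      (∃ c : Fin n → R, (∑ i, c i) = 1 ∧ ∀ x, g x = ∑ i, c i • x i)) ∧
    (∃ t : Term σ 3, ∀ x y z : Q.carrier, t.eval Q ![x, y, z] = x - y + z)

/-- `θ` witnesses that `ab` is an edge of the unary type. -/
def UnaryWitness (A : UAlgebra σ) (a b : A.carrier) (θ : Congruence (A.Sg {a, b})) : Prop :=
  θ.IsMaximal ∧ IsSetAlgebra ((A.Sg {a, b}).quot θ)

/-- `θ` witnesses that `ab` is an edge of the semilattice type. -/
def SLWitness (A : UAlgebra σ) (a b : A.carrier) (θ : Congruence (A.Sg {a, b})) : Prop :=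
  θ.IsMaximal ∧ ∃ t : Term σ 2,
    IsSemilatticeOn (fun x y => t.eval ((A.Sg {a, b}).quot θ) ![x, y])
      {A.qa a b θ, A.qb a b θ}

/-- `θ` witnesses that `ab` is an edge of the majority type. -/
def MajWitness (A : UAlgebra σ) (a b : A.carrier) (θ : Congruence (A.Sg {a, b})) : Prop :=
  θ.IsMaximal ∧
  (∃ t : Term σ 3,
    IsMajorityOn (fun x y z => t.eval ((A.Sg {a, b}).quot θ) ![x, y, z])
      {A.qa a b θ, A.qb a b θ}) ∧
  ¬ (∃ t : Term σ 2,
    IsSemilatticeOn (fun x y => t.eval ((A.Sg {a, b}).quot θ) ![x, y])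
      {A.qa a b θ, A.qb a b θ})

/-- `θ` witnesses that `ab` is an edge of the affine type. -/
def AffWitness (A : UAlgebra σ) (a b : A.carrier) (θ : Congruence (A.Sg {a, b})) : Prop :=
  θ.IsMaximal ∧ IsAffineAlgebra ((A.Sg {a, b}).quot θ)

/-- A pair of distinct elements is an edge. -/
def IsEdge (A : UAlgebra σ) (a b : A.carrier) : Prop :=
  a ≠ b ∧ ∃ θ : Congruence (A.Sg {a, b}), ¬ θ.IsFull ∧
    (IsSetAlgebra ((A.Sg {a, b}).quot θ) ∨
     IsAffineAlgebra ((A.Sg {a, b}).quot θ) ∨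
     (∃ t : Term σ 2,
        IsSemilatticeOn (fun x y => t.eval ((A.Sg {a, b}).quot θ) ![x, y])
          {A.qa a b θ, A.qb a b θ}) ∨
     (∃ t : Term σ 3,
        IsMajorityOn (fun x y z => t.eval ((A.Sg {a, b}).quot θ) ![x, y, z])
          {A.qa a b θ, A.qb a b θ}))

def IsUnaryEdge (A : UAlgebra σ) (a b : A.carrier) : Prop :=
  a ≠ b ∧ ∃ θ : Congruence (A.Sg {a, b}), UnaryWitness A a b θ

def IsSLEdge (A : UAlgebra σ) (a b : A.carrier) : Prop :=
  a ≠ b ∧ ∃ θ : Congruence (A.Sg {a, b}), SLWitness A a b θ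

def IsMajEdge (A : UAlgebra σ) (a b : A.carrier) : Prop :=
  a ≠ b ∧ ∃ θ : Congruence (A.Sg {a, b}), MajWitness A a b θ

def IsAffEdge (A : UAlgebra σ) (a b : A.carrier) : Prop :=
  a ≠ b ∧ ∃ θ : Congruence (A.Sg {a, b}), AffWitness A a b θ

end UAlgebra

/-- The four types of edges. -/
inductive EdgeType where
  | unary | semilattice | majority | affine
deriving DecidableEq

namespace UAlgebra

variable {σ : Signature}

def HasEdgeOfType (A : UAlgebra σ) (τ : EdgeType) (a b : A.carrier) : Prop :=
  match τ with
  | .unary => A.IsUnaryEdge a b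
  | .semilattice => A.IsSLEdge a b
  | .majority => A.IsMajEdge a b
  | .affine => A.IsAffEdge a b

/-- `T`-restricted algebra: every edge has a type from `T`. -/
def Restricted (A : UAlgebra σ) (T : Set EdgeType) : Prop :=
  ∀ a b : A.carrier, A.IsEdge a b → ∃ τ ∈ T, A.HasEdgeOfType τ a b

/-- `A` omits type 1: no subalgebra of `A` has an edge of the unary type. -/
def OmitsType1 (A : UAlgebra σ) : Prop :=
  ∀ (S : Set A.carrier) (hS : A.IsClosed S) (a b : (A.subalg S hS).carrier),
    ¬ (A.subalg S hS).IsUnaryEdge a b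

/-- The union of the two `θ`-blocks of a thick edge, as a subset of `A`. -/
def edgeBlockUnion (A : UAlgebra σ) (a b : A.carrier) (θ : Congruence (A.Sg {a, b})) :
    Set A.carrier :=
  {x | ∃ hx : x ∈ A.ClosureSet {a, b},
    θ.rel ⟨x, hx⟩ (A.sgA a b) ∨ θ.rel ⟨x, hx⟩ (A.sgB a b)}

/-- Smooth algebra: for every semilattice- or majority-type edge with a witnessing
maximal congruence, the union of the two blocks is a subuniverse. -/
def IsSmooth (A : UAlgebra σ) : Prop :=
  ∀ (a b : A.carrier) (θ : Congruence (A.Sg {a, b})),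
    (SLWitness A a b θ ∨ MajWitness A a b θ) → A.IsClosed (A.edgeBlockUnion a b θ)

def SemilatticeFree (A : UAlgebra σ) : Prop := ∀ a b : A.carrier, ¬ A.IsSLEdge a b
def MajorityFree (A : UAlgebra σ) : Prop := ∀ a b : A.carrier, ¬ A.IsMajEdge a b
def AffineFree (A : UAlgebra σ) : Prop := ∀ a b : A.carrier, ¬ A.IsAffEdge a b

/-- Thin semilattice edge. -/
def IsThinSLEdge (A : UAlgebra σ) (a b : A.carrier) : Prop :=
  ∃ t : Term σ 2, t.eval A ![a, a] = a ∧ t.eval A ![a, b] = b ∧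
    t.eval A ![b, a] = b ∧ t.eval A ![b, b] = b

/-- Undirected thin majority edge: some term operation is majority on `{a, b}`. -/
def IsUndirThinMajEdge (A : UAlgebra σ) (a b : A.carrier) : Prop :=
  ∃ t : Term σ 3, IsMajorityOn (fun x y z => t.eval A ![x, y, z]) {a, b}

/-- Mal'tsev edge: some term operation is Mal'tsev on `{a, b}`. -/
def IsMaltsevEdge (A : UAlgebra σ) (a b : A.carrier) : Prop :=
  ∃ t : Term σ 3, IsMaltsevOn (fun x y z => t.eval A ![x, y, z]) {a, b}

/-- The class of all quotients of subalgebras of `A`. -/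
def QuotSub (A : UAlgebra σ) : Set (UAlgebra σ) :=
  {B | ∃ (S : Set A.carrier) (hS : A.IsClosed S)
        (θ : Congruence (A.subalg S hS)), B = (A.subalg S hS).quot θ}

end UAlgebra

/-- The class of all quotients of subalgebras of the algebras of a class. -/
def QuotSubClass {σ : Signature} (K : Set (UAlgebra σ)) : Set (UAlgebra σ) :=
  {B | ∃ A ∈ K, B ∈ UAlgebra.QuotSub A}

/-- A ternary term satisfies the majority condition relative to a class `𝒦`. -/
def MajorityCondition {σ : Signature} (𝒦 : Set (UAlgebra σ)) (t : Term σ 3) : Prop :=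
  (∀ B ∈ 𝒦, ∀ x y : B.carrier,
    t.eval B ![x, t.eval B ![x, y, y], t.eval B ![x, y, y]] = t.eval B ![x, y, y]) ∧
  (∀ B ∈ 𝒦, ∀ (a b : B.carrier) (θ : UAlgebra.Congruence (B.Sg {a, b})),
    a ≠ b → UAlgebra.MajWitness B a b θ →
    IsMajorityOn (fun x y z => t.eval ((B.Sg {a, b}).quot θ) ![x, y, z])
      {B.qa a b θ, B.qb a b θ})

/-- A ternary term satisfies the minority condition relative to a class `𝒦`. -/
def MinorityCondition {σ : Signature} (𝒦 : Set (UAlgebra σ)) (t : Term σ 3) : Prop :=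
  (∀ B ∈ 𝒦, ∀ x y : B.carrier,
    t.eval B ![t.eval B ![x, y, y], y, y] = t.eval B ![x, y, y]) ∧
  (∀ B ∈ 𝒦, ∀ (a b : B.carrier) (θ : UAlgebra.Congruence (B.Sg {a, b})),
    a ≠ b → UAlgebra.AffWitness B a b θ →
    IsMaltsevOn (fun x y z => t.eval ((B.Sg {a, b}).quot θ) ![x, y, z])
      {B.qa a b θ, B.qb a b θ})

/-- Thin majority edge relative to a class `𝒦`. -/
def IsThinMajEdge {σ : Signature} (𝒦 : Set (UAlgebra σ)) (A : UAlgebra σ)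
    (a b : A.carrier) : Prop :=
  ∀ t : Term σ 3, MajorityCondition 𝒦 t →
    b ∈ A.ClosureSet {a, t.eval A ![a, b, b]} ∧
    b ∈ A.ClosureSet {a, t.eval A ![b, a, b]} ∧
    b ∈ A.ClosureSet {a, t.eval A ![b, b, a]}

/-- Thin affine edge relative to a class `𝒦` (with respect to some fixed term
operation satisfying the minority condition). -/
def IsThinAffEdge {σ : Signature} (𝒦 : Set (UAlgebra σ)) (A : UAlgebra σ)
    (a b : A.carrier) : Prop :=
  (∃ t : Term σ 3, MinorityCondition 𝒦 t ∧ t.eval A ![b, a, a] = b) ∧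
  ∀ t : Term σ 3, MinorityCondition 𝒦 t → b ∈ A.ClosureSet {a, t.eval A ![a, a, b]}

namespace UAlgebra

variable {σ : Signature}

/-- Reachability in the digraph `Gs(A)` of thin semilattice edges. -/
def sReach (A : UAlgebra σ) : A.carrier → A.carrier → Prop :=
  Relation.ReflTransGen (fun x y => A.IsThinSLEdge x y)

/-- A maximal element of `Gs(A)`: an element of a maximal strongly connected
component. -/
def IsMaxElem (A : UAlgebra σ) (a : A.carrier) : Prop :=
  ∀ b, A.sReach a b → A.sReach b a

/-- A maximal component of `Gs(A)`: the strongly connected component of a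
maximal element. -/
def IsMaxComponent (A : UAlgebra σ) (C : Set A.carrier) : Prop :=
  ∃ a, A.IsMaxElem a ∧ C = {b | A.sReach a b ∧ A.sReach b a}

end UAlgebra

/-- An arc of the digraph `Gas(A)`: a thin semilattice or thin affine edge. -/
def asStep {σ : Signature} (𝒦 : Set (UAlgebra σ)) (A : UAlgebra σ)
    (x y : A.carrier) : Prop :=
  A.IsThinSLEdge x y ∨ IsThinAffEdge 𝒦 A x y

/-- Reachability in `Gas(A)`. -/
def asReach {σ : Signature} (𝒦 : Set (UAlgebra σ)) (A : UAlgebra σ) :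
    A.carrier → A.carrier → Prop :=
  Relation.ReflTransGen (asStep 𝒦 A)

/-- An as-maximal element: an element of an as-component. -/
def IsAsMaxElem {σ : Signature} (𝒦 : Set (UAlgebra σ)) (A : UAlgebra σ)
    (a : A.carrier) : Prop :=
  ∀ b, asReach 𝒦 A a b → asReach 𝒦 A b a

/-- An as-component of `A`: a maximal strongly connected component of `Gas(A)`. -/
def IsAsComponent {σ : Signature} (𝒦 : Set (UAlgebra σ)) (A : UAlgebra σ)
    (C : Set A.carrier) : Prop :=
  ∃ a, IsAsMaxElem 𝒦 A a ∧ C = {b | asReach 𝒦 A a b ∧ asReach 𝒦 A b a}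

namespace UAlgebra

variable {σ : Signature}

/-- Binary direct product. -/
def prod (A B : UAlgebra σ) : UAlgebra σ where
  carrier := A.carrier × B.carrier
  interp f x := (A.interp f fun j => (x j).1, B.interp f fun j => (x j).2)

/-- Direct product of a family. -/
def pi {ι : Type} (A : ι → UAlgebra σ) : UAlgebra σ where
  carrier := ∀ i, (A i).carrier
  interp f x := fun i => (A i).interp f fun j => x j i

/-- Homomorphism of similar algebras. -/
def IsHom (A B : UAlgebra σ) (φ : A.carrier → B.carrier) : Prop :=
  ∀ (f : σ.ops) (x : Fin (σ.arity f) → A.carrier),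
    φ (A.interp f x) = B.interp f fun j => φ (x j)

/-- Simple algebra: only the equality and full congruences. -/
def IsSimple (A : UAlgebra σ) : Prop :=
  ∀ θ : Congruence A, (∀ x y, θ.rel x y ↔ x = y) ∨ θ.IsFull

/-- Maximal generated algebra: generated by one of its maximal components. -/
def MaximalGenerated (A : UAlgebra σ) : Prop :=
  ∃ C : Set A.carrier, A.IsMaxComponent C ∧ A.ClosureSet C = Set.univ

/-- The number of subalgebras (nonempty closed subsets) of an algebra. -/
noncomputable def numSubalgebras (A : UAlgebra σ) : ℕ :=
  Nat.card {S : Set A.carrier // S.Nonempty ∧ A.IsClosed S}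

end UAlgebra

/-- A (k+3)-ary term is an edge term for a class `𝒦`. -/
def IsEdgeTermFor {σ : Signature} (𝒦 : Set (UAlgebra σ)) {k : ℕ}
    (t : Term σ (k + 3)) : Prop :=
  ∀ A ∈ 𝒦, ∀ x y : A.carrier,
    t.eval A (fun i => if i.val ≤ 1 then y else x) = x ∧
    t.eval A (fun i => if i.val = 0 ∨ i.val = 2 then y else x) = x ∧
    ∀ j : Fin (k + 3), 3 ≤ j.val →
      t.eval A (Function.update (fun _ => x) j y) = x

/-- A finite class has few subproducts. -/
def FewSubproducts {σ : Signature} (K : Set (UAlgebra σ)) : Prop :=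
  ∃ p : Polynomial ℕ, ∀ (n : ℕ) (A : Fin n → UAlgebra σ), (∀ i, A i ∈ K) →
    UAlgebra.numSubalgebras (UAlgebra.pi A) ≤ 2 ^ (p.eval n)

/-- `g_K` is bounded by a polynomial: every subalgebra of an `n`-fold product
of members of `K` has a generating set of polynomial size. -/
def PolyGenerated {σ : Signature} (K : Set (UAlgebra σ)) : Prop :=
  ∃ p : Polynomial ℕ, ∀ (n : ℕ) (A : Fin n → UAlgebra σ), (∀ i, A i ∈ K) →
    ∀ S : Set (UAlgebra.pi A).carrier, S.Nonempty → (UAlgebra.pi A).IsClosed S →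
      ∃ G : Set (UAlgebra.pi A).carrier, G ⊆ S ∧ G.Finite ∧
        G.ncard ≤ p.eval n ∧ (UAlgebra.pi A).ClosureSet G = S

/-- An instance of the CSP over a class `K` of similar finite idempotent
algebras: variables with domains from `K` and constraints that are
subalgebras of products of the domains. -/
structure CSPInstance (σ : Signature) (K : Set (UAlgebra σ)) where
  V : Type
  finV : Finite V
  dom : V → UAlgebra σ
  dom_mem : ∀ v, dom v ∈ K
  CI : Type
  finCI : Finite CI
  ar : CI → ℕ
  scope : ∀ c : CI, Fin (ar c) → V
  rel : ∀ c : CI, Set (UAlgebra.pi (fun j => dom (scope c j))).carrier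
  rel_closed : ∀ c, (UAlgebra.pi (fun j => dom (scope c j))).IsClosed (rel c)
  rel_nonempty : ∀ c, (rel c).Nonempty

namespace CSPInstance

variable {σ : Signature} {K : Set (UAlgebra σ)}

/-- A solution of a CSP instance. -/
def IsSolution (P : CSPInstance σ K) (φ : ∀ v, (P.dom v).carrier) : Prop :=
  ∀ c : P.CI, (fun j => φ (P.scope c j)) ∈ P.rel c

/-- A partial solution on a set `W` of variables: it satisfies every
constraint projected onto `W`. -/
def IsPartialSolution (P : CSPInstance σ K) (W : Set P.V)
    (φ : ∀ v, (P.dom v).carrier) : Prop :=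
  ∀ c : P.CI, ∃ a ∈ P.rel c, ∀ j, P.scope c j ∈ W → a j = φ (P.scope c j)

/-- A (2,3)-strategy: a set of pairs (W, φ), |W| ≤ 3, φ a partial solution on
`W` (depending only on its restriction to `W`), nonempty on every `W` with
`|W| ≤ 3`, satisfying (S1), (S2), (S3). -/
def IsStrategy23 (P : CSPInstance σ K)
    (F : Set (Set P.V × (∀ v, (P.dom v).carrier))) : Prop :=
  (∀ Wφ ∈ F, Wφ.1.ncard ≤ 3 ∧ P.IsPartialSolution Wφ.1 Wφ.2) ∧
  (∀ Wφ ∈ F, ∀ ψ : ∀ v, (P.dom v).carrier,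
    (∀ v ∈ Wφ.1, ψ v = Wφ.2 v) → (Wφ.1, ψ) ∈ F) ∧
  (∀ W : Set P.V, W.ncard ≤ 3 → ∃ φ, (W, φ) ∈ F) ∧
  -- (S1): every set of at most 3 variables is inside the scope of a constraint
  (∀ W : Set P.V, W.ncard ≤ 3 → ∃ c : P.CI, ∀ v ∈ W, ∃ j, P.scope c j = v) ∧
  -- (S2): closed under restriction
  (∀ Wφ ∈ F, ∀ U : Set P.V, U ⊆ Wφ.1 → (U, Wφ.2) ∈ F) ∧
  -- (S3): every pair in F with |W| ≤ 2 extends inside every constraint whose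
  -- scope contains W to an F-compatible tuple
  (∀ (c : P.CI) (W : Set P.V) (φ : ∀ v, (P.dom v).carrier),
    (W, φ) ∈ F → W.ncard ≤ 2 → (∀ v ∈ W, ∃ j, P.scope c j = v) →
    ∃ a ∈ P.rel c, ∃ ψ : ∀ v, (P.dom v).carrier,
      (∀ j, a j = ψ (P.scope c j)) ∧ (∀ v ∈ W, ψ v = φ v) ∧
      ∀ U : Set P.V, U.ncard ≤ 2 → (∀ v ∈ U, ∃ j, P.scope c j = v) →
        (U, ψ) ∈ F)

end CSPInstance

namespace BW

variable {σ : Signature}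

open UAlgebra

theorem eval_hom {A B : UAlgebra σ} {g : A.carrier → B.carrier} (hg : A.IsHom B g) {n : ℕ}
    (t : Term σ n) (x : Fin n → A.carrier) : g (t.eval A x) = t.eval B (fun j => g (x j)) := by
  induction t with
  | var i => rfl
  | app f ts ih => simp only [Term.eval]; rw [hg]; congr 1; funext j; exact ih j

theorem eval_mem {A : UAlgebra σ} {S : Set A.carrier} (hS : A.IsClosed S) {n : ℕ}
    (t : Term σ n) (x : Fin n → A.carrier) (hx : ∀ j, x j ∈ S) : t.eval A x ∈ S := by
  induction t with
  | var i => exact hx i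
  | app f ts ih => exact hS f _ ih

theorem eval_idem {A : UAlgebra σ} (hA : A.Idempotent) {n : ℕ}
    (t : Term σ n) (a : A.carrier) : t.eval A (fun _ => a) = a := by
  induction t with
  | var i => rfl
  | app f ts ih => simp only [Term.eval, ih]; exact hA f a

/-- Substitution of terms for variables. -/
def tbind {n m : ℕ} : Term σ n → (Fin n → Term σ m) → Term σ m
  | .var i, s => s i
  | .app f ts, s => .app f fun j => tbind (ts j) s

theorem eval_tbind (A : UAlgebra σ) {n m : ℕ} (t : Term σ n) (s : Fin n → Term σ m)
    (x : Fin m → A.carrier) :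
    (tbind t s).eval A x = t.eval A (fun i => (s i).eval A x) := by
  induction t with
  | var i => rfl
  | app f ts ih => simp only [tbind, Term.eval]; congr 1; funext j; exact ih j

/-- A binary relation compatible with the operations. -/
def RelClosed (A B : UAlgebra σ) (R : A.carrier → B.carrier → Prop) : Prop :=
  ∀ (f : σ.ops) (x : Fin (σ.arity f) → A.carrier) (y : Fin (σ.arity f) → B.carrier),
    (∀ j, R (x j) (y j)) → R (A.interp f x) (B.interp f y)

theorem RelClosed.eval {A B : UAlgebra σ} {R : A.carrier → B.carrier → Prop}
    (hR : RelClosed A B R) {n : ℕ} (t : Term σ n) (x : Fin n → A.carrier)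
    (y : Fin n → B.carrier) (h : ∀ j, R (x j) (y j)) : R (t.eval A x) (t.eval B y) := by
  induction t with
  | var i => exact h i
  | app f ts ih => exact hR f _ _ ih

theorem RelClosed.flip {A B : UAlgebra σ} {R : A.carrier → B.carrier → Prop}
    (hR : RelClosed A B R) : RelClosed B A (fun b a => R a b) :=
  fun f x y h => hR f y x h

instance finite_prod (A B : UAlgebra σ) [Finite A.carrier] [Finite B.carrier] :
    Finite (A.prod B).carrier := inferInstanceAs (Finite (A.carrier × B.carrier))

instance finite_subalg (A : UAlgebra σ) [Finite A.carrier] (S : Set A.carrier)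
    (hS : A.IsClosed S) : Finite (A.subalg S hS).carrier :=
  inferInstanceAs (Finite {x : A.carrier // x ∈ S})

instance finite_pi {ι : Type} [Finite ι] (A : ι → UAlgebra σ) [∀ i, Finite (A i).carrier] :
    Finite (UAlgebra.pi A).carrier := inferInstanceAs (Finite (∀ i, (A i).carrier))

theorem isHom_fst (A B : UAlgebra σ) : (A.prod B).IsHom A Prod.fst := fun _ _ => rfl

theorem isHom_snd (A B : UAlgebra σ) : (A.prod B).IsHom B Prod.snd := fun _ _ => rfl

theorem isHom_comp {A B C : UAlgebra σ} {g : A.carrier → B.carrier} {h : B.carrier → C.carrier}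
    (hh : B.IsHom C h) (hg : A.IsHom B g) : A.IsHom C (fun x => h (g x)) :=
  fun f x => by simp only [hg f x, hh f]

theorem isHom_id (A : UAlgebra σ) : A.IsHom A (fun x => x) := fun _ _ => rfl

theorem isHom_eval_pi {ι : Type} (A : ι → UAlgebra σ) (i : ι) :
    (UAlgebra.pi A).IsHom (A i) (fun x => x i) := fun _ _ => rfl

theorem isHom_subalg (A : UAlgebra σ) (S : Set A.carrier) (hS : A.IsClosed S) :
    (A.subalg S hS).IsHom A (fun x => x.1) := fun _ _ => rfl

theorem quot_interp_mk (A : UAlgebra σ) (θ : Congruence A) (f : σ.ops)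
    (x : Fin (σ.arity f) → A.carrier) :
    (A.quot θ).interp f (fun j => Quotient.mk θ.toSetoid (x j)) =
      Quotient.mk θ.toSetoid (A.interp f x) := by
  apply Quotient.sound
  exact θ.compat f _ _ fun j => Quotient.exact (Quotient.out_eq (Quotient.mk θ.toSetoid (x j)))

theorem isHom_mk (A : UAlgebra σ) (θ : Congruence A) :
    A.IsHom (A.quot θ) (fun x => Quotient.mk θ.toSetoid x) :=
  fun f x => (quot_interp_mk A θ f x).symm

theorem closure_min {A : UAlgebra σ} {X S : Set A.carrier} (h : X ⊆ S) (hS : A.IsClosed S) :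
    A.ClosureSet X ⊆ S := by
  intro x hx
  induction hx with
  | base ha => exact h ha
  | app f x _ ih => exact hS f x ih

theorem subset_closure (A : UAlgebra σ) (X : Set A.carrier) : X ⊆ A.ClosureSet X :=
  fun _ h => Closure.base h

theorem eval_finitary (A : UAlgebra σ) {n : ℕ} (t : Term σ n) (a : Fin n → A.carrier) :
    t.eval A a ∈ A.ClosureSet (Set.range a) :=
  eval_mem (closureSet_isClosed A _) t a fun j => subset_closure A _ ⟨j, rfl⟩

theorem exists_term_range {A : UAlgebra σ} {n : ℕ} (a : Fin n → A.carrier) {x : A.carrier}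
    (hx : x ∈ A.ClosureSet (Set.range a)) : ∃ t : Term σ n, t.eval A a = x := by
  induction hx with
  | base h => obtain ⟨i, rfl⟩ := h; exact ⟨.var i, rfl⟩
  | app f y _ ih => choose t ht using ih; exact ⟨.app f t, by simp only [Term.eval, ht]⟩

theorem range_pair {α : Type} (a b : α) : Set.range ![a, b] = {a, b} := by
  ext x; simp [eq_comm, or_comm]

theorem exists_term_pair {A : UAlgebra σ} {a b x : A.carrier} (hx : x ∈ A.ClosureSet {a, b}) :
    ∃ t : Term σ 2, t.eval A ![a, b] = x := by
  rw [← range_pair] at hx; exact exists_term_range _ hx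

theorem left_mem_pair (A : UAlgebra σ) (a b : A.carrier) : a ∈ A.ClosureSet {a, b} :=
  subset_closure A _ (by simp)

theorem right_mem_pair (A : UAlgebra σ) (a b : A.carrier) : b ∈ A.ClosureSet {a, b} :=
  subset_closure A _ (by simp)

theorem isClosed_inter {A : UAlgebra σ} {S T : Set A.carrier} (hS : A.IsClosed S)
    (hT : A.IsClosed T) : A.IsClosed (S ∩ T) :=
  fun f x h => ⟨hS f x fun j => (h j).1, hT f x fun j => (h j).2⟩

theorem isClosed_preimage {A B : UAlgebra σ} {g : A.carrier → B.carrier} (hg : A.IsHom B g)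
    {S : Set B.carrier} (hS : B.IsClosed S) : A.IsClosed {x | g x ∈ S} :=
  fun f x h => by
    change g _ ∈ S
    rw [hg]; exact hS f _ h

theorem isClosed_singleton {A : UAlgebra σ} (hA : A.Idempotent) (a : A.carrier) :
    A.IsClosed {a} := by
  intro f x h
  have : x = fun _ => a := funext h
  rw [this]; exact hA f a

theorem isClosed_univ (A : UAlgebra σ) : A.IsClosed Set.univ := fun _ _ _ => trivial

theorem isClosed_iInter {A : UAlgebra σ} {ι : Sort*} {S : ι → Set A.carrier}
    (h : ∀ i, A.IsClosed (S i)) : A.IsClosed {x | ∀ i, x ∈ S i} :=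
  fun f x hx i => h i f x fun j => hx j i

theorem isClosed_forall_rel {A B : UAlgebra σ} (hB : B.Idempotent)
    {R : A.carrier → B.carrier → Prop}
    (hR : RelClosed A B R) (T : Set B.carrier) : A.IsClosed {a | ∀ b ∈ T, R a b} := by
  intro f x hx b hb
  have := hR f x (fun _ => b) fun j => hx j b hb
  rwa [hB] at this

theorem isClosed_image_rel {A B : UAlgebra σ}
    {R : A.carrier → B.carrier → Prop}
    (hR : RelClosed A B R) {T : Set B.carrier} (hT : B.IsClosed T) :
    A.IsClosed {a | ∃ b ∈ T, R a b} := by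
  intro f x hx
  choose b hb h using hx
  exact ⟨_, hT f b hb, hR f x b h⟩

theorem idem_prod {A B : UAlgebra σ} (hA : A.Idempotent) (hB : B.Idempotent) :
    (A.prod B).Idempotent := fun f x => Prod.ext (hA f x.1) (hB f x.2)

theorem idem_subalg {A : UAlgebra σ} (hA : A.Idempotent) (S : Set A.carrier)
    (hS : A.IsClosed S) : (A.subalg S hS).Idempotent :=
  fun f x => Subtype.ext (hA f x.1)

theorem idem_pi {ι : Type} {A : ι → UAlgebra σ} (hA : ∀ i, (A i).Idempotent) :
    (UAlgebra.pi A).Idempotent := fun f x => funext fun i => hA i f (x i)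

theorem idem_image {A B : UAlgebra σ} {g : A.carrier → B.carrier} (hg : A.IsHom B g)
    (hs : Function.Surjective g) (hA : A.Idempotent) : B.Idempotent := by
  intro f b
  obtain ⟨a, rfl⟩ := hs b
  rw [← hg f (fun _ => a), hA]

/-- No simple factor of a two-generated subalgebra that separates the generators is a set
or affine. -/
def InV (A : UAlgebra σ) : Prop :=
  ∀ (a b : A.carrier) (B : UAlgebra σ) (g : A.carrier → B.carrier),
    (∀ (f : σ.ops) (x : Fin (σ.arity f) → A.carrier), (∀ j, x j ∈ A.ClosureSet {a, b}) →
      g (A.interp f x) = B.interp f fun j => g (x j)) →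
    (∀ y, ∃ x ∈ A.ClosureSet {a, b}, g x = y) → g a ≠ g b → B.IsSimple →
    ¬ IsSetAlgebra B ∧ ¬ IsAffineAlgebra B

theorem closure_subalg {A : UAlgebra σ} {T : Set A.carrier} (hT : A.IsClosed T)
    {X : Set (A.subalg T hT).carrier} {x : A.carrier}
    (hx : x ∈ A.ClosureSet ((fun y : (A.subalg T hT).carrier => y.1) '' X)) :
    ∃ h : x ∈ T, (⟨x, h⟩ : (A.subalg T hT).carrier) ∈ (A.subalg T hT).ClosureSet X := by
  induction hx with
  | base h => obtain ⟨y, hy, rfl⟩ := h; exact ⟨y.2, Closure.base hy⟩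
  | app f y _ ih =>
    choose h1 h2 using ih
    exact ⟨hT f y h1, Closure.app (A := A.subalg T hT) f (fun j => ⟨y j, h1 j⟩) h2⟩

theorem closure_hom {A B : UAlgebra σ} {g : A.carrier → B.carrier} (hg : A.IsHom B g)
    {X : Set A.carrier} {y : B.carrier} :
    y ∈ B.ClosureSet (g '' X) ↔ ∃ x ∈ A.ClosureSet X, g x = y := by
  constructor
  · intro hy
    induction hy with
    | base h => obtain ⟨x, hx, rfl⟩ := h; exact ⟨x, Closure.base hx, rfl⟩
    | app f y _ ih =>
      choose x hx h using ih
      exact ⟨_, Closure.app f x hx, by rw [hg]; simp only [h]⟩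
  · rintro ⟨x, hx, rfl⟩
    exact closure_min (S := {x | g x ∈ B.ClosureSet (g '' X)})
      (fun x hx => subset_closure B _ ⟨x, hx, rfl⟩)
      (isClosed_preimage hg (closureSet_isClosed B _)) hx

theorem InV.subalg {A : UAlgebra σ} (hA : InV A) {T : Set A.carrier} (hT : A.IsClosed T) :
    InV (A.subalg T hT) := by
  classical
  intro a b B g hg hs hab hB
  have hcl : ∀ x ∈ A.ClosureSet {a.1, b.1}, ∃ h : x ∈ T,
      (⟨x, h⟩ : (A.subalg T hT).carrier) ∈ (A.subalg T hT).ClosureSet {a, b} := by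
    intro x hx
    apply closure_subalg
    rw [Set.image_pair]; exact hx
  refine hA a.1 b.1 B (fun x => if h : x ∈ T then g ⟨x, h⟩ else g a) ?_ ?_ ?_ hB
  · intro f x hx
    have h1 : ∀ j, x j ∈ T := fun j => (hcl _ (hx j)).1
    have h2 : A.interp f x ∈ T := hT f x h1
    simp only [h1, h2, dif_pos]
    exact hg f (fun j => ⟨x j, h1 j⟩) fun j => (hcl _ (hx j)).2
  · intro y
    obtain ⟨x, hx, rfl⟩ := hs y
    refine ⟨x.1, ?_, dif_pos x.2⟩
    have := (closure_hom (isHom_subalg A T hT) (X := {a, b})).2 ⟨x, hx, rfl⟩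
    rwa [Set.image_pair] at this
  · rw [dif_pos a.2, dif_pos b.2]; exact hab

theorem InV.image {A B : UAlgebra σ} (hA : InV A) {h : A.carrier → B.carrier}
    (hh : A.IsHom B h) (hs : Function.Surjective h) : InV B := by
  intro a b C g hg hsg hab hC
  obtain ⟨a, rfl⟩ := hs a
  obtain ⟨b, rfl⟩ := hs b
  have hcl : ∀ x ∈ A.ClosureSet {a, b}, h x ∈ B.ClosureSet {h a, h b} := by
    intro x hx
    have := (closure_hom hh (X := {a, b})).2 ⟨x, hx, rfl⟩
    rwa [Set.image_pair] at this
  refine hA a b C (fun x => g (h x)) ?_ ?_ hab hC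
  · intro f x hx
    rw [hh, hg f _ fun j => hcl _ (hx j)]
  · intro y
    obtain ⟨x, hx, rfl⟩ := hsg y
    rw [← Set.image_pair, closure_hom hh] at hx
    obtain ⟨x, hx, rfl⟩ := hx
    exact ⟨x, hx, rfl⟩

theorem isSetAlgebra_image {A B : UAlgebra σ} {g : A.carrier → B.carrier} (hg : A.IsHom B g)
    (hs : Function.Surjective g) (h : IsSetAlgebra A) : IsSetAlgebra B := by
  intro n t
  obtain ⟨i, hi⟩ := h n t
  refine ⟨i, fun x => ?_⟩
  choose y hy using fun j => hs (x j)
  have := eval_hom hg t y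
  simp only [hy, hi] at this
  exact this.symm

theorem isAffineAlgebra_image {A B : UAlgebra σ} {g : A.carrier → B.carrier} (hg : A.IsHom B g)
    (hs : Function.Bijective g) (h : IsAffineAlgebra A) : IsAffineAlgebra B := by
  obtain ⟨R, iR, fR, iG, iM, h1, t, ht⟩ := h
  let e : A.carrier ≃ B.carrier := Equiv.ofBijective g hs
  let _ : AddCommGroup B.carrier := e.symm.addCommGroup
  let _ : Module R B.carrier := e.symm.module R
  let l : A.carrier ≃ₗ[R] B.carrier := (e.symm.linearEquiv R).symm
  have hl : ∀ x, l x = g x := fun x => rfl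
  have hl' : ∀ {n} (t : Term σ n) x, t.eval B x = l (t.eval A (fun j => l.symm (x j))) := by
    intro n t x
    rw [hl, eval_hom hg]
    congr 1; funext j; rw [← hl]; simp
  refine ⟨R, iR, fR, inferInstance, inferInstance, ?_, t, ?_⟩
  · intro n f
    have := h1 n (fun x => l.symm (f (fun j => l (x j))))
    constructor
    · rintro ⟨t, ht⟩
      obtain ⟨c, hc, hx⟩ := this.1 ⟨t, fun x => by rw [← ht, hl']; simp⟩
      refine ⟨c, hc, fun x => ?_⟩
      have := congrArg l (hx (fun j => l.symm (x j)))
      simpa using this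
    · rintro ⟨c, hc, hx⟩
      obtain ⟨t, ht⟩ := this.2 ⟨c, hc, fun x => by simp [hx]⟩
      exact ⟨t, fun x => by rw [hl', ht]; simp⟩
  · intro x y z
    rw [hl']
    have : (fun j => l.symm ((![x, y, z] : Fin 3 → B.carrier) j)) =
        ![l.symm x, l.symm y, l.symm z] := by
      funext j; fin_cases j <;> rfl
    rw [this, ht]; simp

theorem inV_of_omits {A : UAlgebra σ} (h1 : A.OmitsType1) (haf : A.AffineFree) : InV A := by
  intro a b B g hg hs hab hB
  have hne : a ≠ b := fun h => hab (by rw [h])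
  let g' : (A.Sg {a, b}).carrier → B.carrier := fun x => g x.1
  have hg' : (A.Sg {a, b}).IsHom B g' := fun f x => hg f (fun j => (x j).1) fun j => (x j).2
  let θ : Congruence (A.Sg {a, b}) :=
    { rel := fun x y => g' x = g' y
      refl := fun _ => rfl
      symm := fun h => h.symm
      trans := fun h h' => h.trans h'
      compat := fun f x y h => by rw [hg', hg', funext h] }
  let k : ((A.Sg {a, b}).quot θ).carrier → B.carrier := Quotient.lift g' fun _ _ h => h
  have hk : ((A.Sg {a, b}).quot θ).IsHom B k := by
    intro f x
    choose y hy using fun j => Quotient.exists_rep (x j)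
    have : x = fun j => Quotient.mk θ.toSetoid (y j) := funext fun j => (hy j).symm
    rw [this, quot_interp_mk]
    exact hg' f y
  have hkb : Function.Bijective k := by
    constructor
    · intro x y h
      induction x using Quotient.inductionOn
      induction y using Quotient.inductionOn
      exact Quotient.sound h
    · intro y
      obtain ⟨x, hx, rfl⟩ := hs y
      exact ⟨Quotient.mk _ ⟨x, hx⟩, rfl⟩
  let k' : B.carrier → ((A.Sg {a, b}).quot θ).carrier := (Equiv.ofBijective k hkb).symm
  have hkk : ∀ x, k (k' x) = x := (Equiv.ofBijective k hkb).apply_symm_apply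
  have hk'b : Function.Bijective k' := (Equiv.ofBijective k hkb).symm.bijective
  have hk' : B.IsHom ((A.Sg {a, b}).quot θ) k' := by
    intro f x
    apply hkb.1
    rw [hk, hkk]; simp only [hkk]
  have hmax : θ.IsMaximal := by
    refine ⟨fun h => hab (h (A.sgA a b) (A.sgB a b)), ?_⟩
    intro η hle hnf
    choose r hr hr' using hs
    let r' : B.carrier → (A.Sg {a, b}).carrier := fun y => ⟨r y, hr y⟩
    have hgr : ∀ y, g' (r' y) = y := hr'
    have hrel : ∀ x, η.rel (r' (g' x)) x := fun x => hle _ _ (hgr _)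
    let η' : Congruence B :=
      { rel := fun x y => η.rel (r' x) (r' y)
        refl := fun _ => η.refl _
        symm := fun h => η.symm h
        trans := fun h h' => η.trans h h'
        compat := fun f x y h => by
          have h1 := η.compat f (fun j => r' (x j)) (fun j => r' (y j)) h
          have h2 : ∀ z : Fin (σ.arity f) → B.carrier, η.rel (r' (B.interp f z))
              ((A.Sg {a, b}).interp f fun j => r' (z j)) := by
            intro z
            apply hle
            change g' _ = g' _
            rw [hgr, hg']; simp only [hgr]
          exact η.trans (h2 x) (η.trans h1 (η.symm (h2 y))) }
    rcases hB η' with h | h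
    · intro x y hxy
      apply (h _ _).1
      exact η.trans (hrel x) (η.trans hxy (η.symm (hrel y)))
    · exact absurd (fun x y => η.trans (η.symm (hrel x)) (η.trans (h _ _) (hrel y))) hnf
  constructor
  · intro hset
    have hset' := isSetAlgebra_image hk' hk'b.2 hset
    have hU := isClosed_univ A
    let i : A.carrier → (A.subalg Set.univ hU).carrier := fun x => ⟨x, trivial⟩
    have hi : A.IsHom (A.subalg Set.univ hU) i := fun _ _ => rfl
    apply h1 Set.univ hU (i a) (i b)
    refine ⟨fun h => hne (congrArg Subtype.val h), ?_⟩
    have hc : ∀ x : (A.subalg Set.univ hU).carrier,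
        x ∈ (A.subalg Set.univ hU).ClosureSet {i a, i b} ↔ x.1 ∈ A.ClosureSet {a, b} := by
      intro x
      rw [← Set.image_pair, closure_hom hi]
      constructor
      · rintro ⟨y, hy, rfl⟩; exact hy
      · intro h; exact ⟨x.1, h, rfl⟩
    let q : ((A.subalg Set.univ hU).Sg {i a, i b}).carrier → (A.Sg {a, b}).carrier :=
      fun x => ⟨x.1.1, (hc x.1).1 x.2⟩
    have hq : ((A.subalg Set.univ hU).Sg {i a, i b}).IsHom (A.Sg {a, b}) q := fun _ _ => rfl
    let p : (A.Sg {a, b}).carrier → ((A.subalg Set.univ hU).Sg {i a, i b}).carrier :=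
      fun x => ⟨i x.1, (hc (i x.1)).2 x.2⟩
    have hp : (A.Sg {a, b}).IsHom ((A.subalg Set.univ hU).Sg {i a, i b}) p := fun _ _ => rfl
    let ζ : Congruence ((A.subalg Set.univ hU).Sg {i a, i b}) :=
      { rel := fun x y => θ.rel (q x) (q y)
        refl := fun _ => θ.refl _
        symm := fun h => θ.symm h
        trans := fun h h' => θ.trans h h'
        compat := fun f x y h => θ.compat f _ _ h }
    refine ⟨ζ, ⟨fun h => hmax.1 fun x y => h (p x) (p y), ?_⟩, ?_⟩
    · intro η hle hnf
      let η' : Congruence (A.Sg {a, b}) :=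
        { rel := fun x y => η.rel (p x) (p y)
          refl := fun _ => η.refl _
          symm := fun h => η.symm h
          trans := fun h h' => η.trans h h'
          compat := fun f x y h => η.compat f _ _ h }
      intro x y hxy
      exact hmax.2 η' (fun x y h => hle _ _ h) (fun h => hnf fun x y => h (q x) (q y)) _ _ hxy
    · have hm : ((A.Sg {a, b}).quot θ).IsHom
          (((A.subalg Set.univ hU).Sg {i a, i b}).quot ζ)
          (Quotient.lift (fun x => Quotient.mk ζ.toSetoid (p x))
            fun _ _ h => Quotient.sound h) := by
        intro f x
        choose y hy using fun j => Quotient.exists_rep (x j)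
        have : x = fun j => Quotient.mk θ.toSetoid (y j) := funext fun j => (hy j).symm
        rw [this, quot_interp_mk]
        exact (quot_interp_mk _ ζ f fun j => p (y j)).symm
      refine isSetAlgebra_image hm ?_ hset'
      intro y
      induction y using Quotient.inductionOn with
      | h y => exact ⟨Quotient.mk _ (q y), rfl⟩
  · intro haff
    exact haf a b ⟨hne, θ, hmax, isAffineAlgebra_image hk' hk'b haff⟩

/-- No proper nonempty closed subset is absorbed by a binary term. -/
def BAFree (E : UAlgebra σ) : Prop :=
  ∀ B : Set E.carrier, E.IsClosed B → B.Nonempty →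
    (∃ t : Term σ 2, ∀ a ∈ B, ∀ e, t.eval E ![a, e] ∈ B ∧ t.eval E ![e, a] ∈ B) → B = Set.univ

/-- There is a term that can reach every value with any of its arguments fixed arbitrarily. -/
def TransTerm (E : UAlgebra σ) : Prop :=
  ∃ (n : ℕ) (t : Term σ n), 0 < n ∧ ∀ i a b, ∃ x, x i = a ∧ t.eval E x = b

/-- Composition of `t` with `u` in every argument, with disjoint sets of variables. -/
def star {n m : ℕ} (t : Term σ n) (u : Term σ m) : Term σ (n * m) :=
  tbind t fun i => tbind u fun j => .var (finProdFinEquiv (i, j))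

theorem eval_star (E : UAlgebra σ) {n m : ℕ} (t : Term σ n) (u : Term σ m)
    (X : Fin (n * m) → E.carrier) : (star t u).eval E X =
      t.eval E fun i => u.eval E fun j => X (finProdFinEquiv (i, j)) := by
  simp only [star, eval_tbind]; rfl

/-- The values of a term with the `i`th argument in `B`. -/
def cim {E : UAlgebra σ} {n : ℕ} (t : Term σ n) (i : Fin n) (B : Set E.carrier) :
    Set E.carrier := {b | ∃ x, x i ∈ B ∧ t.eval E x = b}

theorem cim_mono {E : UAlgebra σ} {n : ℕ} (t : Term σ n) (i : Fin n) {B C : Set E.carrier}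
    (h : B ⊆ C) : cim t i B ⊆ cim t i C := fun _ ⟨x, hx, e⟩ => ⟨x, h hx, e⟩

theorem subset_cim {E : UAlgebra σ} (hE : E.Idempotent) {n : ℕ} (t : Term σ n) (i : Fin n)
    (B : Set E.carrier) : B ⊆ cim t i B := fun b hb => ⟨fun _ => b, hb, eval_idem hE t b⟩

theorem cim_star {E : UAlgebra σ} (hE : E.Idempotent) {n m : ℕ} (t : Term σ n) (u : Term σ m)
    (i : Fin n) (j : Fin m) (B : Set E.carrier) :
    cim t i (cim u j B) ⊆ cim (star t u) (finProdFinEquiv (i, j)) B := by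
  rintro _ ⟨y, ⟨x, hx, hxy⟩, rfl⟩
  refine ⟨fun k => if (finProdFinEquiv.symm k).1 = i then x (finProdFinEquiv.symm k).2
    else y (finProdFinEquiv.symm k).1, ?_, ?_⟩
  · simpa using hx
  · rw [eval_star]
    congr 1
    funext i'
    by_cases h : i' = i
    · subst h; simpa using hxy
    · simpa [h] using eval_idem hE u (y i')

theorem exists_expanding {E : UAlgebra σ} (hE : E.Idempotent) (F : Set (Set E.carrier))
    (hF : F.Finite) (h : ∀ B ∈ F, ∃ (n : ℕ) (t : Term σ n), 0 < n ∧ ∀ i, ¬ cim t i B ⊆ B) :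
    ∃ (n : ℕ) (t : Term σ n), 0 < n ∧ ∀ B ∈ F, ∀ i, ¬ cim t i B ⊆ B := by
  induction F, hF using Set.Finite.induction_on with
  | empty => exact ⟨1, .var 0, one_pos, by simp⟩
  | @insert B F _ _ ih =>
    obtain ⟨n, t, hn, ht⟩ := h B (by simp)
    obtain ⟨m, u, hm, hu⟩ := ih fun C hC => h C (by simp [hC])
    refine ⟨n * m, star t u, Nat.mul_pos hn hm, fun C hC k => ?_⟩
    obtain ⟨⟨i, j⟩, rfl⟩ := finProdFinEquiv.surjective k
    intro hk
    have hk := (cim_star hE t u i j C).trans hk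
    rcases Set.mem_insert_iff.1 hC with rfl | hC
    · exact ht i ((cim_mono t i (subset_cim hE u j C)).trans hk)
    · exact hu C hC j ((subset_cim hE t i _).trans hk)

theorem transTerm_of_expanding {E : UAlgebra σ} [Finite E.carrier] (hE : E.Idempotent)
    (h : ∀ B : Set E.carrier, B.Nonempty → B ≠ Set.univ →
      ∃ (n : ℕ) (t : Term σ n), 0 < n ∧ ∀ i, ¬ cim t i B ⊆ B) : TransTerm E := by
  obtain ⟨m, u, hm, hu⟩ := exists_expanding hE {B | B.Nonempty ∧ B ≠ Set.univ}
    (Set.toFinite _) fun B hB => h B hB.1 hB.2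
  have key : ∀ k : ℕ, ∃ (n : ℕ) (t : Term σ n), 0 < n ∧ ∀ i (a : E.carrier),
      k ≤ (cim t i {a}).ncard ∨ cim t i {a} = Set.univ := by
    intro k
    induction k with
    | zero => exact ⟨1, .var 0, one_pos, fun _ _ => Or.inl (Nat.zero_le _)⟩
    | succ k ih =>
      obtain ⟨n, t, hn, ht⟩ := ih
      refine ⟨m * n, star u t, Nat.mul_pos hm hn, fun l a => ?_⟩
      obtain ⟨⟨i, j⟩, rfl⟩ := finProdFinEquiv.surjective l
      have h1 := cim_star hE u t i j {a}
      by_cases hU : cim t j {a} = Set.univ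
      · right
        rw [hU] at h1
        exact Set.eq_univ_of_univ_subset ((subset_cim hE u i _).trans h1)
      · left
        have h2 := hu (cim t j {a}) ⟨⟨a, subset_cim hE t j _ rfl⟩, hU⟩ i
        have h3 : cim t j {a} ⊂ cim u i (cim t j {a}) := ⟨subset_cim hE u i _, h2⟩
        have h4 := Set.ncard_lt_ncard h3 (Set.toFinite _)
        have h5 := Set.ncard_le_ncard h1 (Set.toFinite _)
        have h6 := (ht j a).resolve_right hU
        omega
  obtain ⟨n, t, hn, ht⟩ := key (Nat.card E.carrier + 1)
  refine ⟨n, t, hn, fun i a b => ?_⟩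
  have h1 := (ht i a).resolve_left fun h' => by
    have := Set.ncard_le_ncard (Set.subset_univ (cim t i {a})) (Set.toFinite _)
    rw [Set.ncard_univ] at this
    omega
  have : b ∈ cim t i {a} := h1 ▸ Set.mem_univ b
  exact this

theorem mono_pair {α : Type} (x : Fin 2 → α) : x = ![x 0, x 1] := by
  funext j; fin_cases j <;> rfl

/-- The term `u(v(x, y), y)`. -/
def comp₂ (u v : Term σ 2) : Term σ 2 := tbind u ![v, .var 1]

theorem eval_comp₂ (E : UAlgebra σ) (u v : Term σ 2) (x y : E.carrier) :
    (comp₂ u v).eval E ![x, y] = u.eval E ![v.eval E ![x, y], y] := by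
  rw [comp₂, eval_tbind]; congr 1; funext j; fin_cases j <;> rfl

/-- The two-element algebra in which each operation is a chosen projection. -/
def projAlg (p : ∀ f : σ.ops, Fin (σ.arity f)) : UAlgebra σ where
  carrier := Bool
  interp f x := x (p f)

theorem isSetAlgebra_projAlg (p : ∀ f : σ.ops, Fin (σ.arity f)) : IsSetAlgebra (projAlg p) := by
  intro n t
  induction t with
  | var i => exact ⟨i, fun _ => rfl⟩
  | app f ts ih =>
    obtain ⟨i, hi⟩ := ih (p f)
    exact ⟨i, fun x => hi x⟩

theorem isSimple_projAlg (p : ∀ f : σ.ops, Fin (σ.arity f)) : (projAlg p).IsSimple := by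
  intro θ
  by_cases h : θ.rel true false
  · right
    intro x y
    change Bool at x y
    cases x <;> cases y
    · exact θ.refl _
    · exact θ.symm h
    · exact h
    · exact θ.refl _
  · left
    intro x y
    constructor
    · intro hxy
      change Bool at x y
      cases x <;> cases y
      · rfl
      · exact absurd (θ.symm hxy) h
      · exact absurd hxy h
      · rfl
    · rintro rfl; exact θ.refl _

theorem transTerm_of_BAFree {E : UAlgebra σ} [Finite E.carrier] (hE : E.Idempotent)
    (hBA : BAFree E) (hV : InV E) : TransTerm E := by
  classical
  apply transTerm_of_expanding hE
  by_contra! hcon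
  obtain ⟨B, ⟨b0, hb0⟩, hBu, hB⟩ := hcon
  obtain ⟨a0, ha0⟩ := (Set.ne_univ_iff_exists_notMem B).1 hBu
  have hgood : ∀ (n : ℕ) (t : Term σ n), ∃ i, ∀ x, x i ∈ B → t.eval E x ∈ B := by
    intro n t
    rcases Nat.eq_zero_or_pos n with rfl | hn
    · exfalso
      have h1 := eval_idem hE t a0
      have h2 := eval_idem hE t b0
      rw [Subsingleton.elim (fun _ : Fin 0 => a0) (fun _ => b0), h2] at h1
      exact ha0 (h1 ▸ hb0)
    · obtain ⟨i, hi⟩ := hB n t hn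
      exact ⟨i, fun x hx => hi ⟨x, hx, rfl⟩⟩
  have hop : ∀ f : σ.ops, ∃ i, ∀ x, x i ∈ B → E.interp f x ∈ B := fun f =>
    hgood _ (.app f fun j => .var j)
  choose p hp using hop
  have hcl : E.IsClosed B := fun f x hx => hp f x (hx _)
  have hnot : ∀ t : Term σ 2, (∀ x ∈ B, ∀ y, t.eval E ![x, y] ∈ B) →
      ¬ (∀ x ∈ B, ∀ y, t.eval E ![y, x] ∈ B) := fun t h1 h2 =>
    hBu (hBA B hcl ⟨b0, hb0⟩ ⟨t, fun a ha e => ⟨h1 a ha e, h2 a ha e⟩⟩)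
  have hor : ∀ t : Term σ 2, (∀ x ∈ B, ∀ y, t.eval E ![x, y] ∈ B) ∨
      (∀ x ∈ B, ∀ y, t.eval E ![y, x] ∈ B) := by
    intro t
    obtain ⟨i, hi⟩ := hgood 2 t
    fin_cases i
    · exact Or.inl fun x hx y => hi ![x, y] hx
    · exact Or.inr fun x hx y => hi ![y, x] hx
  have hclaim : ∃ a, a ∉ B ∧ ∃ b ∈ B, ∀ u : Term σ 2,
      (∀ x ∈ B, ∀ y, u.eval E ![x, y] ∈ B) → u.eval E ![a, b] ∉ B := by
    by_contra! hc
    have hc' : ∀ a, ∀ b ∈ B, ∃ u : Term σ 2, (∀ x ∈ B, ∀ y, u.eval E ![x, y] ∈ B) ∧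
        u.eval E ![a, b] ∈ B := by
      intro a b hb
      by_cases ha : a ∈ B
      · exact ⟨.var 0, fun x hx _ => hx, ha⟩
      · exact hc a ha b hb
    have hall : ∀ P : Set (E.carrier × E.carrier), P.Finite → ∃ v : Term σ 2,
        (∀ x ∈ B, ∀ y, v.eval E ![x, y] ∈ B) ∧
        ∀ q ∈ P, q.2 ∈ B → v.eval E ![q.1, q.2] ∈ B := by
      intro P hP
      induction P, hP using Set.Finite.induction_on with
      | empty => exact ⟨.var 0, fun x hx _ => hx, by simp⟩
      | @insert q P _ _ ih =>
        obtain ⟨v, hv, hvP⟩ := ih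
        by_cases hq : q.2 ∈ B
        · obtain ⟨u, hu, hu'⟩ := hc' (v.eval E ![q.1, q.2]) q.2 hq
          refine ⟨comp₂ u v, fun x hx y => ?_, fun r hr hrB => ?_⟩
          · rw [eval_comp₂]; exact hu _ (hv x hx y) y
          · rw [eval_comp₂]
            rcases Set.mem_insert_iff.1 hr with rfl | hr
            · exact hu'
            · exact hu _ (hvP r hr hrB) _
        · refine ⟨v, hv, fun r hr hrB => ?_⟩
          rcases Set.mem_insert_iff.1 hr with rfl | hr
          · exact absurd hrB hq
          · exact hvP r hr hrB
    obtain ⟨v, hv, hvP⟩ := hall Set.univ (Set.toFinite _)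
    exact hnot v hv fun x hx y => hvP (y, x) trivial hx
  obtain ⟨a, ha, b, hb, hab⟩ := hclaim
  refine (hV a b (projAlg p) (fun x => decide (x ∈ B)) ?_ ?_ ?_ (isSimple_projAlg p)).1
    (isSetAlgebra_projAlg p)
  · intro f x hx
    choose u hu using fun j => exists_term_pair (hx j)
    change decide _ = decide _
    rw [decide_eq_decide]
    constructor
    · intro h
      by_contra hxi
      have h0 : ∀ y ∈ B, ∀ z, (u (p f)).eval E ![y, z] ∈ B := by
        rcases hor (u (p f)) with h0 | h1
        · exact h0
        · have := h1 b hb a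
          rw [hu] at this
          exact absurd this hxi
      refine hab (.app f u) (fun y hy z => hp f _ (h0 y hy z)) ?_
      simp only [Term.eval, hu]; exact h
    · exact fun h => hp f x h
  · intro y
    change Bool at y
    cases y
    · exact ⟨a, left_mem_pair E a b, decide_eq_false ha⟩
    · exact ⟨b, right_mem_pair E a b, decide_eq_true hb⟩
  · intro h
    exact ha ((decide_eq_decide.1 h).2 hb)

/-- `C` has the 2-Helly property: every invariant relation meeting `C` in any two coordinates
meets `C` in all coordinates simultaneously. -/
def H2 (A : UAlgebra σ) (C : Set A.carrier) : Prop :=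
  ∀ (B : UAlgebra σ) (R : Set B.carrier), B.IsClosed R → R.Nonempty →
    ∀ (ι : Type) [Finite ι] (f : ι → B.carrier → A.carrier), (∀ i, B.IsHom A (f i)) →
      (∀ i j, ∃ r ∈ R, f i r ∈ C ∧ f j r ∈ C) → ∃ r ∈ R, ∀ i, f i r ∈ C

/-- No proper nonempty closed subset has the 2-Helly property. -/
def H2Free (A : UAlgebra σ) : Prop :=
  ∀ C : Set A.carrier, A.IsClosed C → C.Nonempty → H2 A C → C = Set.univ

theorem comp_pair {α β : Type} (g : α → β) (x y : α) :
    (fun j => g ((![x, y] : Fin 2 → α) j)) = ![g x, g y] := by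
  funext j; fin_cases j <;> rfl

theorem H2_of_absorbing {A : UAlgebra σ} {C : Set A.carrier} (t : Term σ 2)
    (ht : ∀ a ∈ C, ∀ e, t.eval A ![a, e] ∈ C ∧ t.eval A ![e, a] ∈ C) : H2 A C := by
  intro B R hR hRn ι _ f hf h
  have : ∀ J : Set ι, J.Finite → ∃ r ∈ R, ∀ i ∈ J, f i r ∈ C := by
    intro J hJ
    induction J, hJ using Set.Finite.induction_on with
    | empty => obtain ⟨r, hr⟩ := hRn; exact ⟨r, hr, by simp⟩
    | @insert i J _ _ ih =>
      obtain ⟨r, hr, hrJ⟩ := ih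
      obtain ⟨r', hr', hi, -⟩ := h i i
      refine ⟨t.eval B ![r, r'], eval_mem hR t _ fun j => ?_, fun k hk => ?_⟩
      · fin_cases j <;> assumption
      · rw [eval_hom (hf k), comp_pair]
        rcases Set.mem_insert_iff.1 hk with rfl | hk
        · exact (ht _ hi _).2
        · exact (ht _ (hrJ k hk) _).1
  obtain ⟨r, hr, h⟩ := this Set.univ (Set.toFinite _)
  exact ⟨r, hr, fun i => h i trivial⟩

theorem H2Free.BAFree {A : UAlgebra σ} (hA : H2Free A) : BAFree A :=
  fun B hB hn ⟨t, ht⟩ => hA B hB hn (H2_of_absorbing t ht)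

theorem TransTerm.absorbs {A E : UAlgebra σ} {n : ℕ} {t : Term σ n}
    (ht : ∀ i a b, ∃ x, x i = a ∧ t.eval E x = b) {R : A.carrier → E.carrier → Prop}
    (hR : RelClosed A E R) (i : Fin n) (x : Fin n → A.carrier) (hl : ∃ e, R (x i) e)
    (hx : ∀ j, j ≠ i → ∀ e, R (x j) e) : ∀ e, R (t.eval A x) e := by
  intro e
  obtain ⟨d, hd⟩ := hl
  obtain ⟨y, hy, rfl⟩ := ht i d e
  refine hR.eval t x y fun j => ?_
  by_cases hj : j = i
  · subst hj; rwa [hy]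
  · exact hx j hj _

/-- The family `f` on `R` meets `C` in all but any one coordinate, but not in all. -/
def EssOn {A : UAlgebra σ} (C : Set A.carrier) {B : UAlgebra σ} (R : Set B.carrier) {ι : Type}
    (f : ι → B.carrier → A.carrier) : Prop :=
  (¬ ∃ r ∈ R, ∀ i, f i r ∈ C) ∧ ∀ i, ∃ r ∈ R, ∀ j, j ≠ i → f j r ∈ C

/-- There is an essential relation of `C` with index set `ι`. -/
def Ess (A : UAlgebra σ) (C : Set A.carrier) (ι : Type) : Prop :=
  ∃ (B : UAlgebra σ) (R : Set B.carrier) (f : ι → B.carrier → A.carrier),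
    B.IsClosed R ∧ (∀ i, B.IsHom A (f i)) ∧ EssOn C R f

theorem Ess.congr {A : UAlgebra σ} {C : Set A.carrier} {ι κ : Type} (e : κ ≃ ι)
    (h : Ess A C ι) : Ess A C κ := by
  obtain ⟨B, R, f, hR, hf, h1, h2⟩ := h
  refine ⟨B, R, fun k => f (e k), hR, fun k => hf _, ?_, fun k => ?_⟩
  · rintro ⟨r, hr, h⟩
    exact h1 ⟨r, hr, fun i => by simpa using h (e.symm i)⟩
  · obtain ⟨r, hr, h⟩ := h2 (e k)
    exact ⟨r, hr, fun j hj => h _ fun h' => hj (e.injective h')⟩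

theorem Ess.descend {A : UAlgebra σ} {C : Set A.carrier} (hC : A.IsClosed C) {κ : Type}
    (h : Ess A C (Option κ)) : Ess A C κ := by
  obtain ⟨B, R, f, hR, hf, h1, h2⟩ := h
  refine ⟨B, R ∩ {r | f none r ∈ C}, fun k => f (some k),
    isClosed_inter hR (isClosed_preimage (hf none) hC), fun k => hf _, ?_, fun k => ?_⟩
  · rintro ⟨r, ⟨hr, hr'⟩, h⟩
    refine h1 ⟨r, hr, fun i => ?_⟩
    cases i with
    | none => exact hr'
    | some k => exact h k
  · obtain ⟨r, hr, h⟩ := h2 (some k)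
    exact ⟨r, ⟨hr, h none (by simp)⟩, fun j hj => h _ (by simpa using hj)⟩

theorem Ess.fin_le {A : UAlgebra σ} {C : Set A.carrier} (hC : A.IsClosed C) {m n : ℕ}
    (h : Ess A C (Fin n)) (hmn : m ≤ n) : Ess A C (Fin m) := by
  induction n, hmn using Nat.le_induction with
  | base => exact h
  | succ k _ ih => exact ih ((h.congr (finSuccEquiv k).symm).descend hC)

theorem not_mem_closure_cross {A E : UAlgebra σ} (hA : A.Idempotent) (hBA : BAFree E)
    {R : A.carrier → E.carrier → Prop} (hR : RelClosed A E R) (hl : ∀ a, ∃ e, R a e)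
    {a : A.carrier} (ha : ¬ ∀ e, R a e) :
    ((a, a) : (A.prod A).carrier) ∉
      (A.prod A).ClosureSet {p | p.1 = a ∧ (∀ e, R p.2 e) ∨ (∀ e, R p.1 e) ∧ p.2 = a} := by
  have key : ∀ p ∈ (A.prod A).ClosureSet
      {p | p.1 = a ∧ (∀ e, R p.2 e) ∨ (∀ e, R p.1 e) ∧ p.2 = a},
      ∃ t : Term σ 2, ∀ b, R a b → ∀ e, R p.1 (t.eval E ![b, e]) ∧ R p.2 (t.eval E ![e, b]) := by
    intro p hp
    induction hp with
    | @base p h =>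
      rcases h with ⟨h1, h2⟩ | ⟨h1, h2⟩
      · exact ⟨.var 0, fun b hb e => ⟨h1 ▸ hb, h2 _⟩⟩
      · exact ⟨.var 1, fun b hb e => ⟨h1 _, h2 ▸ hb⟩⟩
    | app f x _ ih =>
      choose t ht using ih
      exact ⟨.app f t, fun b hb e => ⟨hR f _ _ fun j => (ht j b hb e).1,
        hR f _ _ fun j => (ht j b hb e).2⟩⟩
  intro h
  obtain ⟨t, ht⟩ := key _ h
  have := hBA {b | R a b} (fun f x hx => by
    have := hR f (fun _ => a) x hx
    rwa [hA] at this) (hl a) ⟨t, fun b hb e => ht b hb e⟩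
  exact ha fun e => by
    have h : e ∈ {b | R a b} := this ▸ Set.mem_univ e
    exact h

theorem Ess.double {A : UAlgebra σ} [Finite A.carrier] (hA : A.Idempotent)
    {C : Set A.carrier} (hC : A.IsClosed C)
    (hQ : ∀ a ∉ C, ((a, a) : (A.prod A).carrier) ∉
      (A.prod A).ClosureSet {p | p.1 = a ∧ p.2 ∈ C ∨ p.1 ∈ C ∧ p.2 = a})
    {κ : Type} (h : Ess A C (Option κ)) : Ess A C (κ ⊕ κ) := by
  classical
  obtain ⟨B, R₁, f, hR₁, hf, hE₁⟩ := h
  let D : Set B.carrier → Set A.carrier := fun R => {d | ∃ r ∈ R, (∀ k, f (some k) r ∈ C) ∧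
    f none r = d}
  have hex : ∃ n, ∃ R : Set B.carrier, B.IsClosed R ∧ EssOn C R f ∧ (D R).ncard = n :=
    ⟨_, R₁, hR₁, hE₁, rfl⟩
  obtain ⟨R, hR, ⟨hE1, hE2⟩, hRn⟩ := Nat.find_spec hex
  have hmin : ∀ U : Set A.carrier, A.IsClosed U → C ⊆ U → (∃ d ∈ D R, d ∈ U) → D R ⊆ U := by
    intro U hU hCU hd
    have hE' : EssOn C (R ∩ {r | f none r ∈ U}) f := by
      refine ⟨fun ⟨r, hr, h⟩ => hE1 ⟨r, hr.1, h⟩, fun i => ?_⟩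
      cases i with
      | none =>
        obtain ⟨_, ⟨r, hr, h, rfl⟩, hrU⟩ := hd
        refine ⟨r, ⟨hr, hrU⟩, fun j hj => ?_⟩
        cases j with
        | none => exact absurd rfl hj
        | some k => exact h k
      | some k =>
        obtain ⟨r, hr, h⟩ := hE2 (some k)
        exact ⟨r, ⟨hr, hCU (h none (by simp))⟩, h⟩
    have h1 := Nat.find_min' hex ⟨_, isClosed_inter hR (isClosed_preimage (hf none) hU), hE', rfl⟩
    rw [← hRn] at h1
    have hsub : D (R ∩ {r | f none r ∈ U}) ⊆ D R := fun d ⟨r, hr, h⟩ => ⟨r, hr.1, h⟩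
    have h2 := Set.eq_of_subset_of_ncard_le hsub h1 (Set.toFinite _)
    intro d hd
    rw [← h2] at hd
    obtain ⟨r, hr, -, rfl⟩ := hd
    exact hr.2
  have hDC : ∀ d ∈ D R, d ∉ C := by
    rintro _ ⟨r, hr, h, rfl⟩ hd
    refine hE1 ⟨r, hr, fun i => ?_⟩
    cases i with
    | none => exact hd
    | some k => exact h k
  have hDcl : A.IsClosed (D R) := by
    intro g x hx
    choose r hr h e using hx
    refine ⟨_, hR g r hr, fun k => ?_, ?_⟩
    · rw [hf]; exact hC g _ fun j => h j k
    · rw [hf]; simp only [e]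
  obtain ⟨a, ha⟩ : (D R).Nonempty := by
    obtain ⟨r, hr, h⟩ := hE2 none
    exact ⟨_, r, hr, fun k => h _ (by simp), rfl⟩
  let Q : Set (A.prod A).carrier :=
    (A.prod A).ClosureSet {p | p.1 = a ∧ p.2 ∈ C ∨ p.1 ∈ C ∧ p.2 = a}
  have hQcl : (A.prod A).IsClosed Q := closureSet_isClosed _ _
  have hQr : RelClosed A A fun x y => ((x, y) : (A.prod A).carrier) ∈ Q :=
    fun g x y h => hQcl g (fun j => (x j, y j)) h
  have hsymm : ∀ p ∈ Q, ((p.2, p.1) : (A.prod A).carrier) ∈ Q := by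
    apply closure_min
    · rintro p (h | h)
      · exact Closure.base (Or.inr ⟨h.2, h.1⟩)
      · exact Closure.base (Or.inl ⟨h.2, h.1⟩)
    · exact isClosed_preimage (A := A.prod A) (B := A.prod A) (g := fun p => (p.2, p.1))
        (fun _ _ => rfl) hQcl
  have hU1 : ∀ d ∈ D R, ((d, a) : (A.prod A).carrier) ∉ Q := by
    intro d hd hdQ
    have := hmin {u | ∃ v ∈ ({a} : Set A.carrier), ((u, v) : (A.prod A).carrier) ∈ Q}
      (isClosed_image_rel hQr (isClosed_singleton hA a))
      (fun c hc => ⟨a, rfl, Closure.base (Or.inr ⟨hc, rfl⟩)⟩) ⟨d, hd, a, rfl, hdQ⟩ ha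
    obtain ⟨_, rfl, h⟩ := this
    exact hQ _ (hDC _ ha) h
  have hU2 : ∀ d ∈ D R, ∀ e ∈ D R, ((d, e) : (A.prod A).carrier) ∉ Q := by
    intro d hd e he hdQ
    have := hmin {u | ∃ v ∈ D R, ((u, v) : (A.prod A).carrier) ∈ Q}
      (isClosed_image_rel hQr hDcl)
      (fun c hc => ⟨a, ha, Closure.base (Or.inr ⟨hc, rfl⟩)⟩) ⟨d, hd, e, he, hdQ⟩ ha
    obtain ⟨v, hv, h⟩ := this
    exact hU1 v hv (hsymm _ h)
  obtain ⟨ra, hra, hraC, hraa⟩ := ha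
  refine ⟨B.prod B, {p | p.1 ∈ R ∧ p.2 ∈ R ∧ ((f none p.1, f none p.2) : (A.prod A).carrier) ∈ Q},
    fun i p => i.elim (fun k => f (some k) p.1) (fun k => f (some k) p.2), ?_, ?_, ?_, ?_⟩
  · intro g x hx
    refine ⟨hR g _ fun j => (hx j).1, hR g _ fun j => (hx j).2.1, ?_⟩
    have := hQcl g _ fun j => (hx j).2.2
    change (f none (B.interp g _), f none (B.interp g _)) ∈ Q
    rw [hf, hf]; exact this
  · rintro (k | k)
    · exact isHom_comp (hf _) (isHom_fst B B)
    · exact isHom_comp (hf _) (isHom_snd B B)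
  · rintro ⟨⟨r, r'⟩, ⟨h1, h2, h3⟩, h⟩
    exact hU2 _ ⟨r, h1, fun k => h (Sum.inl k), rfl⟩ _ ⟨r', h2, fun k => h (Sum.inr k), rfl⟩ h3
  · rintro (k | k)
    · obtain ⟨r, hr, h⟩ := hE2 (some k)
      refine ⟨(r, ra), ⟨hr, hra, Closure.base (Or.inr ⟨h none (by simp), hraa⟩)⟩, ?_⟩
      rintro (j | j) hj
      · exact h _ fun h' => hj (by rw [Option.some_injective _ h'])
      · exact hraC j
    · obtain ⟨r, hr, h⟩ := hE2 (some k)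
      refine ⟨(ra, r), ⟨hra, hr, Closure.base (Or.inl ⟨hraa, h none (by simp)⟩)⟩, ?_⟩
      rintro (j | j) hj
      · exact hraC j
      · exact h _ fun h' => hj (by rw [Option.some_injective _ h'])

theorem H2_of_no_ess {A : UAlgebra σ} {C : Set A.carrier} (h : ¬ Ess A C (Fin 3))
    (hC : A.IsClosed C) : H2 A C := by
  classical
  intro B R hR hRn ι _ f hf h2
  have := Fintype.ofFinite ι
  have key : ∀ n, ∀ J : Finset ι, J.card = n → ∃ r ∈ R, ∀ i ∈ J, f i r ∈ C := by
    intro n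
    induction n with
    | zero =>
      intro J hJ
      obtain ⟨r, hr⟩ := hRn
      refine ⟨r, hr, ?_⟩
      rw [Finset.card_eq_zero] at hJ; simp [hJ]
    | succ n ih =>
      intro J hJ
      by_contra hcon
      have hE : Ess A C J := by
        refine ⟨B, R, fun i => f i.1, hR, fun i => hf _, ?_, ?_⟩
        · rintro ⟨r, hr, h⟩
          exact hcon ⟨r, hr, fun i hi => h ⟨i, hi⟩⟩
        · rintro ⟨i, hi⟩
          obtain ⟨r, hr, h⟩ := ih (J.erase i) (by rw [Finset.card_erase_of_mem hi]; omega)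
          refine ⟨r, hr, fun j hj => h _ (Finset.mem_erase.2 ⟨fun h' => hj (Subtype.ext h'), j.2⟩)⟩
      rcases Nat.lt_or_ge n 2 with hn | hn
      · interval_cases n
        · obtain ⟨i, rfl⟩ := Finset.card_eq_one.1 hJ
          obtain ⟨r, hr, h, -⟩ := h2 i i
          exact hcon ⟨r, hr, by simpa using h⟩
        · obtain ⟨i, j, -, rfl⟩ := Finset.card_eq_two.1 hJ
          obtain ⟨r, hr, h, h'⟩ := h2 i j
          exact hcon ⟨r, hr, by simp [h, h']⟩
      · exact h (Ess.fin_le hC (hE.congr (Fintype.equivFinOfCardEq (α := J)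
          (n := n + 1) (by simpa using hJ)).symm) (by omega))
  obtain ⟨r, hr, h⟩ := key _ Finset.univ rfl
  exact ⟨r, hr, fun i => h i (Finset.mem_univ i)⟩

/-- The center of a relation against an absorption-free algebra has the 2-Helly property. -/
theorem H2_center {A E : UAlgebra σ} [Finite A.carrier] [Finite E.carrier] (hA : A.Idempotent)
    (hE : E.Idempotent) (hBA : BAFree E) (hV : InV E) {R : A.carrier → E.carrier → Prop}
    (hR : RelClosed A E R) (hl : ∀ a, ∃ e, R a e) : H2 A {a | ∀ e, R a e} := by
  obtain ⟨n, t, -, ht⟩ := transTerm_of_BAFree hE hBA hV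
  have hC : A.IsClosed {a | ∀ e, R a e} := by
    have := isClosed_forall_rel hE hR Set.univ
    simpa using this
  refine H2_of_no_ess (fun h3 => ?_) hC
  have hall : ∀ k, Ess A {a | ∀ e, R a e} (Fin (k + 3)) := by
    intro k
    induction k with
    | zero => exact h3
    | succ k ih =>
      have h1 := (ih.congr (finSuccEquiv (k + 2)).symm).double hA hC
        fun a ha => not_mem_closure_cross hA hBA hR hl ha
      exact Ess.fin_le hC (h1.congr finSumFinEquiv.symm) (by omega)
  obtain ⟨B, S, f, hS, hf, h1, h2⟩ := (hall n).fin_le hC (show n ≤ n + 3 by omega)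
  choose r hr hrC using h2
  refine h1 ⟨t.eval B r, eval_mem hS t r hr, fun i => ?_⟩
  rw [eval_hom (hf i)]
  exact TransTerm.absorbs ht hR i _ (hl _) fun j hj => hrC j i hj.symm

theorem H2_preimage {A B : UAlgebra σ} {g : A.carrier → B.carrier} (hg : A.IsHom B g)
    {C : Set B.carrier} (h : H2 B C) : H2 A {a | g a ∈ C} :=
  fun B' R hR hRn ι _ f hf hij =>
    h B' R hR hRn ι (fun i r => g (f i r)) (fun i => isHom_comp hg (hf i)) hij

theorem H2Free.image {A B : UAlgebra σ} (hA : H2Free A) {g : A.carrier → B.carrier}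
    (hg : A.IsHom B g) (hs : Function.Surjective g) : H2Free B := by
  intro C hC ⟨c, hc⟩ h
  obtain ⟨a, rfl⟩ := hs c
  have := hA _ (isClosed_preimage hg hC) ⟨a, hc⟩ (H2_preimage hg h)
  rw [Set.eq_univ_iff_forall] at this ⊢
  intro b
  obtain ⟨a, rfl⟩ := hs b
  exact this a

theorem H2Free.prod {A B : UAlgebra σ} (hA : H2Free A) (hB : H2Free B)
    (hAi : A.Idempotent) (hBi : B.Idempotent) : H2Free (A.prod B) := by
  intro C hC ⟨⟨a0, b0⟩, h0⟩ h
  have hfib : ∀ a b, ((a, b) : (A.prod B).carrier) ∈ C →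
      ∀ b', ((a, b') : (A.prod B).carrier) ∈ C := by
    intro a b hab b'
    have hg : ∀ (D : UAlgebra σ) (f : D.carrier → B.carrier), D.IsHom B f →
        D.IsHom (A.prod B) fun r => (a, f r) := fun D f hf g x =>
      Prod.ext (hAi g a).symm (hf g x)
    have := hB {b | ((a, b) : (A.prod B).carrier) ∈ C}
      (isClosed_preimage (hg B _ (isHom_id B)) hC) ⟨b, hab⟩
      (H2_preimage (hg B _ (isHom_id B)) h)
    have h : b' ∈ {b | ((a, b) : (A.prod B).carrier) ∈ C} := this ▸ Set.mem_univ b'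
    exact h
  have hfst := hA {a | ((a, b0) : (A.prod B).carrier) ∈ C}
    (isClosed_preimage (A := A) (B := A.prod B) (g := fun a => (a, b0))
      (fun g x => Prod.ext rfl (hBi g b0).symm) hC) ⟨a0, h0⟩
    (H2_preimage (A := A) (B := A.prod B) (g := fun a => (a, b0))
      (fun g x => Prod.ext rfl (hBi g b0).symm) h)
  rw [Set.eq_univ_iff_forall] at hfst ⊢
  rintro ⟨a, b⟩
  exact hfib a b0 (hfst a) b

theorem common_neighbour {S Q : UAlgebra σ} [Finite S.carrier] (hS : S.Idempotent)
    (hV : InV S) (hF : H2Free S) {R : S.carrier → Q.carrier → Prop} (hR : RelClosed S Q R)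
    (h2 : ∀ s s', ∃ q, R s q ∧ R s' q) (n : ℕ) :
    ∀ X : Finset S.carrier, X.card = n + 1 → ∃ q, ∀ x ∈ X, R x q := by
  classical
  induction n with
  | zero =>
    intro X hX
    obtain ⟨x, rfl⟩ := Finset.card_eq_one.1 hX
    obtain ⟨q, hq, -⟩ := h2 x x
    exact ⟨q, by simpa using hq⟩
  | succ n ih =>
    intro X hX
    rcases Nat.eq_zero_or_pos n with rfl | hn
    · obtain ⟨x, y, -, rfl⟩ := Finset.card_eq_two.1 hX
      obtain ⟨q, hq, hq'⟩ := h2 x y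
      exact ⟨q, by simp [hq, hq']⟩
    · obtain ⟨x0, hx0⟩ : X.Nonempty := Finset.card_pos.1 (by omega)
      have hX1 : (X.erase x0).card = n + 1 := by rw [Finset.card_erase_of_mem hx0]; omega
      obtain ⟨y0, hy0⟩ : (X.erase x0).Nonempty := Finset.card_pos.1 (by omega)
      let Z := (X.erase x0).erase y0
      have hZ : Z.card = n := by rw [Finset.card_erase_of_mem hy0]; omega
      obtain ⟨z0, hz0⟩ : Z.Nonempty := Finset.card_pos.1 (by omega)
      have hZx : ∀ x, ∃ q, (∀ z ∈ Z, R z q) ∧ R x q := by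
        intro x
        by_cases hx : x ∈ Z
        · obtain ⟨q, hq⟩ := ih (insert y0 Z) (by
            rw [Finset.card_insert_of_notMem (by simp [Z])]; omega)
          exact ⟨q, fun z hz => hq z (by simp [hz]), hq x (by simp [hx])⟩
        · obtain ⟨q, hq⟩ := ih (insert x Z) (by rw [Finset.card_insert_of_notMem hx]; omega)
          exact ⟨q, fun z hz => hq z (by simp [hz]), hq x (by simp)⟩
      let W : S.carrier → S.carrier → Prop := fun x y => ∃ q, (∀ z ∈ Z, R z q) ∧ R x q ∧ R y q
      have hW : RelClosed S S W := by
        intro f x y h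
        choose q h1 h2 h3 using h
        refine ⟨Q.interp f q, fun z hz => ?_, hR f _ _ h2, hR f _ _ h3⟩
        have := hR f (fun _ => z) q fun j => h1 j z hz
        rwa [hS] at this
      have hc := H2_center hS hS hF.BAFree hV hW fun x => by
        obtain ⟨q, h1, h2⟩ := hZx x
        exact ⟨x, q, h1, h2, h2⟩
      have hcl : S.IsClosed {a | ∀ e, W a e} := by
        simpa using isClosed_forall_rel hS hW Set.univ
      have hu := hF _ hcl ⟨z0, fun e => by
        obtain ⟨q, h1, h2⟩ := hZx e
        exact ⟨q, h1, h1 _ hz0, h2⟩⟩ hc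
      have hx : x0 ∈ {a | ∀ e, W a e} := hu ▸ Set.mem_univ x0
      obtain ⟨q, h1, h2, h3⟩ := hx y0
      refine ⟨q, fun x hx => ?_⟩
      by_cases hxx : x = x0
      · rwa [hxx]
      by_cases hxy : x = y0
      · rwa [hxy]
      exact h1 x (by simp [Z, hx, hxx, hxy])

theorem common_neighbour_univ {S Q : UAlgebra σ} [Finite S.carrier] [Nonempty S.carrier]
    (hS : S.Idempotent)
    (hV : InV S) (hF : H2Free S) {R : S.carrier → Q.carrier → Prop} (hR : RelClosed S Q R)
    (h2 : ∀ s s', ∃ q, R s q ∧ R s' q) : ∃ q, ∀ s, R s q := by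
  have := Fintype.ofFinite S.carrier
  obtain ⟨q, hq⟩ := common_neighbour hS hV hF hR h2 (Fintype.card S.carrier - 1) Finset.univ
    (by rw [Finset.card_univ]; have := Fintype.card_pos (α := S.carrier); omega)
  exact ⟨q, fun s => hq s (Finset.mem_univ s)⟩

theorem full_of_common {S Q : UAlgebra σ} [Finite S.carrier] [Nonempty S.carrier]
    [Finite Q.carrier] (hS : S.Idempotent) (hV : InV S) (hF : H2Free S) (hQ : Q.Idempotent)
    (hQF : H2Free Q) {R : S.carrier → Q.carrier → Prop} (hR : RelClosed S Q R)
    (hr : ∀ q, ∃ s, R s q) (h2 : ∀ s s', ∃ q, R s q ∧ R s' q) : ∀ s q, R s q := by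
  obtain ⟨q0, hq0⟩ := common_neighbour_univ hS hV hF hR h2
  have hc := H2_center hQ hS hF.BAFree hV hR.flip hr
  have hcl : Q.IsClosed {a | ∀ e, R e a} := by
    simpa using isClosed_forall_rel hS hR.flip Set.univ
  have hu := hQF _ hcl ⟨q0, hq0⟩ hc
  intro s q
  have : q ∈ {a | ∀ e, R e a} := hu ▸ Set.mem_univ q
  exact this s

/-- A simple absorption-free algebra is either fully linked or functionally related. -/
theorem full_or_functional {S Q : UAlgebra σ} [Finite S.carrier] [Finite Q.carrier]
    (hS : S.Idempotent) (hSs : S.IsSimple) (hV : InV S) (hF : H2Free S) (hQ : Q.Idempotent)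
    (hQF : H2Free Q) {R : S.carrier → Q.carrier → Prop} (hR : RelClosed S Q R)
    (hl : ∀ s, ∃ q, R s q) (hr : ∀ q, ∃ s, R s q) :
    (∀ s q, R s q) ∨ (∀ s s' q, R s q → R s' q → s = s') := by
  classical
  by_cases hne : Nonempty S.carrier
  swap
  · exact Or.inl fun s => absurd ⟨s⟩ hne
  by_cases hfull : ∀ s s', ∃ q, R s q ∧ R s' q
  · exact Or.inl (full_of_common hS hV hF hQ hQF hR hr hfull)
  right
  by_contra! hcon
  obtain ⟨s0, s1, q0, h0, h1, hs01⟩ := hcon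
  let P : Set (Set (S.carrier × S.carrier)) := {U | RelClosed S S (fun x y => (x, y) ∈ U) ∧
    (∀ x, (x, x) ∈ U) ∧ (∀ x y, (x, y) ∈ U → (y, x) ∈ U) ∧ ¬ ∀ x y, (x, y) ∈ U}
  have hU : {p : S.carrier × S.carrier | ∃ q, R p.1 q ∧ R p.2 q} ∈ P := by
    refine ⟨fun f x y h => ?_, fun x => ?_, fun x y ⟨q, h, h'⟩ => ⟨q, h', h⟩, hfull⟩
    · choose q h h' using h
      exact ⟨_, hR f _ _ h, hR f _ _ h'⟩
    · obtain ⟨q, h⟩ := hl x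
      exact ⟨q, h, h⟩
  obtain ⟨U, hUU, ⟨hUc, hUr, hUs, hUn⟩, hmax⟩ := (Set.toFinite P).exists_le_maximal hU
  have hcomp : ∀ x y, ∃ z, (x, z) ∈ U ∧ (y, z) ∈ U := by
    by_contra hno
    have hU2 : {p : S.carrier × S.carrier | ∃ z, (p.1, z) ∈ U ∧ (p.2, z) ∈ U} ∈ P := by
      refine ⟨fun f x y h => ?_, fun x => ⟨x, hUr x, hUr x⟩, fun x y ⟨q, h, h'⟩ => ⟨q, h', h⟩, hno⟩
      choose q h h' using h
      exact ⟨_, hUc f _ _ h, hUc f _ _ h'⟩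
    have hle := hmax hU2 fun p hp => ⟨p.2, hp, hUr _⟩
    let θ : Congruence S :=
      { rel := fun x y => (x, y) ∈ U
        refl := hUr
        symm := fun h => hUs _ _ h
        trans := fun {x y z} h h' => hle ⟨y, h, hUs _ _ h'⟩
        compat := hUc }
    rcases hSs θ with h | h
    · exact hs01 ((h s0 s1).1 (hUU ⟨q0, h0, h1⟩))
    · exact hUn h
  exact hUn (full_of_common hS hV hF hS hF hUc (fun q => ⟨q, hUr q⟩) hcomp)

/-- A function of two arguments that is a homomorphism on the product. -/
def BiHom (A B C : UAlgebra σ) (h : A.carrier → B.carrier → C.carrier) : Prop :=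
  ∀ (f : σ.ops) x y, h (A.interp f x) (B.interp f y) = C.interp f fun j => h (x j) (y j)

/-- The standing assumptions on a simple factor. -/
structure SimpleFactor (S : UAlgebra σ) : Prop where
  fin : Finite S.carrier
  idem : S.Idempotent
  simple : S.IsSimple
  inV : InV S
  free : H2Free S

theorem BiHom.idempotent_right {A B C : UAlgebra σ} (hB : B.Idempotent)
    {h : A.carrier → B.carrier → C.carrier} (hh : BiHom A B C h) (b : B.carrier) :
    A.IsHom C fun a => h a b := by
  intro f x
  have := hh f x fun _ => b
  rwa [hB] at this

theorem exists_loop {A S : UAlgebra σ} (hS : SimpleFactor S)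
    (h : A.carrier → S.carrier → S.carrier) (hh : BiHom A S S h)
    (h1 : ∀ a s, ∃ b, h a b = s) (h2 : ∀ b s, ∃ a, h a b = s) (e e' : S.carrier) (hee : e ≠ e') :
    ∃ p : S.carrier → S.carrier → S.carrier, BiHom S S S p ∧ (∀ x, p x e = x) ∧
      (∀ x, p e x = x) ∧ (∀ x s, ∃ y, p x y = s) ∧ (∀ y s, ∃ x, p x y = s) := by
  have := hS.fin
  have hdet : ∀ a a' b b', h a b = h a' b → h a b' = h a' b' := by
    let R : S.carrier → (S.prod (S.prod S)).carrier → Prop := fun s' q =>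
      ∃ a, h a q.1 = q.2.2 ∧ h a q.2.1 = s'
    have hR : RelClosed S (S.prod (S.prod S)) R := by
      intro f x y hxy
      choose a ha ha' using hxy
      refine ⟨A.interp f a, ?_, ?_⟩
      · change h (A.interp f a) (S.interp f fun j => (y j).1) = S.interp f fun j => (y j).2.2
        rw [hh]; simp only [ha]
      · change h (A.interp f a) (S.interp f fun j => (y j).2.1) = S.interp f x
        rw [hh]; simp only [ha']
    have hSS := idem_prod hS.idem hS.idem
    rcases full_or_functional hS.idem hS.simple hS.inV hS.free (idem_prod hS.idem hSS)
      (hS.free.prod (hS.free.prod hS.free hS.idem hS.idem) hS.idem hSS) hR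
      (fun s' => by
        obtain ⟨a, ha⟩ := h2 e s'
        exact ⟨(e, e, s'), a, ha, ha⟩)
      (fun q => by
        obtain ⟨a, ha⟩ := h2 q.1 q.2.2
        exact ⟨_, a, ha, rfl⟩) with hfull | hfun
    · obtain ⟨a, ha, ha'⟩ := hfull e' (e, e, e)
      exact absurd (ha.symm.trans ha') hee
    · intro a a' b b' hab
      exact hfun _ _ (b, b', h a b) ⟨a, rfl, rfl⟩ ⟨a', hab.symm, rfl⟩
  choose α hα using h2 e
  have hα' : ∀ a b, h (α (h a e)) b = h a b := fun a b => hdet _ _ e b (hα _)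
  let g : S.carrier → S.carrier → S.carrier := fun s b => h (α s) b
  have hg : BiHom S S S g := by
    intro f x y
    have h3 := hα' (A.interp f fun j => α (x j)) (S.interp f y)
    have h4 : h (A.interp f fun j => α (x j)) e = S.interp f x :=
      (BiHom.idempotent_right hS.idem hh e f _).trans (by simp only [hα])
    rw [h4, hh] at h3
    exact h3
  have hge : ∀ s, g s e = s := hα
  have hgbs : ∀ s, ∃ y, g e y = s := fun s => h1 (α e) s
  have hgb : Function.Bijective (g e) :=
    (Finite.injective_iff_surjective.2 hgbs : Function.Injective (g e)) |> fun i => ⟨i, hgbs⟩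
  choose μ hμ using hgbs
  have hμ' : ∀ y, μ (g e y) = y := fun y => hgb.1 (hμ _)
  have hμh : S.IsHom S μ := by
    intro f x
    apply hgb.1
    rw [hμ]
    have := hg f (fun _ => e) fun j => μ (x j)
    rw [hS.idem] at this
    rw [this]; simp only [hμ]
  refine ⟨fun x y => g x (μ y), ?_, ?_, ?_, ?_, ?_⟩
  · intro f x y
    simp only [hμh f y, hg f]
  · intro x
    have : μ e = e := by
      have := hμ' e
      rwa [hge] at this
    simp only [this, hge]
  · exact hμ
  · intro x s
    obtain ⟨y, hy⟩ := h1 (α x) s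
    exact ⟨g e y, by simp only [hμ']; exact hy⟩
  · intro y s
    obtain ⟨a, ha⟩ := h2 (μ y) s
    exact ⟨h a e, by simp only [g, hα', ha]⟩

theorem exists_addCommGroup {S : UAlgebra σ} (hS : SimpleFactor S)
    {p : S.carrier → S.carrier → S.carrier} (hp : BiHom S S S p) {e e' : S.carrier} (hee : e ≠ e')
    (hpe : ∀ x, p x e = x) (hep : ∀ x, p e x = x) (h1 : ∀ x s, ∃ y, p x y = s)
    (h2 : ∀ y s, ∃ x, p x y = s) :
    ∃ _ : AddCommGroup S.carrier, BiHom S S S fun x y => x + y := by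
  have := hS.fin
  have hassoc : ∀ x y z, p (p x y) z = p x (p y z) := by
    let R : S.carrier → (S.prod S).carrier → Prop := fun v q =>
      ∃ y z, p (p q.1 y) z = q.2 ∧ p q.1 (p y z) = v
    have hR : RelClosed S (S.prod S) R := by
      intro f x q hxq
      choose y z hy hz using hxq
      refine ⟨S.interp f y, S.interp f z, ?_, ?_⟩
      · change p (p (S.interp f fun j => (q j).1) _) _ = S.interp f fun j => (q j).2
        rw [hp, hp]; simp only [hy]
      · change p (S.interp f fun j => (q j).1) _ = _
        rw [hp, hp]; simp only [hz]
    rcases full_or_functional hS.idem hS.simple hS.inV hS.free (idem_prod hS.idem hS.idem)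
      (hS.free.prod hS.free hS.idem hS.idem) hR
      (fun v => ⟨(e, v), e, v, by simp only [hep], by simp only [hep]⟩)
      (fun q => by
        obtain ⟨z, hz⟩ := h1 q.1 q.2
        exact ⟨_, e, z, by rw [hpe, hz], rfl⟩) with hfull | hfun
    · obtain ⟨y, z, hy, hz⟩ := hfull e' (e, e)
      simp only [hep] at hy hz
      exact absurd (hy.symm.trans hz) hee
    · intro x y z
      obtain ⟨y', hy'⟩ := h1 x (p (p x y) z)
      exact hfun _ _ (x, p (p x y) z) ⟨y', e, by rw [hpe, hy'], by rw [hpe, hy']⟩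
        ⟨y, z, rfl, rfl⟩
  have hcomm : ∀ x y, p x y = p y x := by
    let R : S.carrier → S.carrier → Prop := fun v u => ∃ x y, p x y = u ∧ p y x = v
    have hR : RelClosed S S R := by
      intro f v u h
      choose x y hx hy using h
      refine ⟨S.interp f x, S.interp f y, ?_, ?_⟩
      · rw [hp]; simp only [hx]
      · rw [hp]; simp only [hy]
    rcases full_or_functional hS.idem hS.simple hS.inV hS.free hS.idem hS.free hR
      (fun v => ⟨v, v, e, hpe v, hep v⟩) (fun v => ⟨v, v, e, hpe v, hep v⟩) with hfull | hfun
    · obtain ⟨x, y, hx, hy⟩ := hfull e' e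
      obtain ⟨w, hw⟩ := h2 x e
      have : w = y := by rw [← hpe w, ← hx, ← hassoc, hw, hep]
      rw [this] at hw
      exact absurd (hw.symm.trans hy) hee
    · intro x y
      exact hfun _ _ (p x y) ⟨p x y, e, hpe _, hep _⟩ ⟨x, y, rfl, rfl⟩
  choose ν hν using fun x => h2 x e
  let : AddGroup S.carrier :=
    @AddGroup.ofLeftAxioms S.carrier ⟨p⟩ ⟨ν⟩ ⟨e⟩ hassoc hep hν
  exact ⟨{ (inferInstance : AddGroup S.carrier) with add_comm := hcomm }, hp⟩

section Affine

variable {S : UAlgebra σ} [AddCommGroup S.carrier]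

theorem eval_add (hadd : BiHom S S S fun x y => x + y) {n : ℕ} (t : Term σ n)
    (x y : Fin n → S.carrier) : t.eval S (x + y) = t.eval S x + t.eval S y := by
  induction t with
  | var i => rfl
  | app f ts ih =>
    simp only [Term.eval, ih]
    exact (hadd f _ _).symm

/-- A term operation of an algebra with additive operations, as an additive map. -/
def evalHom (hadd : BiHom S S S fun x y => x + y) {n : ℕ} (t : Term σ n) :
    (Fin n → S.carrier) →+ S.carrier := AddMonoidHom.mk' (t.eval S) (eval_add hadd t)

theorem eval_sub (hadd : BiHom S S S fun x y => x + y) {n : ℕ} (t : Term σ n)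
    (x y : Fin n → S.carrier) : t.eval S (x - y) = t.eval S x - t.eval S y :=
  map_sub (evalHom hadd t) x y

theorem exists_pow_idem {M : Type} [Monoid M] [Finite M] (x : M) :
    ∃ k : ℕ, x ^ (k + 1) * x ^ (k + 1) = x ^ (k + 1) := by
  obtain ⟨i, j, hij, h⟩ : ∃ i j : ℕ, i < j ∧ x ^ i = x ^ j := by
    obtain ⟨i, j, hij, h⟩ := Finite.exists_ne_map_eq_of_infinite fun n : ℕ => x ^ n
    rcases lt_or_gt_of_ne hij with h' | h'
    · exact ⟨i, j, h', h⟩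
    · exact ⟨j, i, h', h.symm⟩
  obtain ⟨p, rfl⟩ : ∃ p, j = i + (p + 1) := ⟨j - i - 1, by omega⟩
  have h1 : ∀ m, x ^ (i + m + (p + 1)) = x ^ (i + m) := by
    intro m
    have : i + m + (p + 1) = i + (p + 1) + m := by omega
    rw [this, pow_add, ← h, ← pow_add]
  have h2 : ∀ a m, x ^ (i + m + a * (p + 1)) = x ^ (i + m) := by
    intro a
    induction a with
    | zero => intro m; simp
    | succ a ih =>
      intro m
      have : i + m + (a + 1) * (p + 1) = i + (m + a * (p + 1)) + (p + 1) := by ring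
      rw [this, h1, ← add_assoc, ih]
  refine ⟨i + (i + 1) * p, ?_⟩
  rw [← pow_add]
  have h3 := h2 (i + 1) ((i + 1) * p + 1)
  have e1 : i + ((i + 1) * p + 1) = i + (i + 1) * p + 1 := by ring
  have e2 : i + ((i + 1) * p + 1) + (i + 1) * (p + 1) =
    i + (i + 1) * p + 1 + (i + (i + 1) * p + 1) := by ring
  rwa [e2, e1] at h3

theorem eval_cons_sub (hadd : BiHom S S S fun x y => x + y) {n : ℕ} (t : Term σ (n + 1))
    (a b : S.carrier) (x : Fin n → S.carrier) :
    t.eval S (Fin.cons a x) - t.eval S (Fin.cons b x) = t.eval S (Fin.cons (a - b) 0) := by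
  rw [← eval_sub hadd]
  congr 1
  funext j
  refine Fin.cases ?_ (fun j => ?_) j <;> simp

theorem no_absorption [Finite S.carrier] (hS : S.Idempotent)
    (hadd : BiHom S S S fun x y => x + y) {T C : Set S.carrier} (hCT : C ⊆ T)
    {c0 : S.carrier} (hc0 : c0 ∈ C) (n : ℕ) :
    ∀ t : Term σ (n + 1), (∀ i x, (∀ j, x j ∈ T) → (∀ j, j ≠ i → x j ∈ C) → t.eval S x ∈ C) →
      T ⊆ C := by
  induction n with
  | zero =>
    intro t ht a ha
    have := ht 0 (fun _ => a) (fun _ => ha) fun j hj => absurd (Fin.ext (by omega)) hj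
    rwa [eval_idem hS] at this
  | succ n ih =>
    intro t ht
    let P : AddMonoid.End S.carrier := AddMonoidHom.mk' (fun a => t.eval S (Fin.cons a 0))
      fun a b => by
        have := eval_cons_sub hadd t (a + b) b 0
        rw [add_sub_cancel_right] at this
        rw [← this]; abel
    have hP : ∀ a, P a = t.eval S (Fin.cons a 0) := fun _ => rfl
    have : Finite (AddMonoid.End S.carrier) :=
      Finite.of_injective (fun f : AddMonoid.End S.carrier => (f : S.carrier → S.carrier))
        DFunLike.coe_injective
    obtain ⟨k, hk⟩ := exists_pow_idem P
    have hiter : ∀ k : ℕ, ∃ u : Term σ (n + 2),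
        (∀ i x, (∀ j, x j ∈ T) → (∀ j, j ≠ i → x j ∈ C) → u.eval S x ∈ C) ∧
        ∀ a, u.eval S (Fin.cons a 0) = (P ^ (k + 1)) a := by
      intro k
      induction k with
      | zero => exact ⟨t, ht, fun a => by simp [hP]⟩
      | succ k ihk =>
        obtain ⟨u, hu, hua⟩ := ihk
        have hev : ∀ x : Fin (n + 2) → S.carrier,
            (tbind t (Fin.cons u fun j => .var j.succ)).eval S x =
            t.eval S (Fin.cons (u.eval S x) fun j => x j.succ) := by
          intro x
          rw [eval_tbind]; congr 1; funext j
          refine Fin.cases rfl (fun j => rfl) j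
        refine ⟨tbind t (Fin.cons u fun j => .var j.succ), fun i x hx hi => ?_, fun a => ?_⟩
        · rw [hev]
          refine ht i _ (fun j => ?_) fun j => ?_
          · exact Fin.cases (hCT (hu i x hx hi)) (fun j => hx _) j
          · exact Fin.cases (fun _ => hu i x hx hi) (fun j hj => hi _ hj) j
        · rw [hev, hua, pow_succ' P (k + 1)]
          exact (hP _).symm
    obtain ⟨u, hu, hua⟩ := hiter k
    have hQ : ∀ a, (P ^ (k + 1)) ((P ^ (k + 1)) a) = (P ^ (k + 1)) a := fun a =>
      congrArg (fun f : AddMonoid.End S.carrier => f a) hk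
    have hev : ∀ x : Fin (n + 1) → S.carrier,
        (tbind u (Fin.cons (.var 0) fun j => .var j)).eval S x =
        u.eval S (Fin.cons (x 0) x) := by
      intro x
      rw [eval_tbind]; congr 1; funext j
      refine Fin.cases rfl (fun j => rfl) j
    refine ih (tbind u (Fin.cons (.var 0) fun j => .var j)) fun i x hx hi => ?_
    rw [hev]
    by_cases h0 : i = 0
    · subst h0
      have ha : u.eval S (Fin.cons (x 0) fun _ => c0) ∈ C :=
        hu 0 _ (fun j => Fin.cases (hx 0) (fun _ => hCT hc0) j)
          fun j => Fin.cases (fun h => absurd rfl h) (fun _ _ => hc0) j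
      have h1 : u.eval S (Fin.cons (u.eval S (Fin.cons (x 0) fun _ => c0)) x) ∈ C := by
        refine hu (Fin.succ 0) _ (fun j => Fin.cases (hCT ha) (fun j => hx j) j) fun j => ?_
        exact Fin.cases (fun _ => ha) (fun j hj => hi j fun h => hj (by rw [h])) j
      have h2 : u.eval S (Fin.cons (x 0) fun _ => c0) = (P ^ (k + 1)) (x 0 - c0) + c0 := by
        have h3 := eval_cons_sub hadd u (x 0) c0 fun _ => c0
        have h4 : (Fin.cons c0 fun _ => c0 : Fin (n + 2) → S.carrier) = fun _ => c0 := by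
          funext j; exact Fin.cases rfl (fun _ => rfl) j
        rw [h4, eval_idem hS, hua] at h3
        rw [← h3]; abel
      have h5 := eval_cons_sub hadd u (u.eval S (Fin.cons (x 0) fun _ => c0)) (x 0) x
      rw [hua, h2] at h5
      have h6 : (P ^ (k + 1)) ((P ^ (k + 1)) (x 0 - c0) + c0 - x 0) = 0 := by
        have : (P ^ (k + 1)) (x 0 - c0) + c0 - x 0 = (P ^ (k + 1)) (x 0 - c0) - (x 0 - c0) := by
          abel
        rw [this, map_sub, hQ, sub_self]
      rw [h6, sub_eq_zero] at h5
      rw [h2, h5] at h1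
      exact h1
    · refine hu i.succ _ (fun j => Fin.cases (hx 0) (fun j => hx j) j) fun j => ?_
      exact Fin.cases (fun _ => hi 0 (Ne.symm h0)) (fun j hj => hi j fun h => hj (by rw [h])) j

theorem BAFree_subalg [Finite S.carrier] (hS : S.Idempotent)
    (hadd : BiHom S S S fun x y => x + y) {T : Set S.carrier} (hT : S.IsClosed T) :
    BAFree (S.subalg T hT) := by
  rintro B hB ⟨b, hb⟩ ⟨t, ht⟩
  have hev : ∀ x : Fin 2 → (S.subalg T hT).carrier,
      (t.eval (S.subalg T hT) x).1 = t.eval S fun j => (x j).1 :=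
    fun x => eval_hom (isHom_subalg S T hT) t x
  have := no_absorption (C := {x | ∃ h : x ∈ T, (⟨x, h⟩ : (S.subalg T hT).carrier) ∈ B}) hS hadd
    (fun x hx => hx.1) (c0 := b.1) ⟨b.2, hb⟩ 1 t ?_
  · rw [Set.eq_univ_iff_forall]
    intro x
    exact (this x.2).2
  · intro i x hx hi
    refine ⟨eval_mem hT t x hx, ?_⟩
    have he : ∀ h, (⟨t.eval S x, h⟩ : (S.subalg T hT).carrier) =
        t.eval (S.subalg T hT) fun j => ⟨x j, hx j⟩ := fun h => Subtype.ext (hev fun j => ⟨x j, hx j⟩).symm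
    rw [he, mono_pair fun j => (⟨x j, hx j⟩ : (S.subalg T hT).carrier)]
    fin_cases i
    · exact (ht _ (hi 1 (by simp)).2 _).2
    · exact (ht _ (hi 0 (by simp)).2 _).1

theorem local_maltsev [Finite S.carrier] (hS : S.Idempotent) (hV : InV S)
    (hadd : BiHom S S S fun x y => x + y) (u v : S.carrier) :
    ∃ t : Term σ 3, t.eval S ![u, 0, 0] = u ∧ t.eval S ![0, 0, v] = v := by
  let g : Fin 3 → (S.prod S).carrier := ![(u, 0), (0, 0), (0, v)]
  let G : Set (S.prod S).carrier := (S.prod S).ClosureSet (Set.range g)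
  have hG : (S.prod S).IsClosed G := closureSet_isClosed _ _
  have hg : ∀ j, g j ∈ G := fun j => subset_closure _ _ ⟨j, rfl⟩
  have hT2 := closureSet_isClosed S {0, v}
  have hT1 := closureSet_isClosed S {0, u}
  let R : S.carrier → (S.subalg (S.ClosureSet {0, v}) hT2).carrier → Prop :=
    fun x y => ((x, y.1) : (S.prod S).carrier) ∈ G
  have hR : RelClosed S (S.subalg (S.ClosureSet {0, v}) hT2) R :=
    fun f x y h => hG f (fun j => (x j, (y j).1)) h
  have hTi := idem_subalg hS _ hT2
  obtain ⟨n, t, hn, ht⟩ := transTerm_of_BAFree hTi (BAFree_subalg hS hadd hT2) (hV.subalg hT2)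
  have hl : ∀ x ∈ S.ClosureSet {0, u}, ((x, 0) : (S.prod S).carrier) ∈ G := by
    apply closure_min
    · rintro x (rfl | rfl)
      · exact hg 1
      · exact hg 0
    · exact isClosed_preimage (A := S) (B := S.prod S) (g := fun x => (x, 0))
        (fun f x => Prod.ext rfl (hS f 0).symm) hG
  have h0 : ∀ y ∈ S.ClosureSet {0, v}, ((0, y) : (S.prod S).carrier) ∈ G := by
    apply closure_min
    · rintro x (rfl | rfl)
      · exact hg 1
      · exact hg 2
    · exact isClosed_preimage (A := S) (B := S.prod S) (g := fun x => (0, x))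
        (fun f x => Prod.ext (hS f 0).symm rfl) hG
  obtain ⟨n, rfl⟩ : ∃ m, n = m + 1 := ⟨n - 1, by omega⟩
  have hsub := no_absorption (C := {x | x ∈ S.ClosureSet {0, u} ∧ ∀ e, R x e}) hS hadd
    (fun x hx => hx.1) (c0 := 0) ⟨left_mem_pair S 0 u, fun e => h0 _ e.2⟩ n t
    (fun i x hx hi => ⟨eval_mem hT1 t x hx, TransTerm.absorbs ht hR i x
      ⟨⟨0, left_mem_pair S 0 v⟩, hl _ (hx i)⟩ fun j hj => (hi j hj).2⟩)
  have huv := (hsub (right_mem_pair S 0 u)).2 ⟨v, right_mem_pair S 0 v⟩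
  obtain ⟨t, ht⟩ := exists_term_range g huv
  refine ⟨t, ?_, ?_⟩
  · have := congrArg Prod.fst ht
    rw [eval_hom (isHom_fst S S)] at this
    refine Eq.trans ?_ this
    congr 1; funext j; fin_cases j <;> rfl
  · have := congrArg Prod.snd ht
    rw [eval_hom (isHom_snd S S)] at this
    refine Eq.trans ?_ this
    congr 1; funext j; fin_cases j <;> rfl

end Affine

theorem eval_tbind3 (A : UAlgebra σ) {n : ℕ} (t : Term σ 3) (p q r : Term σ n)
    (x : Fin n → A.carrier) :
    (tbind t ![p, q, r]).eval A x = t.eval A ![p.eval A x, q.eval A x, r.eval A x] := by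
  rw [eval_tbind]; congr 1; funext j; fin_cases j <;> rfl

theorem eval_tbind2 (A : UAlgebra σ) {n : ℕ} (t : Term σ 2) (p q : Term σ n)
    (x : Fin n → A.carrier) :
    (tbind t ![p, q]).eval A x = t.eval A ![p.eval A x, q.eval A x] := by
  rw [eval_tbind]; congr 1; funext j; fin_cases j <;> rfl

theorem eval_same3 {S : UAlgebra σ} (hS : S.Idempotent) (t : Term σ 3) (x : S.carrier) :
    t.eval S ![x, x, x] = x := by
  have : ![x, x, x] = fun _ : Fin 3 => x := by funext j; fin_cases j <;> rfl
  rw [this, eval_idem hS]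

theorem eval_same2 {S : UAlgebra σ} (hS : S.Idempotent) (t : Term σ 2) (x : S.carrier) :
    t.eval S ![x, x] = x := by
  have : ![x, x] = fun _ : Fin 2 => x := by funext j; fin_cases j <;> rfl
  rw [this, eval_idem hS]

section Affine

variable {S : UAlgebra σ} [AddCommGroup S.carrier]

theorem eval_add3 (hadd : BiHom S S S fun x y => x + y) (t : Term σ 3)
    (x y z x' y' z' : S.carrier) :
    t.eval S ![x + x', y + y', z + z'] = t.eval S ![x, y, z] + t.eval S ![x', y', z'] := by
  rw [← eval_add hadd]; congr 1; funext j; fin_cases j <;> rfl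

theorem eval_add2 (hadd : BiHom S S S fun x y => x + y) (t : Term σ 2)
    (x y x' y' : S.carrier) :
    t.eval S ![x + x', y + y'] = t.eval S ![x, y] + t.eval S ![x', y'] := by
  rw [← eval_add hadd]; congr 1; funext j; fin_cases j <;> rfl

theorem left_maltsev [Finite S.carrier] (hS : S.Idempotent) (hV : InV S)
    (hadd : BiHom S S S fun x y => x + y) (v : S.carrier) (X : Finset S.carrier) :
    ∃ t : Term σ 3, (∀ x ∈ X, t.eval S ![x, 0, 0] = x) ∧ t.eval S ![0, 0, v] = v := by
  classical
  induction X using Finset.induction_on with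
  | empty => exact ⟨.var 2, by simp, rfl⟩
  | insert u X _ ih =>
    obtain ⟨t1, h1, h1v⟩ := ih
    obtain ⟨t2, h2, h2v⟩ := local_maltsev hS hV hadd (u - t1.eval S ![u, 0, 0]) v
    refine ⟨tbind t2 ![.var 0, tbind t1 ![.var 0, .var 1, .var 1], t1], fun x hx => ?_, ?_⟩
    · rw [eval_tbind3, eval_tbind3]
      change t2.eval S ![x, t1.eval S ![x, 0, 0], t1.eval S ![x, 0, 0]] = x
      rcases Finset.mem_insert.1 hx with rfl | hx
      · have := eval_add3 hadd t2 (x - t1.eval S ![x, 0, 0]) 0 0 (t1.eval S ![x, 0, 0])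
          (t1.eval S ![x, 0, 0]) (t1.eval S ![x, 0, 0])
        rw [h2, eval_same3 hS] at this
        simpa using this
      · rw [h1 x hx, eval_same3 hS]
    · rw [eval_tbind3, eval_tbind3]
      change t2.eval S ![0, t1.eval S ![0, 0, 0], t1.eval S ![0, 0, v]] = v
      rw [eval_same3 hS, h1v, h2v]

theorem exists_maltsev [Finite S.carrier] (hS : S.Idempotent) (hV : InV S)
    (hadd : BiHom S S S fun x y => x + y) :
    ∃ t : Term σ 3, ∀ x y z, t.eval S ![x, y, z] = x - y + z := by
  classical
  have key : ∀ Y : Finset S.carrier, ∃ t : Term σ 3, (∀ x, t.eval S ![x, 0, 0] = x) ∧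
      ∀ v ∈ Y, t.eval S ![0, 0, v] = v := by
    have := Fintype.ofFinite S.carrier
    intro Y
    induction Y using Finset.induction_on with
    | empty => exact ⟨.var 0, fun _ => rfl, by simp⟩
    | insert v Y _ ih =>
      obtain ⟨t1, h1, h1v⟩ := ih
      obtain ⟨t2, h2, h2v⟩ := left_maltsev hS hV hadd (v - t1.eval S ![0, 0, v]) Finset.univ
      refine ⟨tbind t2 ![t1, tbind t1 ![.var 1, .var 1, .var 2], .var 2], fun x => ?_,
        fun w hw => ?_⟩
      · rw [eval_tbind3, eval_tbind3]
        change t2.eval S ![t1.eval S ![x, 0, 0], t1.eval S ![0, 0, 0], 0] = x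
        rw [eval_same3 hS, h1, h2 _ (Finset.mem_univ _)]
      · rw [eval_tbind3, eval_tbind3]
        change t2.eval S ![t1.eval S ![0, 0, w], t1.eval S ![0, 0, w], w] = w
        rcases Finset.mem_insert.1 hw with rfl | hw
        · have := eval_add3 hadd t2 0 0 (w - t1.eval S ![0, 0, w]) (t1.eval S ![0, 0, w])
            (t1.eval S ![0, 0, w]) (t1.eval S ![0, 0, w])
          rw [h2v, eval_same3 hS] at this
          simpa using this
        · rw [h1v w hw, eval_same3 hS]
  have := Fintype.ofFinite S.carrier
  obtain ⟨t, h1, h2⟩ := key Finset.univ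
  have h3 := fun z => h2 z (Finset.mem_univ z)
  have h4 : ∀ y, t.eval S ![0, y, 0] = -y := by
    intro y
    have e1 := eval_add3 hadd t y 0 0 0 y y
    have e2 := eval_add3 hadd t 0 y 0 0 0 y
    simp only [add_zero, zero_add] at e1 e2
    rw [eval_same3 hS, e2, h1, h3] at e1
    have : t.eval S ![0, y, 0] + y = 0 := left_eq_add.1 e1
    exact eq_neg_of_add_eq_zero_left this
  refine ⟨t, fun x y z => ?_⟩
  have e1 := eval_add3 hadd t x 0 0 0 y z
  have e2 := eval_add3 hadd t 0 y 0 0 0 z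
  simp only [add_zero, zero_add] at e1 e2
  rw [e1, e2, h1, h3, h4]; abel

/-- The ring of endomorphisms induced by binary terms. -/
def termRing {m : Term σ 3} (hm : ∀ x y z, m.eval S ![x, y, z] = x - y + z) :
    Subring (AddMonoid.End S.carrier) where
  carrier := {r | ∃ t : Term σ 2, ∀ x, t.eval S ![x, 0] = r x}
  mul_mem' := by
    rintro r s ⟨t, ht⟩ ⟨u, hu⟩
    refine ⟨tbind t ![u, .var 1], fun x => ?_⟩
    rw [eval_tbind2, hu]
    exact ht _
  one_mem' := ⟨.var 0, fun _ => rfl⟩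
  zero_mem' := ⟨.var 1, fun _ => rfl⟩
  add_mem' := by
    rintro r s ⟨t, ht⟩ ⟨u, hu⟩
    refine ⟨tbind m ![t, .var 1, u], fun x => ?_⟩
    rw [eval_tbind3, hm, ht, hu]
    change r x - 0 + s x = r x + s x
    rw [sub_zero]
  neg_mem' := by
    rintro r ⟨t, ht⟩
    refine ⟨tbind m ![.var 1, t, .var 1], fun x => ?_⟩
    rw [eval_tbind3, hm, ht]
    change 0 - r x + 0 = - r x
    rw [zero_sub, add_zero]

theorem isAffineAlgebra_of_maltsev [Finite S.carrier] (hS : S.Idempotent)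
    (hadd : BiHom S S S fun x y => x + y) {m : Term σ 3}
    (hm : ∀ x y z, m.eval S ![x, y, z] = x - y + z) {e : S.carrier} (he : e ≠ 0) :
    IsAffineAlgebra S := by
  have hfin : Finite (AddMonoid.End S.carrier) :=
    Finite.of_injective (fun f : AddMonoid.End S.carrier => (f : S.carrier → S.carrier))
      DFunLike.coe_injective
  have hsmul : ∀ (r : termRing hm) (x : S.carrier), r • x = r.1 x := fun _ _ => rfl
  refine ⟨termRing hm, inferInstance, inferInstance, inferInstance, inferInstance,
    fun n g => ⟨?_, ?_⟩, m, hm⟩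
  · rintro ⟨t, ht⟩
    let c : Fin n → termRing hm := fun i =>
      ⟨(evalHom hadd t).comp (AddMonoidHom.single (fun _ => S.carrier) i),
        tbind t (fun j => if j = i then .var 0 else .var 1), fun x => by
          rw [eval_tbind]
          change t.eval S _ = t.eval S (Pi.single i x)
          congr 1; funext j
          by_cases h : j = i
          · subst h; simp [Term.eval]
          · simp [Term.eval, h]⟩
    have hc : ∀ x : Fin n → S.carrier, ∑ i, c i • x i = t.eval S x := by
      intro x
      have : ∀ i, c i • x i = evalHom hadd t (Pi.single i (x i)) := fun i => rfl
      simp only [this]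
      rw [← map_sum, Finset.univ_sum_single]; rfl
    refine ⟨c, ?_, fun x => by rw [hc, ht]⟩
    apply Subtype.ext
    apply AddMonoidHom.ext
    intro x
    have := hc fun _ => x
    rw [← Finset.sum_smul, eval_idem hS] at this
    exact this
  · rintro ⟨c, hc, hg⟩
    cases n with
    | zero =>
      exfalso
      apply he
      have : (1 : termRing hm) • e = (0 : termRing hm) • e := by rw [← hc]; simp
      rwa [one_smul, zero_smul] at this
    | succ n =>
      classical
      have : ∀ J : Finset (Fin (n + 1)), ∃ t : Term σ (n + 1), ∀ x,
          t.eval S x = x 0 + ∑ i ∈ J, c i • (x i - x 0) := by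
        intro J
        induction J using Finset.induction_on with
        | empty => exact ⟨.var 0, fun x => by simp [Term.eval]⟩
        | insert i J hi ih =>
          obtain ⟨t, ht⟩ := ih
          obtain ⟨b, hb⟩ := (c i).2
          refine ⟨tbind m ![t, .var 0, tbind b ![.var i, .var 0]], fun x => ?_⟩
          rw [eval_tbind3, eval_tbind2, hm, ht]
          have h2 : b.eval S ![x i, x 0] = c i • (x i - x 0) + x 0 := by
            have := eval_add2 hadd b (x i - x 0) 0 (x 0) (x 0)
            rw [eval_same2 hS, hb, sub_add_cancel, zero_add] at this
            exact this
          change _ - x 0 + b.eval S ![x i, x 0] = _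
          rw [h2, Finset.sum_insert hi]
          abel
      obtain ⟨t, ht⟩ := this Finset.univ
      refine ⟨t, fun x => ?_⟩
      rw [ht, hg]
      simp only [smul_sub, Finset.sum_sub_distrib]
      rw [← Finset.sum_smul, hc, one_smul]
      abel

theorem closure_pair_eq_univ (hs : S.IsSimple)
    (hadd : BiHom S S S fun x y => x + y) {m : Term σ 3}
    (hm : ∀ x y z, m.eval S ![x, y, z] = x - y + z) {e : S.carrier} (he : e ≠ 0) :
    ∀ y, y ∈ S.ClosureSet {e, 0} := by
  let θ : Congruence S :=
    { rel := fun x y => x - y ∈ S.ClosureSet {e, 0}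
      refl := fun x => by rw [sub_self]; exact right_mem_pair S e 0
      symm := fun {x y} h => by
        have := eval_mem (closureSet_isClosed S {e, 0}) m ![0, x - y, 0] (fun j => by
          fin_cases j
          · exact right_mem_pair S e 0
          · exact h
          · exact right_mem_pair S e 0)
        rw [hm] at this
        simpa using this
      trans := fun {x y z} h h' => by
        have := eval_mem (closureSet_isClosed S {e, 0}) m ![x - y, 0, y - z] (fun j => by
          fin_cases j
          · exact h
          · exact right_mem_pair S e 0
          · exact h')
        rw [hm] at this
        simpa using this
      compat := fun f x y h => by
        have h1 : (S.interp f fun j => x j - y j) + S.interp f y = S.interp f x := by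
          rw [show (S.interp f fun j => x j - y j) + S.interp f y =
            S.interp f fun j => x j - y j + y j from hadd f _ _]
          simp
        rw [← h1, add_sub_cancel_right]
        exact closureSet_isClosed S {e, 0} f _ h }
  rcases hs θ with h | h
  · exact absurd ((h e 0).1 (by change e - 0 ∈ _; rw [sub_zero]; exact left_mem_pair S e 0)) he
  · intro y
    have : y - 0 ∈ S.ClosureSet {e, 0} := h y 0
    rwa [sub_zero] at this

end Affine

theorem no_parametrized_quasigroup {A S : UAlgebra σ} (hS : SimpleFactor S)
    (h : A.carrier → S.carrier → S.carrier) (hh : BiHom A S S h)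
    (h1 : ∀ a s, ∃ b, h a b = s) (h2 : ∀ b s, ∃ a, h a b = s) (e e' : S.carrier) (hee : e ≠ e') :
    False := by
  have := hS.fin
  obtain ⟨p, hp, hpe, hep, p1, p2⟩ := exists_loop hS h hh h1 h2 e e' hee
  obtain ⟨_, hadd⟩ := exists_addCommGroup hS hp hee hpe hep p1 p2
  obtain ⟨m, hm⟩ := exists_maltsev hS.idem hS.inV hadd
  obtain ⟨d, hd⟩ : ∃ d : S.carrier, d ≠ 0 := by
    by_cases he : e = 0
    · exact ⟨e', fun h => hee (he.trans h.symm)⟩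
    · exact ⟨e, he⟩
  have hcl := closure_pair_eq_univ hS.simple hadd hm hd
  exact (hS.inV d 0 S id (fun _ _ _ => rfl) (fun y => ⟨y, hcl y, rfl⟩) hd hS.simple).2
    (isAffineAlgebra_of_maltsev hS.idem hadd hm hd)

theorem ternary_full {A S : UAlgebra σ} [Finite A.carrier] (hA : A.Idempotent) (hAF : H2Free A)
    (hS : SimpleFactor S) {e e' : S.carrier} (hee : e ≠ e')
    {T : A.carrier → S.carrier → S.carrier → Prop}
    (hT : ∀ (f : σ.ops) x y z, (∀ j, T (x j) (y j) (z j)) →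
      T (A.interp f x) (S.interp f y) (S.interp f z))
    (h12 : ∀ a s, ∃ s', T a s s') (h13 : ∀ a s', ∃ s, T a s s') (h23 : ∀ s s', ∃ a, T a s s') :
    ∀ a s s', T a s s' := by
  have := hS.fin
  rcases full_or_functional (Q := A.prod S) (R := fun s' q => T q.1 q.2 s') hS.idem hS.simple
    hS.inV hS.free (idem_prod hA hS.idem) (hAF.prod hS.free hA hS.idem)
    (fun f x y h => hT f (fun j => (y j).1) (fun j => (y j).2) x h)
    (fun s' => (h23 e s').elim fun a ha => ⟨(a, e), ha⟩)
    (fun q => h12 q.1 q.2) with h | h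
  · exact fun a s s' => h s' (a, s)
  · exfalso
    choose g hg using h12
    refine no_parametrized_quasigroup hS g (fun f x y => ?_) (fun a s => ?_) (fun b s => ?_) e e' hee
    · exact h _ _ (A.interp f x, S.interp f y) (hg _ _)
        (hT f x y _ fun j => hg (x j) (y j))
    · exact (h13 a s).imp fun b hb => h _ _ (a, b) (hg a b) hb
    · exact (h23 b s).imp fun a ha => h _ _ (a, b) (hg a b) ha

theorem joint_full {S B : UAlgebra σ} (hS : SimpleFactor S) {e e' : S.carrier} (hee : e ≠ e')
    {ι : Type} (f : ι → B.carrier → S.carrier) (hf : ∀ i, B.IsHom S (f i)) (v : ι → S.carrier)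
    (J : Finset ι) : ∀ R0 : Set B.carrier, B.IsClosed R0 → R0.Nonempty →
      (∀ i ∈ J, ∀ s, ∃ r ∈ R0, f i r = s) →
      (∀ i ∈ J, ∀ j ∈ J, i ≠ j → ∀ s s', ∃ r ∈ R0, f i r = s ∧ f j r = s') →
      ∃ r ∈ R0, ∀ i ∈ J, f i r = v i := by
  classical
  have := hS.fin
  induction J using Finset.induction_on with
  | empty => exact fun R0 _ ⟨r, hr⟩ _ _ => ⟨r, hr, by simp⟩
  | insert i J hi ih =>
    intro R0 hR0 _ h1 h2
    have hiJ := Finset.mem_insert_self i J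
    have hJ : ∀ j ∈ J, j ∈ insert i J := fun j hj => Finset.mem_insert_of_mem hj
    have hne : ∀ j ∈ J, i ≠ j := fun j hj h => hi (h ▸ hj)
    obtain ⟨r, ⟨hr, hri⟩, hrJ⟩ := ih (R0 ∩ {r | f i r ∈ ({v i} : Set S.carrier)})
      (isClosed_inter hR0 (isClosed_preimage (hf i) (isClosed_singleton hS.idem _)))
      ((h1 i hiJ (v i)).imp fun r hr => hr)
      (fun j hj s => (h2 i hiJ j (hJ j hj) (hne j hj) (v i) s).imp
        fun r hr => ⟨⟨hr.1, hr.2.1⟩, hr.2.2⟩)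
      (fun j hj k hk hjk s s' => by
        obtain ⟨r, hr, h⟩ := ternary_full hS.idem hS.free hS hee
          (T := fun a s s' => ∃ r ∈ R0, f i r = a ∧ f j r = s ∧ f k r = s') (by
            intro g x y z hxyz
            choose r hr h1 h2 h3 using hxyz
            refine ⟨B.interp g r, hR0 g r hr, ?_, ?_, ?_⟩
            · rw [hf]; simp only [h1]
            · rw [hf]; simp only [h2]
            · rw [hf]; simp only [h3])
          (fun a s => (h2 i hiJ j (hJ j hj) (hne j hj) a s).elim
            fun r hr => ⟨_, r, hr.1, hr.2.1, hr.2.2, rfl⟩)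
          (fun a s => (h2 i hiJ k (hJ k hk) (hne k hk) a s).elim
            fun r hr => ⟨_, r, hr.1, hr.2.1, rfl, hr.2.2⟩)
          (fun s s' => (h2 j (hJ j hj) k (hJ k hk) hjk s s').elim
            fun r hr => ⟨_, r, hr.1, rfl, hr.2⟩) (v i) s s'
        exact ⟨r, ⟨hr, h.1⟩, h.2⟩)
    refine ⟨r, hr, fun j hj => ?_⟩
    rcases Finset.mem_insert.1 hj with rfl | hj
    · exact hri
    · exact hrJ j hj

theorem helly_point {S B : UAlgebra σ} (hS : SimpleFactor S) {e e' : S.carrier} (hee : e ≠ e')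
    {ι : Type} [Finite ι] (f : ι → B.carrier → S.carrier) (hf : ∀ i, B.IsHom S (f i))
    (s0 : S.carrier) {R0 : Set B.carrier} (hR0 : B.IsClosed R0) (hne : R0.Nonempty)
    (h1 : ∀ i, (∀ r ∈ R0, f i r = s0) ∨ ∀ s, ∃ r ∈ R0, f i r = s)
    (h2 : ∀ i j, ∃ r ∈ R0, f i r = s0 ∧ f j r = s0) : ∃ r ∈ R0, ∀ i, f i r = s0 := by
  classical
  have := hS.fin
  have := Fintype.ofFinite ι
  have key : ∀ I : Finset ι, ∃ J : Finset ι,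
      (∀ i ∈ J, ∀ s, ∃ r ∈ R0, f i r = s) ∧
      (∀ i ∈ J, ∀ j ∈ J, i ≠ j → ∀ s s', ∃ r ∈ R0, f i r = s ∧ f j r = s') ∧
      ∀ r ∈ R0, (∀ j ∈ J, f j r = s0) → ∀ i ∈ I, f i r = s0 := by
    intro I
    induction I using Finset.induction_on with
    | empty => exact ⟨∅, by simp, by simp, by simp⟩
    | insert i I _ ih =>
      obtain ⟨J, J1, J2, J3⟩ := ih
      rcases h1 i with hi | hi
      · refine ⟨J, J1, J2, fun r hr hJ k hk => ?_⟩
        rcases Finset.mem_insert.1 hk with rfl | hk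
        · exact hi r hr
        · exact J3 r hr hJ k hk
      have hdich : ∀ j ∈ J, (∀ s s', ∃ r ∈ R0, f i r = s ∧ f j r = s') ∨
          ∀ r ∈ R0, f j r = s0 → f i r = s0 := by
        intro j hj
        rcases full_or_functional (Q := S) (R := fun s q => ∃ r ∈ R0, f i r = s ∧ f j r = q)
          hS.idem hS.simple hS.inV hS.free hS.idem hS.free (by
            intro g x y hxy
            choose r hr h1 h2 using hxy
            refine ⟨B.interp g r, hR0 g r hr, ?_, ?_⟩
            · rw [hf]; simp only [h1]
            · rw [hf]; simp only [h2])
          (fun s => (hi s).elim fun r hr => ⟨_, r, hr.1, hr.2, rfl⟩)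
          (fun s => (J1 j hj s).elim fun r hr => ⟨_, r, hr.1, rfl, hr.2⟩) with h | h
        · exact Or.inl h
        · right
          intro r hr hjr
          obtain ⟨r', hr', hi', hj'⟩ := h2 i j
          exact h _ _ s0 ⟨r, hr, rfl, hjr⟩ ⟨r', hr', hi', hj'⟩
      by_cases hex : ∃ j ∈ J, ∀ r ∈ R0, f j r = s0 → f i r = s0
      · obtain ⟨j, hj, hji⟩ := hex
        refine ⟨J, J1, J2, fun r hr hJ k hk => ?_⟩
        rcases Finset.mem_insert.1 hk with rfl | hk
        · exact hji r hr (hJ j hj)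
        · exact J3 r hr hJ k hk
      have hfull : ∀ j ∈ J, ∀ s s', ∃ r ∈ R0, f i r = s ∧ f j r = s' := fun j hj =>
        (hdich j hj).resolve_right fun h => hex ⟨j, hj, h⟩
      refine ⟨insert i J, fun k hk => ?_, fun k hk l hl hkl s s' => ?_, fun r hr hJ k hk => ?_⟩
      · rcases Finset.mem_insert.1 hk with rfl | hk
        · exact hi
        · exact J1 k hk
      · rcases Finset.mem_insert.1 hk with rfl | hk'
        · exact hfull l ((Finset.mem_insert.1 hl).resolve_left (Ne.symm hkl)) s s'
        · rcases Finset.mem_insert.1 hl with rfl | hl'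
          · exact (hfull k hk' s' s).imp fun r hr => ⟨hr.1, hr.2.2, hr.2.1⟩
          · exact J2 k hk' l hl' hkl s s'
      · rcases Finset.mem_insert.1 hk with rfl | hk
        · exact hJ k (Finset.mem_insert_self k J)
        · exact J3 r hr (fun j hj => hJ j (Finset.mem_insert_of_mem hj)) k hk
  obtain ⟨J, J1, J2, J3⟩ := key Finset.univ
  obtain ⟨r, hr, h⟩ := joint_full hS hee f hf (fun _ => s0) J R0 hR0 hne J1 J2
  exact ⟨r, hr, fun i => J3 r hr h i (Finset.mem_univ i)⟩

/-- Walks in a graph. -/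
inductive Walk {V : Type} (adj : V → V → Prop) : V → V → Type
  | nil (v : V) : Walk adj v v
  | cons {u v w : V} (h : adj u v) (p : Walk adj v w) : Walk adj u w

namespace Walk

variable {V : Type} {adj : V → V → Prop}

/-- Concatenation of walks. -/
def append : ∀ {u v w : V}, Walk adj u v → Walk adj v w → Walk adj u w
  | _, _, _, .nil _, q => q
  | _, _, _, .cons h p, q => .cons h (append p q)

theorem append_nil {u v : V} (p : Walk adj u v) : p.append (.nil v) = p := by
  induction p with
  | nil v => rfl
  | cons h p ih => simp [append, ih]

theorem append_assoc {u v w x : V} (p : Walk adj u v) (q : Walk adj v w) (r : Walk adj w x) :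
    (p.append q).append r = p.append (q.append r) := by
  induction p with
  | nil v => rfl
  | cons h p ih => simp [append, ih]

/-- Powers of a closed walk. -/
def pow {v : V} (s : Walk adj v v) : ℕ → Walk adj v v
  | 0 => .nil v
  | n + 1 => s.append (pow s n)

theorem pow_one {v : V} (s : Walk adj v v) : s.pow 1 = s := append_nil s

theorem pow_add {v : V} (s : Walk adj v v) (m n : ℕ) :
    s.pow (m + n) = (s.pow m).append (s.pow n) := by
  induction m with
  | zero => rw [Nat.zero_add]; rfl
  | succ m ih => rw [Nat.succ_add]; simp only [pow]; rw [ih, append_assoc]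

theorem pow_mul {v : V} (s : Walk adj v v) (m n : ℕ) : (s.pow m).pow n = s.pow (m * n) := by
  induction n with
  | zero => rfl
  | succ n ih => rw [Nat.mul_succ, Nat.add_comm (m * n), pow_add s, ← ih]; rfl

end Walk

/-- An arc-consistent binary constraint network of finite idempotent algebras. -/
structure Inst (σ : Signature) (V : Type) where
  A : V → UAlgebra σ
  adj : V → V → Prop
  adj_symm : ∀ {v w}, adj v w → adj w v
  rel : ∀ v w, (A v).carrier → (A w).carrier → Prop
  rel_symm : ∀ {v w a b}, rel v w a b → rel w v b a
  closed : ∀ v w, RelClosed (A v) (A w) (rel v w)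
  fin : ∀ v, Finite (A v).carrier
  idem : ∀ v, (A v).Idempotent
  nonempty : ∀ v, Nonempty (A v).carrier
  ac : ∀ {v w}, adj v w → ∀ a, ∃ b, rel v w a b

namespace Inst

variable {V : Type} (I : Inst σ V)

/-- The relation composed along a walk. -/
def W : ∀ {u w : V}, Walk I.adj u w → (I.A u).carrier → (I.A w).carrier → Prop
  | _, _, .nil _, a, b => a = b
  | _, _, .cons (u := u) (v := v) _ p, a, b => ∃ c, I.rel u v a c ∧ W p c b

/-- The relation composed along a walk, staying within a family of subsets. -/
def WIn (D : ∀ v, Set (I.A v).carrier) :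
    ∀ {u w : V}, Walk I.adj u w → (I.A u).carrier → (I.A w).carrier → Prop
  | u, _, .nil _, a, b => a ∈ D u ∧ a = b
  | _, _, .cons (u := u) (v := v) _ p, a, b => a ∈ D u ∧ ∃ c, I.rel u v a c ∧ WIn D p c b

/-- The reversed walk. -/
def rev : ∀ {u w : V}, Walk I.adj u w → Walk I.adj w u
  | _, _, .nil v => .nil v
  | _, _, .cons (u := u) h p => (rev p).append (.cons (I.adj_symm h) (.nil u))

theorem W_append {u v w : V} (p : Walk I.adj u v) (q : Walk I.adj v w) (a : (I.A u).carrier)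
    (b : (I.A w).carrier) : I.W (p.append q) a b ↔ ∃ c, I.W p a c ∧ I.W q c b := by
  induction p with
  | nil v => simp [Walk.append, W]
  | cons h p ih =>
    simp only [Walk.append, W, ih]
    constructor
    · rintro ⟨c, h, d, h1, h2⟩; exact ⟨d, ⟨c, h, h1⟩, h2⟩
    · rintro ⟨d, ⟨c, h, h1⟩, h2⟩; exact ⟨c, h, d, h1, h2⟩

theorem WIn_append {D : ∀ v, Set (I.A v).carrier} {u v w : V} (p : Walk I.adj u v)
    (q : Walk I.adj v w) (a : (I.A u).carrier)
    (b : (I.A w).carrier) : I.WIn D (p.append q) a b ↔ ∃ c, I.WIn D p a c ∧ I.WIn D q c b := by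
  induction p with
  | nil v =>
    simp only [Walk.append, WIn]
    constructor
    · intro h
      refine ⟨a, ⟨?_, rfl⟩, h⟩
      cases q with
      | nil => exact h.1
      | cons _ _ => exact h.1
    · rintro ⟨c, ⟨_, rfl⟩, h⟩; exact h
  | cons h p ih =>
    simp only [Walk.append, WIn, ih]
    constructor
    · rintro ⟨ha, c, h, d, h1, h2⟩; exact ⟨d, ⟨ha, c, h, h1⟩, h2⟩
    · rintro ⟨d, ⟨ha, c, h, h1⟩, h2⟩; exact ⟨ha, c, h, d, h1, h2⟩

theorem W_of_WIn {D : ∀ v, Set (I.A v).carrier} {u w : V} (p : Walk I.adj u w) :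
    ∀ {a b}, I.WIn D p a b → I.W p a b ∧ a ∈ D u ∧ b ∈ D w := by
  induction p with
  | nil v => rintro a b ⟨h, rfl⟩; exact ⟨rfl, h, h⟩
  | cons h p ih =>
    rintro a b ⟨ha, c, hac, h⟩
    exact ⟨⟨c, hac, (ih h).1⟩, ha, (ih h).2.2⟩

theorem W_rev {u w : V} (p : Walk I.adj u w) : ∀ a b, I.W (I.rev p) a b ↔ I.W p b a := by
  induction p with
  | nil v => exact fun a b => ⟨Eq.symm, Eq.symm⟩
  | cons h p ih =>
    intro a b
    simp only [rev, W_append, W, ih]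
    constructor
    · rintro ⟨c, h1, d, h2, rfl⟩; exact ⟨c, I.rel_symm h2, h1⟩
    · rintro ⟨c, h1, h2⟩; exact ⟨c, h2, b, I.rel_symm h1, rfl⟩

theorem W_total {u w : V} (p : Walk I.adj u w) : ∀ a, ∃ b, I.W p a b := by
  induction p with
  | nil v => exact fun a => ⟨a, rfl⟩
  | cons h p ih =>
    intro a
    obtain ⟨c, hc⟩ := I.ac h a
    obtain ⟨b, hb⟩ := ih c
    exact ⟨b, c, hc, hb⟩

theorem W_cototal {u w : V} (p : Walk I.adj u w) (b : (I.A w).carrier) : ∃ a, I.W p a b :=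
  (I.W_total (I.rev p) b).imp fun _ h => (I.W_rev p _ _).1 h

theorem W_closed {u w : V} (p : Walk I.adj u w) : RelClosed (I.A u) (I.A w) (I.W p) := by
  induction p with
  | nil v => exact fun f x y h => congrArg _ (funext h)
  | cons h p ih =>
    intro f x y hxy
    choose c hc hc' using hxy
    exact ⟨_, I.closed _ _ f x c hc, ih f c y hc'⟩

/-- Relative arc consistency of a family of subsets. -/
def ACIn (D : ∀ v, Set (I.A v).carrier) : Prop :=
  ∀ {v w}, I.adj v w → ∀ a ∈ D v, ∃ b ∈ D w, I.rel v w a b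

theorem WIn_total {D : ∀ v, Set (I.A v).carrier} (hD : I.ACIn D) {u w : V}
    (p : Walk I.adj u w) : ∀ a ∈ D u, ∃ b, I.WIn D p a b := by
  induction p with
  | nil v => exact fun a ha => ⟨a, ha, rfl⟩
  | cons h p ih =>
    intro a ha
    obtain ⟨c, hc, hr⟩ := hD h a ha
    obtain ⟨b, hb⟩ := ih c hc
    exact ⟨b, ha, c, hr, hb⟩

theorem WIn_rev {D : ∀ v, Set (I.A v).carrier} {u w : V} (p : Walk I.adj u w) :
    ∀ a b, I.WIn D p b a → I.WIn D (I.rev p) a b := by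
  induction p with
  | nil v => rintro a b ⟨h, rfl⟩; exact ⟨h, rfl⟩
  | cons h p ih =>
    rintro a b ⟨hb, c, hr, hc⟩
    exact (I.WIn_append _ _ _ _).2 ⟨c, ih _ _ hc,
      (I.W_of_WIn _ hc).2.1, b, I.rel_symm hr, hb, rfl⟩

theorem rev_append {u v w : V} (p : Walk I.adj u v) (q : Walk I.adj v w) :
    I.rev (p.append q) = (I.rev q).append (I.rev p) := by
  induction p with
  | nil v => simp [Walk.append, rev, Walk.append_nil]
  | cons h p ih => simp [Walk.append, rev, ih, Walk.append_assoc]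

theorem rev_rev {u w : V} (p : Walk I.adj u w) : I.rev (I.rev p) = p := by
  induction p with
  | nil v => rfl
  | cons h p ih => simp [rev, rev_append, ih, Walk.append]

theorem WIn_cototal {D : ∀ v, Set (I.A v).carrier} (hD : I.ACIn D) {u w : V}
    (p : Walk I.adj u w) (b : (I.A w).carrier) (hb : b ∈ D w) : ∃ a, I.WIn D p a b := by
  obtain ⟨a, ha⟩ := I.WIn_total hD (I.rev p) b hb
  have := I.WIn_rev _ _ _ ha
  rw [rev_rev] at this
  exact ⟨a, this⟩

/-- A step of a closed walk inside a longer closed walk can be undone by every sufficiently large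
power of the longer walk. -/
def Returns : Prop :=
  ∀ (v : V) (u p w : Walk I.adj v v) a b, I.W p a b →
    ∃ N0, ∀ N ≥ N0, I.W ((u.append (p.append w)).pow N) b a

/-- Eventual reachability by powers of a closed walk. -/
def Ev {v : V} (s : Walk I.adj v v) (a b : (I.A v).carrier) : Prop :=
  ∃ N0, ∀ N ≥ N0, I.W (s.pow N) a b

section Returns

variable {I} {v : V}

theorem Ev.refl (hT : I.Returns) (s : Walk I.adj v v) (a : (I.A v).carrier) :
    I.Ev s a a := by
  have := hT v s (.nil v) (.nil v) a a rfl
  change ∃ N0, ∀ N ≥ N0, I.W ((s.append (.nil v)).pow N) a a at this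
  rwa [Walk.append_nil] at this

theorem Ev.trans {s : Walk I.adj v v} {a b c : (I.A v).carrier} (h : I.Ev s a b)
    (h' : I.Ev s b c) : I.Ev s a c := by
  obtain ⟨M, hM⟩ := h
  obtain ⟨N, hN⟩ := h'
  refine ⟨M + N, fun n hn => ?_⟩
  obtain ⟨k, rfl⟩ := Nat.exists_eq_add_of_le hn
  rw [Nat.add_assoc, Walk.pow_add]
  exact (I.W_append _ _ _ _).2 ⟨b, hM _ le_rfl, hN _ (Nat.le_add_right _ _)⟩

theorem Ev.of_back (hT : I.Returns) (s : Walk I.adj v v) {a b : (I.A v).carrier} {N : ℕ}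
    (h : I.W (s.pow N) a b) : I.Ev s b a := by
  obtain ⟨M, hM⟩ := hT v (.nil v) (s.pow N) (.nil v) a b h
  obtain ⟨K, hK⟩ := Ev.refl hT s a
  have hM := hM M le_rfl
  change I.W (((s.pow N).append (.nil v)).pow M) b a at hM
  rw [Walk.append_nil, Walk.pow_mul] at hM
  refine ⟨N * M + K, fun n hn => ?_⟩
  obtain ⟨k, rfl⟩ := Nat.exists_eq_add_of_le hn
  rw [Nat.add_assoc, Walk.pow_add]
  exact (I.W_append _ _ _ _).2 ⟨a, hM, hK _ (Nat.le_add_right _ _)⟩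

theorem Ev.symm (hT : I.Returns) (s : Walk I.adj v v) {a b : (I.A v).carrier}
    (h : I.Ev s a b) : I.Ev s b a :=
  Ev.of_back hT s (h.choose_spec _ le_rfl)

theorem Ev.of_pow (hT : I.Returns) (s : Walk I.adj v v) {a b : (I.A v).carrier} {N : ℕ}
    (h : I.W (s.pow N) a b) : I.Ev s a b :=
  Ev.symm hT s (Ev.of_back hT s h)

theorem Ev.uniform (s : Walk I.adj v v) :
    ∃ N0, ∀ a b, I.Ev s a b → ∀ N ≥ N0, I.W (s.pow N) a b := by
  classical
  have := I.fin v
  have := Fintype.ofFinite (I.A v).carrier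
  have : ∀ ab : (I.A v).carrier × (I.A v).carrier, ∃ N0, I.Ev s ab.1 ab.2 →
      ∀ N ≥ N0, I.W (s.pow N) ab.1 ab.2 := by
    intro ab
    by_cases h : I.Ev s ab.1 ab.2
    · exact h.imp fun N hN _ => hN
    · exact ⟨0, fun h' => absurd h' h⟩
  choose f hf using this
  exact ⟨Finset.univ.sup f, fun a b h N hN =>
    hf (a, b) h N (le_trans (Finset.le_sup (Finset.mem_univ _)) hN)⟩

end Returns

end Inst

namespace Inst

variable {V : Type} (I : Inst σ V)

/-- An algebra whose elements in `Ok` are the realizations of a walk. -/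
structure WalkModel {u w : V} (p : Walk I.adj u w) where
  B : UAlgebra σ
  Ok : Set B.carrier
  closed : B.IsClosed Ok
  st : B.carrier → (I.A u).carrier
  en : B.carrier → (I.A w).carrier
  st_hom : B.IsHom (I.A u) st
  en_hom : B.IsHom (I.A w) en
  ι : Type
  fin : Finite ι
  node : ι → V
  ev : ∀ i, B.carrier → (I.A (node i)).carrier
  ev_hom : ∀ i, B.IsHom (I.A (node i)) (ev i)
  W_iff : ∀ a b, I.W p a b ↔ ∃ x ∈ Ok, st x = a ∧ en x = b
  WIn_iff : ∀ (D : ∀ v, Set (I.A v).carrier) a b, I.WIn D p a b ↔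
    ∃ x ∈ Ok, st x = a ∧ en x = b ∧ ∀ i, ev i x ∈ D (node i)
  split : ∀ i, ∃ (q1 : Walk I.adj u (node i)) (q2 : Walk I.adj (node i) w), ∀ a d b,
    (∃ x ∈ Ok, st x = a ∧ en x = b ∧ ev i x = d) ↔ I.W q1 a d ∧ I.W q2 d b

theorem exists_walkModel {u w : V} (p : Walk I.adj u w) : Nonempty (I.WalkModel p) := by
  induction p with
  | nil v =>
    exact ⟨{
      B := I.A v
      Ok := Set.univ
      closed := isClosed_univ _
      st := fun x => x
      en := fun x => x
      st_hom := isHom_id _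
      en_hom := isHom_id _
      ι := Unit
      fin := inferInstance
      node := fun _ => v
      ev := fun _ x => x
      ev_hom := fun _ => isHom_id _
      W_iff := fun a b => by simp [W]
      WIn_iff := fun D a b => by
        simp only [WIn, Set.mem_univ, true_and]
        constructor
        · rintro ⟨h, rfl⟩; exact ⟨a, rfl, rfl, fun _ => h⟩
        · rintro ⟨x, rfl, rfl, h⟩; exact ⟨h (), rfl⟩
      split := fun _ => ⟨.nil v, .nil v, fun a d b => by
        simp only [W, Set.mem_univ, true_and]
        constructor
        · rintro ⟨x, rfl, rfl, rfl⟩; exact ⟨rfl, rfl⟩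
        · rintro ⟨rfl, rfl⟩; exact ⟨a, rfl, rfl, rfl⟩⟩ }⟩
  | @cons u v w h p ih =>
    obtain ⟨M⟩ := ih
    exact ⟨{
      B := (I.A u).prod M.B
      Ok := {x | x.2 ∈ M.Ok ∧ I.rel u v x.1 (M.st x.2)}
      closed := fun f x hx => ⟨M.closed f _ fun j => (hx j).1, by
        have := I.closed u v f _ _ fun j => (hx j).2
        change I.rel u v ((I.A u).interp f fun j => (x j).1) (M.st (M.B.interp f fun j => (x j).2))
        rwa [M.st_hom]⟩
      st := Prod.fst
      en := fun x => M.en x.2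
      st_hom := isHom_fst _ _
      en_hom := isHom_comp M.en_hom (isHom_snd _ _)
      ι := Option M.ι
      fin := by have := M.fin; infer_instance
      node := fun i => i.elim u M.node
      ev := fun i => match i with
        | none => Prod.fst
        | some i => fun x => M.ev i x.2
      ev_hom := fun i => match i with
        | none => isHom_fst _ _
        | some i => isHom_comp (M.ev_hom i) (isHom_snd _ _)
      W_iff := fun a b => by
        simp only [W, M.W_iff]
        constructor
        · rintro ⟨c, hc, x, hx, rfl, rfl⟩; exact ⟨(a, x), ⟨hx, hc⟩, rfl, rfl⟩
        · rintro ⟨x, ⟨h1, h2⟩, rfl, rfl⟩; exact ⟨_, h2, x.2, h1, rfl, rfl⟩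
      WIn_iff := fun D a b => by
        simp only [WIn, M.WIn_iff]
        constructor
        · rintro ⟨ha, c, hc, x, hx, rfl, rfl, h⟩
          refine ⟨(a, x), ⟨hx, hc⟩, rfl, rfl, fun i => ?_⟩
          cases i with
          | none => exact ha
          | some i => exact h i
        · rintro ⟨x, ⟨h1, h2⟩, rfl, rfl, h⟩
          exact ⟨h none, _, h2, x.2, h1, rfl, rfl, fun i => h (some i)⟩
      split := fun i => match i with
        | none => ⟨.nil u, .cons h p, fun a d b => by
            simp only [W, M.W_iff]
            constructor
            · rintro ⟨x, ⟨h1, h2⟩, rfl, rfl, rfl⟩; exact ⟨rfl, _, h2, x.2, h1, rfl, rfl⟩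
            · rintro ⟨rfl, c, hc, x, hx, rfl, rfl⟩; exact ⟨(a, x), ⟨hx, hc⟩, rfl, rfl, rfl⟩⟩
        | some i => by
            obtain ⟨q1, q2, hq⟩ := M.split i
            refine ⟨.cons h q1, q2, fun a d b => ?_⟩
            simp only [W]
            constructor
            · rintro ⟨x, ⟨h1, h2⟩, rfl, rfl, rfl⟩
              obtain ⟨h3, h4⟩ := (hq _ _ _).1 ⟨x.2, h1, rfl, rfl, rfl⟩
              exact ⟨⟨_, h2, h3⟩, h4⟩
            · rintro ⟨⟨c, hc, h3⟩, h4⟩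
              obtain ⟨x, hx, rfl, rfl, rfl⟩ := (hq _ _ _).2 ⟨h3, h4⟩
              exact ⟨(a, x), ⟨hx, hc⟩, rfl, rfl, rfl⟩ }⟩

/-- A 2-Helly type property of a family of subsets, for relations with walk-definable unary
projections. -/
def Hel (D : ∀ v, Set (I.A v).carrier) : Prop :=
  ∀ (B : UAlgebra σ) (R0 : Set B.carrier), B.IsClosed R0 → R0.Nonempty →
    ∀ (ι : Type) [Finite ι] (node : ι → V) (f : ∀ i, B.carrier → (I.A (node i)).carrier),
      (∀ i, B.IsHom (I.A (node i)) (f i)) →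
      (∀ i, ∃ (v : V) (q : Walk I.adj v (node i)), ∃ b ∈ D v, ∀ d,
        (∃ r ∈ R0, f i r = d) ↔ I.W q b d) →
      (∀ i j, ∃ r ∈ R0, f i r ∈ D (node i) ∧ f j r ∈ D (node j)) →
      ∃ r ∈ R0, ∀ i, f i r ∈ D (node i)

variable {I}

theorem WIn_three_windows {D : ∀ v, Set (I.A v).carrier} (hac : I.ACIn D) (hD : I.Hel D) {v : V}
    {P1 P2 P3 : Walk I.adj v v} {E : (I.A v).carrier → (I.A v).carrier → Prop}
    (hrefl : ∀ a, E a a) (hsymm : ∀ {a b}, E a b → E b a)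
    (htrans : ∀ {a b c}, E a b → E b c → E a c) (h1 : ∀ a b, I.W P1 a b ↔ E a b)
    (h2 : ∀ a b, I.W P2 a b ↔ E a b) (h3 : ∀ a b, I.W P3 a b ↔ E a b)
    {a b : (I.A v).carrier} (ha : a ∈ D v) (hb : b ∈ D v) (hab : E a b) :
    I.WIn D (P1.append (P2.append P3)) a b := by
  obtain ⟨M1⟩ := I.exists_walkModel P1
  obtain ⟨M2⟩ := I.exists_walkModel P2
  obtain ⟨M3⟩ := I.exists_walkModel P3
  have w1 := M1.W_iff
  have w2 := M2.W_iff
  have w3 := M3.W_iff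
  simp only [h1] at w1
  simp only [h2] at w2
  simp only [h3] at w3
  have := M1.fin
  have := M2.fin
  have := M3.fin
  let B := M1.B.prod (M2.B.prod M3.B)
  let R0 : Set B.carrier := {x | (x.1 ∈ M1.Ok ∧ x.2.1 ∈ M2.Ok ∧ x.2.2 ∈ M3.Ok) ∧ M1.st x.1 = a ∧
    M1.en x.1 = M2.st x.2.1 ∧ M2.en x.2.1 = M3.st x.2.2 ∧ M3.en x.2.2 = b}
  have hR0 : B.IsClosed R0 := by
    intro f x hx
    refine ⟨⟨M1.closed f _ fun j => (hx j).1.1, M2.closed f _ fun j => (hx j).1.2.1,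
      M3.closed f _ fun j => (hx j).1.2.2⟩, ?_, ?_, ?_, ?_⟩
    · refine (M1.st_hom f _).trans ?_
      simp only [fun j => (hx j).2.1, I.idem v f]
    · refine (M1.en_hom f _).trans (Eq.trans ?_ (M2.st_hom f _).symm)
      simp only [fun j => (hx j).2.2.1]
    · refine (M2.en_hom f _).trans (Eq.trans ?_ (M3.st_hom f _).symm)
      simp only [fun j => (hx j).2.2.2.1]
    · refine (M3.en_hom f _).trans ?_
      simp only [fun j => (hx j).2.2.2.2, I.idem v f]
  have toE : ∀ {P : Walk I.adj v v} (_ : ∀ a b, I.W P a b ↔ E a b) {c d},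
      I.WIn D P c d → E c d ∧ c ∈ D v ∧ d ∈ D v := fun hP c d h =>
    ⟨(hP _ _).1 (I.W_of_WIn _ h).1, (I.W_of_WIn _ h).2⟩
  have g1 : ∃ r ∈ R0, (∀ i, M2.ev i r.2.1 ∈ D _) ∧ ∀ i, M3.ev i r.2.2 ∈ D _ := by
    obtain ⟨c2, hc2⟩ := I.WIn_cototal hac P3 b hb
    obtain ⟨e2, m2, -⟩ := toE h3 hc2
    obtain ⟨c1, hc1⟩ := I.WIn_cototal hac P2 c2 m2
    obtain ⟨e1, m1, -⟩ := toE h2 hc1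
    obtain ⟨x3, o3, s3, t3, d3⟩ := (M3.WIn_iff D _ _).1 hc2
    obtain ⟨x2, o2, s2, t2, d2⟩ := (M2.WIn_iff D _ _).1 hc1
    obtain ⟨x1, o1, s1, t1⟩ := (w1 a c1).1 (htrans hab (hsymm (htrans e1 e2)))
    exact ⟨(x1, x2, x3), ⟨⟨o1, o2, o3⟩, s1, t1.trans s2.symm, t2.trans s3.symm, t3⟩, d2, d3⟩
  have g2 : ∃ r ∈ R0, (∀ i, M1.ev i r.1 ∈ D _) ∧ ∀ i, M3.ev i r.2.2 ∈ D _ := by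
    obtain ⟨c2, hc2⟩ := I.WIn_cototal hac P3 b hb
    obtain ⟨e2, -⟩ := toE h3 hc2
    obtain ⟨c1, hc1⟩ := I.WIn_total hac P1 a ha
    obtain ⟨e1, -⟩ := toE h1 hc1
    obtain ⟨x3, o3, s3, t3, d3⟩ := (M3.WIn_iff D _ _).1 hc2
    obtain ⟨x1, o1, s1, t1, d1⟩ := (M1.WIn_iff D _ _).1 hc1
    obtain ⟨x2, o2, s2, t2⟩ := (w2 c1 c2).1 (htrans (hsymm e1) (htrans hab (hsymm e2)))
    exact ⟨(x1, x2, x3), ⟨⟨o1, o2, o3⟩, s1, t1.trans s2.symm, t2.trans s3.symm, t3⟩, d1, d3⟩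
  have g3 : ∃ r ∈ R0, (∀ i, M1.ev i r.1 ∈ D _) ∧ ∀ i, M2.ev i r.2.1 ∈ D _ := by
    obtain ⟨c1, hc1⟩ := I.WIn_total hac P1 a ha
    obtain ⟨e1, -, m1⟩ := toE h1 hc1
    obtain ⟨c2, hc2⟩ := I.WIn_total hac P2 c1 m1
    obtain ⟨e2, -⟩ := toE h2 hc2
    obtain ⟨x1, o1, s1, t1, d1⟩ := (M1.WIn_iff D _ _).1 hc1
    obtain ⟨x2, o2, s2, t2, d2⟩ := (M2.WIn_iff D _ _).1 hc2
    obtain ⟨x3, o3, s3, t3⟩ := (w3 c2 b).1 (htrans (hsymm (htrans e1 e2)) hab)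
    exact ⟨(x1, x2, x3), ⟨⟨o1, o2, o3⟩, s1, t1.trans s2.symm, t2.trans s3.symm, t3⟩, d1, d2⟩
  obtain ⟨r, hr, hrD⟩ := hD B R0 hR0 (g1.imp fun r h => h.1) (M1.ι ⊕ (M2.ι ⊕ M3.ι))
    (fun i => i.elim M1.node (Sum.elim M2.node M3.node))
    (fun i => match i with
      | .inl i => fun x => M1.ev i x.1
      | .inr (.inl i) => fun x => M2.ev i x.2.1
      | .inr (.inr i) => fun x => M3.ev i x.2.2)
    (fun i => match i with
      | .inl i => isHom_comp (M1.ev_hom i) (isHom_fst _ _)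
      | .inr (.inl i) => isHom_comp (M2.ev_hom i) (isHom_comp (isHom_fst _ _) (isHom_snd _ _))
      | .inr (.inr i) => isHom_comp (M3.ev_hom i) (isHom_comp (isHom_snd _ _) (isHom_snd _ _)))
    (fun i => by
      rcases i with i | i | i
      · obtain ⟨q1, q2, hq⟩ := M1.split i
        refine ⟨v, q1, a, ha, fun d => ⟨?_, fun h => ?_⟩⟩
        · rintro ⟨x, ⟨⟨o1, -⟩, s1, -⟩, rfl⟩
          exact ((hq _ _ _).1 ⟨x.1, o1, s1, rfl, rfl⟩).1
        · obtain ⟨e, he⟩ := I.W_total q2 d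
          obtain ⟨x1, o1, s1, t1, v1⟩ := (hq _ _ _).2 ⟨h, he⟩
          obtain ⟨x2, o2, s2, t2⟩ := (w2 e e).1 (hrefl e)
          obtain ⟨x3, o3, s3, t3⟩ := (w3 e b).1
            (htrans (hsymm ((w1 a e).2 ⟨x1, o1, s1, t1⟩)) hab)
          exact ⟨(x1, x2, x3), ⟨⟨o1, o2, o3⟩, s1, t1.trans s2.symm, t2.trans s3.symm, t3⟩, v1⟩
      · obtain ⟨q1, q2, hq⟩ := M2.split i
        refine ⟨v, P1.append q1, a, ha, fun d => ⟨?_, fun h => ?_⟩⟩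
        · rintro ⟨x, ⟨⟨o1, o2, -⟩, s1, t1, -⟩, rfl⟩
          refine (I.W_append _ _ _ _).2 ⟨M2.st x.2.1, (M1.W_iff _ _).2 ⟨x.1, o1, s1, t1⟩, ?_⟩
          exact ((hq _ _ _).1 ⟨x.2.1, o2, rfl, rfl, rfl⟩).1
        · obtain ⟨c, hc, hcd⟩ := (I.W_append _ _ _ _).1 h
          obtain ⟨e, he⟩ := I.W_total q2 d
          obtain ⟨x2, o2, s2, t2, v2⟩ := (hq _ _ _).2 ⟨hcd, he⟩
          obtain ⟨x1, o1, s1, t1⟩ := (M1.W_iff _ _).1 hc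
          obtain ⟨x3, o3, s3, t3⟩ := (w3 e b).1
            (htrans (hsymm (htrans ((h1 _ _).1 hc) ((w2 c e).2 ⟨x2, o2, s2, t2⟩))) hab)
          exact ⟨(x1, x2, x3), ⟨⟨o1, o2, o3⟩, s1, t1.trans s2.symm, t2.trans s3.symm, t3⟩, v2⟩
      · obtain ⟨q1, q2, hq⟩ := M3.split i
        refine ⟨v, I.rev q2, b, hb, fun d => ⟨?_, fun h => ?_⟩⟩
        · rintro ⟨x, ⟨⟨-, -, o3⟩, -, -, -, t3⟩, rfl⟩
          exact (I.W_rev _ _ _).2 ((hq _ _ _).1 ⟨x.2.2, o3, rfl, t3, rfl⟩).2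
        · obtain ⟨c, hc⟩ := I.W_cototal q1 d
          obtain ⟨x3, o3, s3, t3, v3⟩ := (hq _ _ _).2 ⟨hc, (I.W_rev _ _ _).1 h⟩
          obtain ⟨x1, o1, s1, t1⟩ := (w1 a a).1 (hrefl a)
          obtain ⟨x2, o2, s2, t2⟩ := (w2 a c).1
            (htrans hab (hsymm ((w3 c b).2 ⟨x3, o3, s3, t3⟩)))
          exact ⟨(x1, x2, x3), ⟨⟨o1, o2, o3⟩, s1, t1.trans s2.symm, t2.trans s3.symm, t3⟩, v3⟩)
    (fun i j => by
      obtain ⟨r1, hr1, a1, b1⟩ := g1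
      obtain ⟨r2, hr2, a2, b2⟩ := g2
      obtain ⟨r3, hr3, a3, b3⟩ := g3
      rcases i with i | i | i <;> rcases j with j | j | j
      · exact ⟨r2, hr2, a2 i, a2 j⟩
      · exact ⟨r3, hr3, a3 i, b3 j⟩
      · exact ⟨r2, hr2, a2 i, b2 j⟩
      · exact ⟨r3, hr3, b3 i, a3 j⟩
      · exact ⟨r1, hr1, a1 i, a1 j⟩
      · exact ⟨r1, hr1, a1 i, b1 j⟩
      · exact ⟨r2, hr2, b2 i, a2 j⟩
      · exact ⟨r1, hr1, b1 i, a1 j⟩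
      · exact ⟨r1, hr1, b1 i, b1 j⟩)
  obtain ⟨⟨o1, o2, o3⟩, s1, t1, t2, t3⟩ := hr
  refine (I.WIn_append _ _ _ _).2 ⟨M1.en r.1, (M1.WIn_iff _ _ _).2
    ⟨r.1, o1, s1, rfl, fun i => hrD (.inl i)⟩, (I.WIn_append _ _ _ _).2 ⟨M2.en r.2.1,
    (M2.WIn_iff _ _ _).2 ⟨r.2.1, o2, t1.symm, rfl, fun i => hrD (.inr (.inl i))⟩,
    (M3.WIn_iff _ _ _).2 ⟨r.2.2, o3, t2.symm, t3, fun i => hrD (.inr (.inr i))⟩⟩⟩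

theorem returns_in {D : ∀ v, Set (I.A v).carrier} (hT : I.Returns) (hac : I.ACIn D)
    (hD : I.Hel D) (v : V) (u p w : Walk I.adj v v) (a b : (I.A v).carrier)
    (h : I.WIn D p a b) :
    ∃ N0, ∀ N ≥ N0, I.WIn D ((u.append (p.append w)).pow N) b a := by
  obtain ⟨hp, ha, hb⟩ := I.W_of_WIn p h
  obtain ⟨N0, hN0⟩ := Ev.uniform (I := I) (u.append (p.append w))
  have hiff : ∀ N ≥ N0, ∀ c d, I.W ((u.append (p.append w)).pow N) c d ↔
      I.Ev (u.append (p.append w)) c d := fun N hN c d =>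
    ⟨Ev.of_pow hT _, fun h => hN0 c d h N hN⟩
  refine ⟨N0 + (N0 + N0), fun N hN => ?_⟩
  obtain ⟨k, rfl⟩ := Nat.exists_eq_add_of_le hN
  rw [Nat.add_assoc, Nat.add_assoc, Walk.pow_add, Walk.pow_add]
  exact WIn_three_windows hac hD (Ev.refl hT _) (Ev.symm hT _) Ev.trans (hiff N0 le_rfl)
    (hiff N0 le_rfl) (hiff (N0 + k) (Nat.le_add_right _ _)) hb ha (hT v u p w a b hp)

/-- The restriction of a network to subalgebras. -/
def restrict (I : Inst σ V) (D : ∀ v, Set (I.A v).carrier) (hc : ∀ v, (I.A v).IsClosed (D v))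
    (hne : ∀ v, (D v).Nonempty) (hac : I.ACIn D) : Inst σ V where
  A v := (I.A v).subalg (D v) (hc v)
  adj := I.adj
  adj_symm := I.adj_symm
  rel v w a b := I.rel v w a.1 b.1
  rel_symm h := I.rel_symm h
  closed v w f _ _ h := I.closed v w f _ _ h
  fin v := by have := I.fin v; infer_instance
  idem v := idem_subalg (I.idem v) _ _
  nonempty v := (hne v).to_subtype
  ac h a := by
    obtain ⟨b, hb, hr⟩ := hac h a.1 a.2
    exact ⟨⟨b, hb⟩, hr⟩

theorem restrict_W {D : ∀ v, Set (I.A v).carrier} {hc : ∀ v, (I.A v).IsClosed (D v)}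
    {hne : ∀ v, (D v).Nonempty} {hac : I.ACIn D} {u w : V} (p : Walk I.adj u w) :
    ∀ a b, (I.restrict D hc hne hac).W p a b ↔ I.WIn D p a.1 b.1 := by
  induction p with
  | nil v => exact fun a b => ⟨fun h => ⟨a.2, congrArg _ h⟩, fun h => Subtype.ext h.2⟩
  | cons h p ih =>
    intro a b
    constructor
    · rintro ⟨c, hc, h⟩
      exact ⟨a.2, c.1, hc, (ih _ _).1 h⟩
    · rintro ⟨-, c, hc, h⟩
      exact ⟨⟨c, (I.W_of_WIn _ h).2.1⟩, hc, (ih _ _).2 h⟩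

theorem restrict_returns {D : ∀ v, Set (I.A v).carrier} {hc : ∀ v, (I.A v).IsClosed (D v)}
    {hne : ∀ v, (D v).Nonempty} {hac : I.ACIn D} (hT : I.Returns) (hD : I.Hel D) :
    (I.restrict D hc hne hac).Returns := by
  intro v u p w a b h
  obtain ⟨N0, hN⟩ := returns_in hT hac hD v u p w a.1 b.1 ((restrict_W (I := I) p a b).1 h)
  exact ⟨N0, fun N h => (restrict_W (I := I) _ b a).2 (hN N h)⟩

end Inst

namespace Inst

variable {V : Type} {I : Inst σ V}

variable (I) in
/-- The image of a set along a walk. -/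
def img {u w : V} (p : Walk I.adj u w) (C : Set (I.A u).carrier) : Set (I.A w).carrier :=
  {b | ∃ a ∈ C, I.W p a b}

theorem img_append {u v w : V} (p : Walk I.adj u v) (q : Walk I.adj v w)
    (C : Set (I.A u).carrier) : I.img (p.append q) C = I.img q (I.img p C) := by
  ext b
  simp only [img, W_append, Set.mem_ofPred_eq]
  constructor
  · rintro ⟨a, ha, c, h1, h2⟩; exact ⟨c, ⟨a, ha, h1⟩, h2⟩
  · rintro ⟨c, ⟨a, ha, h1⟩, h2⟩; exact ⟨a, ha, c, h1, h2⟩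

theorem img_nil {u : V} (C : Set (I.A u).carrier) : I.img (.nil u) C = C := by
  ext b
  exact ⟨fun ⟨a, ha, h⟩ => (show a = b from h) ▸ ha, fun h => ⟨b, h, rfl⟩⟩

theorem img_closed {u w : V} (p : Walk I.adj u w) {C : Set (I.A u).carrier}
    (hC : (I.A u).IsClosed C) : (I.A w).IsClosed (I.img p C) := by
  intro f x hx
  choose a ha h using hx
  exact ⟨_, hC f a ha, I.W_closed p f a x h⟩

theorem img_nonempty {u w : V} (p : Walk I.adj u w) {C : Set (I.A u).carrier}
    (hC : C.Nonempty) : (I.img p C).Nonempty := by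
  obtain ⟨a, ha⟩ := hC
  obtain ⟨b, hb⟩ := I.W_total p a
  exact ⟨b, a, ha, hb⟩

theorem img_pow {v : V} {s : Walk I.adj v v} {C : Set (I.A v).carrier} (h : I.img s C = C)
    (N : ℕ) : I.img (s.pow N) C = C := by
  induction N with
  | zero => exact img_nil C
  | succ N ih => exact (img_append _ _ _).trans (by rw [h, ih])

theorem img_subset_of_loop (hT : I.Returns) {v : V} (p q : Walk I.adj v v)
    {C : Set (I.A v).carrier} (h : I.img (p.append q) C = C) : I.img p C ⊆ C := by
  rintro c ⟨b, hb, hbc⟩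
  have h1 := hT v (.nil v) p q b c hbc
  obtain ⟨N, hN⟩ := Ev.symm hT _ h1
  rw [← img_pow h N]
  exact ⟨b, hb, hN N le_rfl⟩

theorem img_eq_of_loop (hT : I.Returns) {v : V} (p q : Walk I.adj v v)
    {C : Set (I.A v).carrier} (h : I.img (p.append q) C = C) : I.img p C = C := by
  refine (img_subset_of_loop hT p q h).antisymm ?_
  have h' : I.img (q.append p) (I.img p C) = I.img p C := by
    rw [← img_append, ← Walk.append_assoc, img_append, h]
  have := img_subset_of_loop hT q p h'
  rwa [← img_append, h] at this

theorem hel_of_H2 {z : V} {C : Set (I.A z).carrier} (hC : H2 (I.A z) C)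
    {D : ∀ v, Set (I.A v).carrier}
    (hD : ∀ y, D y = Set.univ ∨ ∃ w : Walk I.adj z y, D y = I.img w C) : I.Hel D := by
  classical
  intro B R0 hR0 hne ι _ node f hf _ hpair
  let J := {i : ι // D (node i) ≠ Set.univ}
  have hJ : ∀ i : J, ∃ w : Walk I.adj z (node i.1), D (node i.1) = I.img w C :=
    fun i => (hD (node i.1)).resolve_left i.2
  choose w hw using hJ
  obtain ⟨r, hr, hrc⟩ := hC (B.prod (UAlgebra.pi fun _ : J => I.A z))
    {x | x.1 ∈ R0 ∧ ∀ i : J, I.W (w i) (x.2 i) (f i.1 x.1)}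
    (by
      intro g x hx
      refine ⟨hR0 g _ fun j => (hx j).1, fun i => ?_⟩
      change I.W (w i) ((I.A z).interp g fun j => (x j).2 i) (f i.1 (B.interp g fun j => (x j).1))
      rw [hf]
      exact I.W_closed (w i) g _ _ fun j => (hx j).2 i)
    (by
      obtain ⟨r, hr⟩ := hne
      choose c hc using fun i : J => I.W_cototal (w i) (f i.1 r)
      exact ⟨(r, c), hr, hc⟩)
    J (fun i x => x.2 i)
    (fun i => isHom_comp (isHom_eval_pi (fun _ : J => I.A z) i) (isHom_snd _ _))
    (fun i j => by
      obtain ⟨r, hr, hi, hj⟩ := hpair i.1 j.1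
      rw [hw i] at hi
      rw [hw j] at hj
      obtain ⟨ci, hci, hi⟩ := hi
      obtain ⟨cj, hcj, hj⟩ := hj
      have : ∀ k : J, ∃ c, I.W (w k) c (f k.1 r) ∧ (k = i ∨ k = j → c ∈ C) := by
        intro k
        by_cases h1 : k = i
        · subst h1; exact ⟨ci, hi, fun _ => hci⟩
        by_cases h2 : k = j
        · subst h2; exact ⟨cj, hj, fun _ => hcj⟩
        exact (I.W_cototal (w k) (f k.1 r)).imp fun c hc => ⟨hc, fun h => by tauto⟩
      choose c hc hcC using this
      exact ⟨(r, c), ⟨hr, hc⟩, hcC i (Or.inl rfl), hcC j (Or.inr rfl)⟩)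
  refine ⟨r.1, hr.1, fun i => ?_⟩
  by_cases h : D (node i) = Set.univ
  · rw [h]; trivial
  · rw [hw ⟨i, h⟩]
    exact ⟨r.2 ⟨i, h⟩, hrc ⟨i, h⟩, hr.2 ⟨i, h⟩⟩

theorem exists_maximal_img [Finite V] (z : V) (C : Set (I.A z).carrier) (hC : C ≠ Set.univ) :
    ∃ (y : V) (w : Walk I.adj z y), I.img w C ≠ Set.univ ∧
      ∀ (x : V) (q : Walk I.adj y x), I.img q (I.img w C) ≠ Set.univ →
        ∃ p : Walk I.adj x y, I.img p (I.img q (I.img w C)) = I.img w C := by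
  classical
  have := I.fin
  let X := Σ y, Set (I.A y).carrier
  have hX : Finite X := inferInstance
  let reach : X → X → Prop := fun a b => ∃ q : Walk I.adj a.1 b.1, b.2 = I.img q a.2
  have htr : ∀ {a b c}, reach a b → reach b c → reach a c := by
    rintro a b c ⟨q, hq⟩ ⟨q', hq'⟩
    exact ⟨q.append q', by rw [hq', hq, img_append]⟩
  let P : Set X := {b | reach ⟨z, C⟩ b ∧ b.2 ≠ Set.univ}
  let up : X → Set X := fun a => {b | reach a b ∧ b.2 ≠ Set.univ}
  obtain ⟨⟨y, B⟩, ⟨hw, hB⟩, hmin⟩ := Set.exists_min_image P (fun a => (up a).ncard)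
    P.toFinite ⟨⟨z, C⟩, ⟨.nil z, (img_nil C).symm⟩, hC⟩
  obtain ⟨w, rfl⟩ : ∃ w : Walk I.adj z y, B = I.img w C := hw
  refine ⟨y, w, hB, fun x q hq => ?_⟩
  have hr : reach ⟨y, I.img w C⟩ ⟨x, I.img q (I.img w C)⟩ := ⟨q, rfl⟩
  have hsub : up ⟨x, I.img q (I.img w C)⟩ ⊆ up ⟨y, I.img w C⟩ := fun b hb => ⟨htr hr hb.1, hb.2⟩
  have heq := Set.eq_of_subset_of_ncard_le hsub
    (hmin ⟨x, I.img q (I.img w C)⟩ ⟨htr ⟨w, rfl⟩ hr, hq⟩) (Set.toFinite _)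
  have hmem : (⟨y, I.img w C⟩ : X) ∈ up ⟨x, I.img q (I.img w C)⟩ := by
    rw [heq]; exact ⟨⟨.nil y, (img_nil _).symm⟩, hB⟩
  obtain ⟨⟨p, hp⟩, -⟩ := hmem
  exact ⟨p, hp.symm⟩

variable (I) in
/-- A family of subsets to which a network can be reduced. -/
structure Reduces (D : ∀ v, Set (I.A v).carrier) : Prop where
  closed : ∀ v, (I.A v).IsClosed (D v)
  nonempty : ∀ v, (D v).Nonempty
  ac : I.ACIn D
  hel : I.Hel D
  proper : ∃ v, D v ≠ Set.univ

theorem exists_reduces_of_H2 [Finite V] (hT : I.Returns) {z : V} {C : Set (I.A z).carrier}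
    (hc : (I.A z).IsClosed C) (hne : C.Nonempty) (hC : H2 (I.A z) C) (hu : C ≠ Set.univ) :
    ∃ D, I.Reduces D := by
  obtain ⟨y0, w0, hB, hmax⟩ := exists_maximal_img (I := I) z C hu
  set B := I.img w0 C with hBdef
  have huniq : ∀ {y : V} (w1 w2 : Walk I.adj y0 y), I.img w1 B ≠ Set.univ →
      I.img w2 B ≠ Set.univ → I.img w1 B = I.img w2 B := by
    intro y w1 w2 h1 h2
    obtain ⟨p1, e1⟩ := hmax y w1 h1
    obtain ⟨p2, e2⟩ := hmax y w2 h2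
    have := img_eq_of_loop hT (p1.append w2) (p2.append w1) (C := I.img w1 B) (by
      rw [img_append (p1.append w2), img_append p1, e1, img_append p2, e2])
    rw [img_append, e1] at this
    exact this.symm
  let D : ∀ v, Set (I.A v).carrier := fun y => {d | ∀ w : Walk I.adj y0 y, d ∈ I.img w B}
  have hdich : ∀ y, D y = Set.univ ∨ ∃ w : Walk I.adj y0 y, D y = I.img w B := by
    intro y
    by_cases h : ∃ w : Walk I.adj y0 y, I.img w B ≠ Set.univ
    · obtain ⟨w, hw⟩ := h
      refine Or.inr ⟨w, Set.Subset.antisymm (fun d hd => hd w) fun d hd w' => ?_⟩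
      by_cases hw' : I.img w' B = Set.univ
      · rw [hw']; trivial
      · rwa [huniq w' w hw' hw]
    · push Not at h
      exact Or.inl (Set.eq_univ_of_forall fun d w => by rw [h w]; trivial)
  refine ⟨D, fun v => isClosed_iInter fun w => img_closed w (img_closed w0 hc), fun v => ?_, ?_,
    hel_of_H2 hC fun y => ?_, y0, fun h => hB ?_⟩
  · rcases hdich v with h | ⟨w, h⟩
    · have := I.nonempty v
      rw [h]; exact Set.univ_nonempty
    · rw [h]; exact img_nonempty w (img_nonempty w0 hne)
  · intro v v' hadj a ha
    rcases hdich v' with h | ⟨w, h⟩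
    · obtain ⟨b, hb⟩ := I.ac hadj a
      exact ⟨b, by rw [h]; trivial, hb⟩
    · obtain ⟨c, hc, hw⟩ := ha (w.append (.cons (I.adj_symm hadj) (.nil v)))
      obtain ⟨b, hb, d, hd, rfl⟩ := (I.W_append _ _ _ _).1 hw
      exact ⟨b, by rw [h]; exact ⟨c, hc, hb⟩, I.rel_symm hd⟩
  · refine (hdich y).imp id fun ⟨w, h⟩ => ⟨w0.append w, ?_⟩
    rw [h, img_append]
  · refine Set.eq_univ_of_forall fun d => ?_
    have hd : d ∈ D y0 := by rw [h]; trivial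
    have := hd (.nil y0)
    rwa [img_nil] at this

end Inst

theorem exists_simpleFactor (n : ℕ) : ∀ (A : UAlgebra σ), Finite A.carrier → A.Idempotent →
    InV A → H2Free A → Nat.card A.carrier ≤ n → ∀ a b : A.carrier, a ≠ b →
    ∃ (S : UAlgebra σ) (g : A.carrier → S.carrier), SimpleFactor S ∧ A.IsHom S g ∧
      Function.Surjective g ∧ ∃ e e' : S.carrier, e ≠ e' := by
  induction n with
  | zero =>
    intro A hfin _ _ _ hn a
    have : Nonempty A.carrier := ⟨a⟩
    have := Nat.card_pos (α := A.carrier)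
    omega
  | succ n ih =>
    intro A hfin hi hV hF hn a b hab
    by_cases hs : A.IsSimple
    · exact ⟨A, fun x => x, ⟨hfin, hi, hs, hV, hF⟩, isHom_id A, Function.surjective_id, a, b, hab⟩
    simp only [IsSimple, Congruence.IsFull] at hs
    push Not at hs
    obtain ⟨θ, h1, x, y, hxy⟩ := hs
    let mk : A.carrier → (A.quot θ).carrier := Quotient.mk θ.toSetoid
    have hmk : Function.Surjective mk := Quotient.mk_surjective
    have hhom : A.IsHom (A.quot θ) mk := isHom_mk A θ
    have hfq : Finite (A.quot θ).carrier := Finite.of_surjective mk hmk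
    have hcard : Nat.card (A.quot θ).carrier < Nat.card A.carrier := by
      refine lt_of_le_of_ne (Nat.card_le_card_of_surjective mk hmk) fun hc => ?_
      have hinj := ((Nat.bijective_iff_surjective_and_card mk).2 ⟨hmk, hc.symm⟩).1
      obtain ⟨u, v, huv⟩ := h1
      rcases huv with ⟨h, hne⟩ | ⟨h, rfl⟩
      · exact hne (hinj (Quotient.sound h))
      · exact h (θ.refl _)
    obtain ⟨S, g, hS, hg, hgs, hee⟩ := ih (A.quot θ) hfq (idem_image hhom hmk hi)
      (hV.image hhom hmk) (hF.image hhom hmk) (by omega) (mk x) (mk y)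
      fun h => hxy (Quotient.exact h)
    exact ⟨S, fun z => g (mk z), hS, isHom_comp hg hhom, hgs.comp hmk, hee⟩

namespace Inst

variable {V : Type} {I : Inst σ V} {x : V} {S : UAlgebra σ}

/-- The function `f` recovers the factor `π` of the start of a walk from the end of the walk. -/
def Recovers (π : (I.A x).carrier → S.carrier) {y : V} (w : Walk I.adj x y)
    (f : (I.A y).carrier → S.carrier) : Prop :=
  ∀ a d, I.W w a d → π a = f d

theorem Recovers.isHom {π : (I.A x).carrier → S.carrier} (hπ : (I.A x).IsHom S π) {y : V}
    {w : Walk I.adj x y} {f : (I.A y).carrier → S.carrier} (h : Recovers π w f) :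
    (I.A y).IsHom S f := by
  intro g z
  choose a ha using fun j => I.W_cototal w (z j)
  rw [← h _ _ (I.W_closed w g a z ha), hπ]
  exact congrArg _ (funext fun j => h _ _ (ha j))

theorem Recovers.loop (hT : I.Returns) {π : (I.A x).carrier → S.carrier}
    {w : Walk I.adj x x} {f : (I.A x).carrier → S.carrier} (h : Recovers π w f) : f = π := by
  funext d
  obtain ⟨a, ha⟩ := I.W_cototal w d
  obtain ⟨N, hN⟩ := hT x (.nil x) w (I.rev w) a d ha
  have hN := hN N le_rfl
  rw [← h a d ha]
  have hpow : ∀ (N : ℕ) (a b : (I.A x).carrier), I.W ((w.append (I.rev w)).pow N) a b →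
      π a = π b := by
    intro N
    induction N with
    | zero => exact fun a b h => congrArg π h
    | succ N ih =>
      intro a b hab
      obtain ⟨c, h1, h2⟩ := (I.W_append _ _ _ _).1 hab
      obtain ⟨z, h3, h4⟩ := (I.W_append _ _ _ _).1 h1
      rw [I.W_rev] at h4
      rw [h _ _ h3, ← h _ _ h4, ih _ _ h2]
  exact (hpow N d a hN).symm

/-- The hypotheses under which a network is reduced along a simple factor of one of its nodes. -/
structure FactorData (I : Inst σ V) (x : V) (S : UAlgebra σ) where
  ret : I.Returns
  free : ∀ v, H2Free (I.A v)
  simple : SimpleFactor S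
  π : (I.A x).carrier → S.carrier
  hom : (I.A x).IsHom S π
  surj : Function.Surjective π
  e : S.carrier
  e' : S.carrier
  ne : e ≠ e'

namespace FactorData

variable (H : FactorData I x S)

theorem full_or_recovers (H : FactorData I x S) {y : V} (w : Walk I.adj x y) :
    (∀ s d, ∃ a, H.π a = s ∧ I.W w a d) ∨ ∃ f, Recovers H.π w f := by
  have := H.simple.fin
  have := I.fin y
  rcases full_or_functional (Q := I.A y) H.simple.idem H.simple.simple H.simple.inV H.simple.free
    (I.idem y) (H.free y) (R := fun s d => ∃ a, H.π a = s ∧ I.W w a d)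
    (by
      intro f s d h
      choose a ha h using h
      exact ⟨_, by rw [H.hom]; exact congrArg _ (funext ha), I.W_closed w f a d h⟩)
    (fun s => by
      obtain ⟨a, rfl⟩ := H.surj s
      exact (I.W_total w a).imp fun d h => ⟨a, rfl, h⟩)
    (fun d => (I.W_cototal w d).elim fun a h => ⟨_, a, rfl, h⟩) with h | h
  · exact Or.inl h
  · choose g hg using I.W_cototal w
    exact Or.inr ⟨fun d => H.π (g d), fun a d hw => h _ _ d ⟨a, rfl, hw⟩ ⟨_, rfl, hg d⟩⟩

theorem eq_or_independent (H : FactorData I x S) {y : V} {w w' : Walk I.adj x y}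
    {f g : (I.A y).carrier → S.carrier}
    (hf : Recovers H.π w f) (hg : Recovers H.π w' g) :
    f = g ∨ ∀ s s', ∃ d, f d = s ∧ g d = s' := by
  rcases H.full_or_recovers (w.append (I.rev w')) with h | ⟨h, hh⟩
  · refine Or.inr fun s s' => ?_
    obtain ⟨b, rfl⟩ := H.surj s'
    obtain ⟨a, rfl, hw⟩ := h s b
    obtain ⟨d, h1, h2⟩ := (I.W_append _ _ _ _).1 hw
    rw [I.W_rev] at h2
    exact ⟨d, (hf _ _ h1).symm, (hg _ _ h2).symm⟩
  · refine Or.inl (funext fun d => ?_)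
    obtain ⟨a, ha⟩ := I.W_cototal w d
    obtain ⟨b, hb⟩ := I.W_cototal w' d
    rw [← hf _ _ ha, ← hg _ _ hb, hh a b ((I.W_append _ _ _ _).2 ⟨d, ha, (I.W_rev _ _ _).2 hb⟩),
      hh.loop H.ret]

/-- The elements whose every recoverable factor equals a fixed value. -/
def fibre (y : V) : Set (I.A y).carrier :=
  {d | ∀ f, (∃ w : Walk I.adj x y, Recovers H.π w f) → f d = H.e}

theorem const_or_onto {v y : V} (q : Walk I.adj v y) {b : (I.A v).carrier} (hb : b ∈ H.fibre v)
    {f : (I.A y).carrier → S.carrier} {w : Walk I.adj x y} (hf : Recovers H.π w f) :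
    (∀ d, I.W q b d → f d = H.e) ∨ ∀ b s, ∃ d, I.W q b d ∧ f d = s := by
  rcases H.full_or_recovers (w.append (I.rev q)) with h | ⟨h, hh⟩
  · refine Or.inr fun b s => ?_
    obtain ⟨a, rfl, hw⟩ := h s b
    obtain ⟨d, h1, h2⟩ := (I.W_append _ _ _ _).1 hw
    rw [I.W_rev] at h2
    exact ⟨d, h2, (hf _ _ h1).symm⟩
  · refine Or.inl fun d hd => ?_
    obtain ⟨a, ha⟩ := I.W_cototal w d
    rw [← hf _ _ ha, hh a b ((I.W_append _ _ _ _).2 ⟨d, ha, (I.W_rev _ _ _).2 hd⟩)]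
    exact hb h ⟨_, hh⟩

theorem exists_common {v y : V} (q : Walk I.adj v y) {b : (I.A v).carrier} (hb : b ∈ H.fibre v)
    {f g : (I.A y).carrier → S.carrier} {w w' : Walk I.adj x y} (hf : Recovers H.π w f)
    (hg : Recovers H.π w' g) : ∃ d, I.W q b d ∧ f d = H.e ∧ g d = H.e := by
  rcases H.const_or_onto q hb hf with h | h <;> rcases H.const_or_onto q hb hg with h' | h'
  · obtain ⟨d, hd⟩ := I.W_total q b
    exact ⟨d, hd, h d hd, h' d hd⟩
  · obtain ⟨d, hd, he⟩ := h' b H.e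
    exact ⟨d, hd, h d hd, he⟩
  · obtain ⟨d, hd, he⟩ := h b H.e
    exact ⟨d, hd, he, h' d hd⟩
  · rcases H.eq_or_independent hf hg with rfl | hi
    · obtain ⟨d, hd, he⟩ := h b H.e
      exact ⟨d, hd, he, he⟩
    · have := I.fin v
      refine ternary_full (I.idem v) (H.free v) H.simple H.ne
        (T := fun b s s' => ∃ d, I.W q b d ∧ f d = s ∧ g d = s') ?_ ?_ ?_ ?_ b H.e H.e
      · intro k c s s' hc
        choose d hd h1 h2 using hc
        refine ⟨_, I.W_closed q k c d hd, ?_, ?_⟩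
        · rw [hf.isHom H.hom]; exact congrArg _ (funext h1)
        · rw [hg.isHom H.hom]; exact congrArg _ (funext h2)
      · exact fun b s => (h b s).elim fun d hd => ⟨_, d, hd.1, hd.2, rfl⟩
      · exact fun b s => (h' b s).elim fun d hd => ⟨_, d, hd.1, rfl, hd.2⟩
      · intro s s'
        obtain ⟨d, hd⟩ := hi s s'
        obtain ⟨b, hb⟩ := I.W_cototal q d
        exact ⟨b, d, hb, hd⟩

theorem fibre_closed (y : V) : (I.A y).IsClosed (H.fibre y) := by
  intro f z hz g hg
  obtain ⟨w, hw⟩ := hg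
  exact isClosed_preimage (hw.isHom H.hom) (isClosed_singleton H.simple.idem H.e) f z
    fun j => hz j g ⟨w, hw⟩

theorem finite_recovered (H : FactorData I x S) (y : V) :
    Finite {f : (I.A y).carrier → S.carrier // ∃ w : Walk I.adj x y, Recovers H.π w f} := by
  have := H.simple.fin
  have := I.fin y
  infer_instance

theorem fibre_ac : I.ACIn H.fibre := by
  intro v y hadj b hb
  have := H.finite_recovered y
  let q : Walk I.adj v y := .cons hadj (.nil y)
  have hq : ∀ d, I.W q b d ↔ I.rel v y b d :=
    fun d => ⟨fun ⟨c, hc, h⟩ => (show c = d from h) ▸ hc, fun h => ⟨d, h, rfl⟩⟩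
  obtain ⟨d, hd, h⟩ := helly_point H.simple H.ne
    (fun f : {f : (I.A y).carrier → S.carrier // ∃ w : Walk I.adj x y, Recovers H.π w f} => f.1)
    (fun f => f.2.elim fun w hw => hw.isHom H.hom) H.e
    (R0 := {d | I.W q b d})
    (fun k z hz => by
      have := I.W_closed q k (fun _ => b) z hz
      rwa [I.idem] at this)
    (I.W_total q b)
    (fun f => by
      obtain ⟨w, hw⟩ := f.2
      exact (H.const_or_onto q hb hw).imp id fun h => h b)
    (fun f g => by
      obtain ⟨w, hw⟩ := f.2
      obtain ⟨w', hw'⟩ := g.2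
      exact H.exists_common q hb hw hw')
  exact ⟨d, fun f hf => h ⟨f, hf⟩, (hq d).1 hd⟩

theorem fibre_hel : I.Hel H.fibre := by
  intro B R0 hR0 hne ι _ node f hf hbr hpair
  have := fun i => H.finite_recovered (node i)
  obtain ⟨r, hr, h⟩ := helly_point H.simple H.ne
    (ι := Σ i, {g : (I.A (node i)).carrier → S.carrier //
      ∃ w : Walk I.adj x (node i), Recovers H.π w g})
    (fun k r => k.2.1 (f k.1 r))
    (fun k => k.2.2.elim fun w hw => isHom_comp (hw.isHom H.hom) (hf k.1)) H.e hR0 hne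
    (fun k => by
      obtain ⟨w, hw⟩ := k.2.2
      obtain ⟨v, q, b, hb, hq⟩ := hbr k.1
      refine (H.const_or_onto q hb hw).imp (fun h r hr => h _ ((hq _).1 ⟨r, hr, rfl⟩))
        fun h s => ?_
      obtain ⟨d, hd, hs⟩ := h b s
      obtain ⟨r, hr, rfl⟩ := (hq d).2 hd
      exact ⟨r, hr, hs⟩)
    (fun k l => by
      obtain ⟨r, hr, h1, h2⟩ := hpair k.1 l.1
      exact ⟨r, hr, h1 _ k.2.2, h2 _ l.2.2⟩)
  exact ⟨r, hr, fun i g hg => h ⟨i, g, hg⟩⟩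

theorem reduces : I.Reduces H.fibre := by
  have hπ : Recovers H.π (.nil x) H.π := fun a d h => congrArg H.π h
  refine ⟨H.fibre_closed, fun y => ?_, H.fibre_ac, H.fibre_hel, x, fun h => ?_⟩
  · by_cases hy : Nonempty (Walk I.adj x y)
    · obtain ⟨w⟩ := hy
      obtain ⟨a, ha⟩ := H.surj H.e
      obtain ⟨b, hb⟩ := I.WIn_total H.fibre_ac w a fun f ⟨w, hw⟩ => by rw [hw.loop H.ret, ha]
      exact ⟨b, (I.W_of_WIn w hb).2.2⟩
    · obtain ⟨d⟩ := I.nonempty y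
      exact ⟨d, fun f ⟨w, _⟩ => absurd ⟨w⟩ hy⟩
  · obtain ⟨a, ha⟩ := H.surj H.e'
    have : a ∈ H.fibre x := by rw [h]; trivial
    exact H.ne ((this H.π ⟨_, hπ⟩).symm.trans ha)

end FactorData

theorem exists_reduces_of_free (hT : I.Returns) (hF : ∀ v, H2Free (I.A v)) {x : V}
    (hV : InV (I.A x)) {a b : (I.A x).carrier} (hab : a ≠ b) : ∃ D, I.Reduces D := by
  obtain ⟨S, π, hS, hπ, hs, e, e', hee⟩ := exists_simpleFactor _ (I.A x) (I.fin x) (I.idem x) hV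
    (hF x) le_rfl a b hab
  exact ⟨_, FactorData.reduces ⟨hT, hF, hS, π, hπ, hs, e, e', hee⟩⟩

/-- A network with the return property has an arc-consistent family of nonempty subsets that are
singletons at all prescribed nodes. -/
theorem exists_subsingleton_ac [Finite V] {V0 : Set V} (n : ℕ) : ∀ I : Inst σ V,
    (∑ᶠ v, Nat.card (I.A v).carrier) ≤ n → I.Returns → (∀ v ∈ V0, InV (I.A v)) →
    ∃ D : ∀ v, Set (I.A v).carrier, (∀ v, (D v).Nonempty) ∧ I.ACIn D ∧
      ∀ v ∈ V0, (D v).Subsingleton := by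
  classical
  have := Fintype.ofFinite V
  simp only [finsum_eq_sum_of_fintype]
  induction n with
  | zero =>
    intro I hn _ _
    refine ⟨fun v => Set.univ, fun v => ?_, fun {v w} h a _ => ?_, fun v => ?_⟩
    · have := I.nonempty v; exact Set.univ_nonempty
    · exact (I.ac h a).imp fun b hb => ⟨trivial, hb⟩
    · have := I.nonempty v
      have := I.fin v
      have := Nat.card_pos (α := (I.A v).carrier)
      have := Finset.single_le_sum (f := fun v => Nat.card (I.A v).carrier)
        (fun _ _ => Nat.zero_le _) (Finset.mem_univ v)
      omega
  | succ n ih =>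
    intro I hn hT hV
    by_cases hsub : ∀ v ∈ V0, Subsingleton (I.A v).carrier
    · refine ⟨fun v => Set.univ, fun v => ?_, fun {v w} h a _ => ?_, fun v hv => ?_⟩
      · have := I.nonempty v; exact Set.univ_nonempty
      · exact (I.ac h a).imp fun b hb => ⟨trivial, hb⟩
      · have := hsub v hv
        exact Set.subsingleton_of_subsingleton
    have hred : ∃ D, I.Reduces D := by
      by_cases hF : ∀ v, H2Free (I.A v)
      · push Not at hsub
        obtain ⟨x, hx, hnt⟩ := hsub
        obtain ⟨a, b, hab⟩ := hnt
        exact exists_reduces_of_free hT hF (hV x hx) hab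
      · simp only [H2Free] at hF
        push Not at hF
        obtain ⟨z, C, hC, hne, h2, hu⟩ := hF
        exact exists_reduces_of_H2 hT hC hne h2 hu
    obtain ⟨D, hD⟩ := hred
    let I' := I.restrict D hD.closed hD.nonempty hD.ac
    obtain ⟨E, hE, hEac, hEs⟩ := ih I' (by
      have hle : ∀ v, Nat.card (I'.A v).carrier ≤ Nat.card (I.A v).carrier := by
        intro v
        have := I.fin v
        exact Nat.card_le_card_of_injective (fun d : (I'.A v).carrier => d.1)
          Subtype.val_injective
      obtain ⟨v, hv⟩ := hD.proper
      have hlt : Nat.card (I'.A v).carrier < Nat.card (I.A v).carrier := by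
        have := I.fin v
        exact (Set.ncard_lt_ncard (Set.ssubset_univ_iff.2 hv)).trans_eq (Set.ncard_univ _)
      have := Finset.sum_lt_sum (s := Finset.univ) (fun v _ => hle v) ⟨v, Finset.mem_univ v, hlt⟩
      omega) (restrict_returns hT hD.hel) fun v hv => (hV v hv).subalg (hD.closed v)
    refine ⟨fun v => {d | ∃ h : d ∈ D v, (⟨d, h⟩ : (I'.A v).carrier) ∈ E v}, fun v => ?_, ?_, ?_⟩
    · obtain ⟨d, hd⟩ := hE v
      exact ⟨d.1, d.2, hd⟩
    · rintro v w hadj a ⟨ha, haE⟩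
      obtain ⟨b, hb, hr⟩ := hEac hadj _ haE
      exact ⟨b.1, ⟨b.2, hb⟩, hr⟩
    · rintro v hv a ⟨ha, haE⟩ b ⟨hb, hbE⟩
      exact congrArg Subtype.val (hEs v hv haE hbE)

end Inst

namespace Walk

variable {V : Type} {adj : V → V → Prop}

theorem pow_rotate {v w : V} (p : Walk adj v w) (q : Walk adj w v) (k : ℕ) :
    (p.append q).pow (k + 1) = p.append (((q.append p).pow k).append q) := by
  induction k with
  | zero => rw [Nat.zero_add, pow_one]; rfl
  | succ k ih =>
    change (p.append q).append ((p.append q).pow (k + 1)) =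
      p.append (((q.append p).append ((q.append p).pow k)).append q)
    rw [ih]
    simp only [append_assoc]

end Walk

theorem ncard_pair_le {α : Type} (x y : α) : ({x, y} : Set α).ncard ≤ 2 :=
  (Set.ncard_insert_le _ _).trans (by rw [Set.ncard_singleton])

section Network

variable {K : Set (UAlgebra σ)} (P : CSPInstance σ K)
  (F : Set (Set P.V × (∀ v, (P.dom v).carrier)))

/-- The subalgebra generated by the restrictions of a strategy to a pair of variables. -/
def pairRel (x y : P.V) (a : (P.dom x).carrier) (b : (P.dom y).carrier) : Prop :=
  ((P.dom x).prod (P.dom y)).Closure {q | ∃ φ, (({x, y} : Set P.V), φ) ∈ F ∧ q = (φ x, φ y)} (a, b)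

/-- A variable lies in the scope of a constraint. -/
def InScope (v : P.V) (c : P.CI) : Prop := ∃ j, P.scope c j = v

/-- Assignments satisfying a constraint together with all pair relations on its scope. -/
def conSet (c : P.CI) : Set (UAlgebra.pi P.dom).carrier :=
  {ψ | (fun j => ψ (P.scope c j)) ∈ P.rel c ∧
    ∀ u v, InScope P u c → InScope P v c → pairRel P F u v (ψ u) (ψ v)}

variable {P F}

theorem pairRel_closed (x y : P.V) : RelClosed (P.dom x) (P.dom y) (pairRel P F x y) :=
  fun f a b h => closureSet_isClosed ((P.dom x).prod (P.dom y)) _ f (fun j => (a j, b j)) h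

theorem pairRel_min {x y : P.V} {S : (P.dom x).carrier → (P.dom y).carrier → Prop}
    (hS : RelClosed (P.dom x) (P.dom y) S)
    (h : ∀ φ, (({x, y} : Set P.V), φ) ∈ F → S (φ x) (φ y)) {a b} (hab : pairRel P F x y a b) :
    S a b :=
  closure_min (A := (P.dom x).prod (P.dom y)) (S := {q | S q.1 q.2})
    (by rintro _ ⟨φ, hφ, rfl⟩; exact h φ hφ)
    (fun f q hq => hS f (fun j => (q j).1) (fun j => (q j).2) hq) hab

theorem pairRel_of_mem {x y : P.V} {φ : ∀ v, (P.dom v).carrier}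
    (h : (({x, y} : Set P.V), φ) ∈ F) : pairRel P F x y (φ x) (φ y) :=
  Closure.base ⟨φ, h, rfl⟩

theorem pairRel_symm {x y : P.V} {a b} (h : pairRel P F x y a b) : pairRel P F y x b a :=
  pairRel_min (S := fun a b => pairRel P F y x b a) (pairRel_closed y x).flip
    (fun φ hφ => pairRel_of_mem (by rwa [Set.pair_comm])) h

theorem pairRel_diag {x : P.V} {a b} (h : pairRel P F x x a b) : a = b :=
  pairRel_min (S := fun a b => a = b) (fun _ _ _ h => congrArg _ (funext h)) (fun _ _ => rfl) h

theorem pairRel_left (hF : P.IsStrategy23 F) {x y : P.V} {a b} (h : pairRel P F x y a b) :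
    pairRel P F x x a a :=
  pairRel_min (S := fun a _ => pairRel P F x x a a)
    (fun f a _ h => pairRel_closed x x f a a h)
    (fun φ hφ => pairRel_of_mem (hF.2.2.2.2.1 _ hφ _ (by intro z hz; simpa using Or.inl hz))) h

theorem conSet_closed (c : P.CI) : (UAlgebra.pi P.dom).IsClosed (conSet P F c) :=
  fun f ψ h => ⟨P.rel_closed c f (fun k j => ψ k (P.scope c j)) fun k => (h k).1,
    fun u v hu hv => pairRel_closed u v f _ _ fun k => (h k).2 u v hu hv⟩

theorem mem_conSet {c : P.CI} {a : (UAlgebra.pi (fun j => P.dom (P.scope c j))).carrier}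
    (ha : a ∈ P.rel c) {ψ : ∀ v, (P.dom v).carrier} (haψ : ∀ j, a j = ψ (P.scope c j))
    (h : ∀ U : Set P.V, U.ncard ≤ 2 → (∀ v ∈ U, ∃ j, P.scope c j = v) → (U, ψ) ∈ F) :
    ψ ∈ conSet P F c := by
  refine ⟨(funext haψ : a = _) ▸ ha, fun u v hu hv => pairRel_of_mem (h _ ?_ ?_)⟩
  · exact ncard_pair_le u v
  · rintro z (rfl | rfl)
    · exact hu
    · exact hv

theorem conSet_nonempty (hF : P.IsStrategy23 F) (c : P.CI) : (conSet P F c).Nonempty := by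
  obtain ⟨φ, hφ⟩ := hF.2.2.1 ∅ (by simp)
  obtain ⟨a, ha, ψ, h1, -, h2⟩ := hF.2.2.2.2.2 c ∅ φ hφ (by simp) (by simp)
  exact ⟨ψ, mem_conSet ha h1 h2⟩

theorem exists_conSet (hF : P.IsStrategy23 F) {c : P.CI} {x y : P.V} (hx : InScope P x c)
    (hy : InScope P y c) {a b} (h : pairRel P F x y a b) :
    ∃ ψ ∈ conSet P F c, ψ x = a ∧ ψ y = b := by
  refine pairRel_min (S := fun a b => ∃ ψ ∈ conSet P F c, ψ x = a ∧ ψ y = b) ?_ ?_ h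
  · intro f a b h
    choose ψ hψ h1 h2 using h
    exact ⟨_, conSet_closed c f ψ hψ, congrArg _ (funext h1), congrArg _ (funext h2)⟩
  · intro φ hφ
    obtain ⟨a, ha, ψ, h1, h2, h3⟩ := hF.2.2.2.2.2 c {x, y} φ hφ (ncard_pair_le x y) (by
      rintro z (rfl | rfl)
      · exact hx
      · exact hy)
    exact ⟨ψ, mem_conSet ha h1 h3, h2 x (by simp), h2 y (by simp)⟩

theorem exists_triangle (hF : P.IsStrategy23 F) {x y : P.V} (z : P.V) {a b}
    (h : pairRel P F x y a b) : ∃ d, pairRel P F x z a d ∧ pairRel P F z y d b := by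
  obtain ⟨c, hc⟩ := hF.2.2.2.1 {x, y, z} (by
    refine (Set.ncard_insert_le _ _).trans ?_
    have := ncard_pair_le y z
    omega)
  have hx := hc x (by simp)
  have hy := hc y (by simp)
  have hz := hc z (by simp)
  obtain ⟨ψ, hψ, rfl, rfl⟩ := exists_conSet hF hx hy h
  exact ⟨ψ z, hψ.2 _ _ hx hz, hψ.2 _ _ hz hy⟩

theorem diagSet_closed (v : P.V) : (P.dom v).IsClosed {a | pairRel P F v v a a} :=
  fun f a h => pairRel_closed v v f a a h

/-- The bipartite network of variables and constraints. -/
def net (hF : P.IsStrategy23 F) (hfin : ∀ v, Finite (P.dom v).carrier)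
    (hid : ∀ v, (P.dom v).Idempotent) : Inst σ (P.V ⊕ P.CI) where
  A
    | .inl v => (P.dom v).subalg {a | pairRel P F v v a a} (diagSet_closed v)
    | .inr c => (UAlgebra.pi P.dom).subalg (conSet P F c) (conSet_closed c)
  adj
    | .inl v, .inr c => InScope P v c
    | .inr c, .inl v => InScope P v c
    | _, _ => False
  adj_symm {n m} h := by rcases n with v | c <;> rcases m with w | d <;> exact h
  rel
    | .inl v, .inr _, a, ψ => ψ.1 v = a.1
    | .inr _, .inl v, ψ, a => ψ.1 v = a.1
    | _, _, _, _ => True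
  rel_symm {n m a b} h := by rcases n with v | c <;> rcases m with w | d <;> exact h
  closed n m := by
    rcases n with v | c <;> rcases m with w | d
    · exact fun _ _ _ _ => trivial
    · exact fun f x y h => congrArg ((P.dom v).interp f) (funext h)
    · exact fun f x y h => congrArg ((P.dom w).interp f) (funext h)
    · exact fun _ _ _ _ => trivial
  fin n := by
    have := P.finV
    rcases n with v | c
    · exact finite_subalg _ _ _
    · exact finite_subalg _ _ _
  idem n := by
    rcases n with v | c
    · exact idem_subalg (hid v) _ _
    · exact idem_subalg (idem_pi hid) _ _
  nonempty n := by
    rcases n with v | c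
    · obtain ⟨φ, hφ⟩ := hF.2.2.1 {v} (by simp)
      exact ⟨φ v, pairRel_of_mem (by simpa using hφ)⟩
    · exact (conSet_nonempty hF c).to_subtype
  ac {n m} h a := by
    rcases n with v | c <;> rcases m with w | d
    · exact h.elim
    · obtain ⟨ψ, hψ, hv, -⟩ := exists_conSet hF h h a.2
      exact ⟨⟨ψ, hψ⟩, hv⟩
    · exact ⟨⟨a.1 w, a.2.2 w w h h⟩, rfl⟩
    · exact h.elim

section Returns

variable {hF : P.IsStrategy23 F} {hfin : ∀ v, Finite (P.dom v).carrier}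
  {hid : ∀ v, (P.dom v).Idempotent}

/-- The value of an element at a variable node. -/
def netVal {x : P.V} (a : ((net hF hfin hid).A (.inl x)).carrier) : (P.dom x).carrier :=
  Subtype.val a

/-- The assignment of an element at a constraint node. -/
def netFun {c : P.CI} (ψ : ((net hF hfin hid).A (.inr c)).carrier) : ∀ v, (P.dom v).carrier :=
  Subtype.val ψ

theorem netVal_mem {x : P.V} (a : ((net hF hfin hid).A (.inl x)).carrier) :
    pairRel P F x x (netVal a) (netVal a) := a.2

theorem netFun_mem {c : P.CI} (ψ : ((net hF hfin hid).A (.inr c)).carrier) :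
    netFun ψ ∈ conSet P F c := ψ.2

theorem netVal_injective {x : P.V} {a b : ((net hF hfin hid).A (.inl x)).carrier}
    (h : netVal a = netVal b) : a = b := Subtype.ext h

/-- The value at a variable of the scope of an element of a constraint node. -/
def netProj {c : P.CI} {x : P.V} (h : (net hF hfin hid).adj (.inr c) (.inl x))
    (ψ : ((net hF hfin hid).A (.inr c)).carrier) : ((net hF hfin hid).A (.inl x)).carrier :=
  ⟨netFun ψ x, (netFun_mem ψ).2 x x h h⟩

theorem exists_netVal {x : P.V} {a : (P.dom x).carrier} (h : pairRel P F x x a a) :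
    ∃ b : ((net hF hfin hid).A (.inl x)).carrier, netVal b = a := ⟨⟨a, h⟩, rfl⟩

theorem exists_netFun {c : P.CI} {x y : P.V} (hx : InScope P x c)
    (hy : InScope P y c) {a b} (h : pairRel P F x y a b) :
    ∃ ψ : ((net hF hfin hid).A (.inr c)).carrier, netFun ψ x = a ∧ netFun ψ y = b := by
  obtain ⟨ψ, hψ, h⟩ := exists_conSet hF hx hy h
  exact ⟨⟨ψ, hψ⟩, h⟩

variable (hF hfin hid) in
/-- A walk into a variable connects all compatible pairs. -/
def Connects (y : P.V) : ∀ n, Walk (net hF hfin hid).adj n (.inl y) → Prop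
  | .inl x, p => ∀ (a : ((net hF hfin hid).A (.inl x)).carrier)
      (b : ((net hF hfin hid).A (.inl y)).carrier), pairRel P F x y (netVal a) (netVal b) →
      (net hF hfin hid).W p a b
  | .inr c, p => ∀ x, InScope P x c → ∀ (a : (P.dom x).carrier)
      (b : ((net hF hfin hid).A (.inl y)).carrier), pairRel P F x y a (netVal b) →
      ∃ ψ : ((net hF hfin hid).A (.inr c)).carrier, netFun ψ x = a ∧ (net hF hfin hid).W p ψ b

theorem connects {y : P.V} : ∀ {n} (p : Walk (net hF hfin hid).adj n (.inl y)),
    Connects hF hfin hid y n p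
  | _, .nil _ => fun _ _ h => netVal_injective (pairRel_diag h)
  | .inl x, .cons (v := .inl z) h p => h.elim
  | .inr c, .cons (v := .inr z) h p => h.elim
  | .inl x, .cons (v := .inr c) h p => by
    intro a b hab
    obtain ⟨ψ, h1, h2⟩ := connects p x h _ b hab
    exact ⟨ψ, h1, h2⟩
  | .inr c, .cons (v := .inl z) h p => by
    intro x hx a b hab
    obtain ⟨d, h1, h2⟩ := exists_triangle hF z hab
    obtain ⟨ψ, h3, rfl⟩ := exists_netFun (hF := hF) (hfin := hfin) (hid := hid) hx h h1
    exact ⟨ψ, h3, netProj h ψ, rfl, connects p _ _ h2⟩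

/-- The closed walk `s` undoes, up to powers, the rest of its course to its end `b`. -/
def Undoes {x : P.V} (s : Walk (net hF hfin hid).adj (.inl x) (.inl x))
    (b : ((net hF hfin hid).A (.inl x)).carrier) :
    ∀ n, Walk (net hF hfin hid).adj n (.inl x) → Prop
  | .inl y, p => ∀ q : Walk (net hF hfin hid).adj (.inl x) (.inl y), s = q.append p →
      ∀ (d : ((net hF hfin hid).A (.inl y)).carrier) (a : ((net hF hfin hid).A (.inl x)).carrier),
      pairRel P F x y (netVal a) (netVal d) → (net hF hfin hid).W p d b →
      ∃ k, (net hF hfin hid).W (s.pow k) b a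
  | .inr c, p => ∀ (y : P.V) (h : (net hF hfin hid).adj (.inl y) (.inr c))
      (q : Walk (net hF hfin hid).adj (.inl x) (.inl y)), s = q.append (.cons h p) →
      ∀ (ψ : ((net hF hfin hid).A (.inr c)).carrier) (a : ((net hF hfin hid).A (.inl x)).carrier),
      pairRel P F x y (netVal a) (netFun ψ y) → (net hF hfin hid).W p ψ b →
      ∃ k, (net hF hfin hid).W (s.pow k) b a

theorem undoes {x : P.V} (s : Walk (net hF hfin hid).adj (.inl x) (.inl x))
    (b : ((net hF hfin hid).A (.inl x)).carrier) :
    ∀ {n} (p : Walk (net hF hfin hid).adj n (.inl x)), Undoes s b n p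
  | _, .nil _ => fun q _ d a h hd => ⟨0, hd.symm.trans (netVal_injective (pairRel_diag h).symm)⟩
  | .inl x, .cons (v := .inl z) h p => h.elim
  | .inr c, .cons (v := .inr z) h p => h.elim
  | .inl y, .cons (v := .inr c) h p => by
    rintro q hq d a hab ⟨ψ, h1, h2⟩
    change netFun ψ y = netVal d at h1
    exact undoes s b p y h q hq ψ a (h1 ▸ hab) h2
  | .inr c, .cons (v := .inl z) h p => by
    rintro y hy q hq ψ a hab ⟨d, h1, h2⟩
    change netFun ψ z = netVal d at h1
    have hyz : pairRel P F y z (netFun ψ y) (netVal d) := h1 ▸ (netFun_mem ψ).2 y z hy h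
    obtain ⟨a', h3, h4⟩ := exists_triangle hF x hyz
    obtain ⟨a', rfl⟩ := exists_netVal (hF := hF) (hfin := hfin) (hid := hid) (pairRel_left hF h4)
    obtain ⟨k, hk⟩ := undoes s b p (q.append (.cons hy (.cons h (.nil _))))
      (by rw [Walk.append_assoc]; exact hq) d a' h4 h2
    refine ⟨k + 1, ?_⟩
    rw [Walk.pow_add, Walk.pow_one]
    refine ((net hF hfin hid).W_append _ _ _ _).2 ⟨a', hk, ?_⟩
    rw [hq]
    exact ((net hF hfin hid).W_append _ _ _ _).2 ⟨netProj (Inst.adj_symm _ hy) ψ,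
      connects q _ _ (pairRel_symm h3), connects (n := .inl y) (.cons hy (.cons h p)) _ _
        (pairRel_symm hab)⟩

theorem connects_of_constraint {c : P.CI} {x : P.V}
    (r : Walk (net hF hfin hid).adj (.inr c) (.inl x)) (h : InScope P x c)
    (ψ : ((net hF hfin hid).A (.inr c)).carrier) :
    (net hF hfin hid).W r ψ (netProj h ψ) := by
  match r with
  | .cons (v := .inr z) h p => exact h.elim
  | .cons (v := .inl z) h' p =>
    exact ⟨netProj h' ψ, rfl, connects p _ _ ((netFun_mem ψ).2 z x h' h)⟩

theorem W_refl_of_closed {n : P.V ⊕ P.CI} (s : Walk (net hF hfin hid).adj n n)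
    (a : ((net hF hfin hid).A n).carrier) : (net hF hfin hid).W s a a := by
  match n, s with
  | _, .nil _ => rfl
  | .inl x, s => exact connects s _ _ (netVal_mem a)
  | .inr c, .cons (v := .inr z) h p => exact h.elim
  | .inr c, .cons (v := .inl z) h p =>
    exact ⟨netProj h a, rfl, ((net hF hfin hid).W_rev p _ _).1 (connects_of_constraint _ h a)⟩

theorem exists_pow_back_variable {x : P.V} (s : Walk (net hF hfin hid).adj (.inl x) (.inl x))
    (a b : ((net hF hfin hid).A (.inl x)).carrier) (hs : (net hF hfin hid).W s a b) :
    ∃ k, (net hF hfin hid).W (s.pow k) b a :=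
  undoes s b s (.nil _) rfl a a (netVal_mem a) hs

theorem exists_pow_back {n : P.V ⊕ P.CI} (s : Walk (net hF hfin hid).adj n n)
    (a b : ((net hF hfin hid).A n).carrier) (hs : (net hF hfin hid).W s a b) :
    ∃ k, (net hF hfin hid).W (s.pow k) b a := by
  match n, s with
  | _, .nil _ => exact ⟨0, hs.symm⟩
  | .inl x, s => exact exists_pow_back_variable s a b hs
  | .inr c, .cons (v := .inr z) h p => exact h.elim
  | .inr c, .cons (v := .inl z) h t =>
    have hself : ∀ ψ, (net hF hfin hid).W t (netProj h ψ) ψ := fun ψ =>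
      ((net hF hfin hid).W_rev t _ _).1 (connects_of_constraint _ h ψ)
    obtain ⟨d, hd, ht⟩ := hs
    have hd : netProj h a = d := netVal_injective hd
    subst hd
    obtain ⟨k, hk⟩ := exists_pow_back_variable (t.append (.cons h (.nil _))) (netProj h a)
      (netProj h b) (((net hF hfin hid).W_append _ _ _ _).2 ⟨b, ht, netProj h b, rfl, rfl⟩)
    refine ⟨k + 1, ?_⟩
    have hrot := Walk.pow_rotate (Walk.cons h (.nil _)) t k
    change (Walk.cons h t).pow (k + 1) = _ at hrot
    rw [hrot]
    exact ⟨netProj h b, rfl, ((net hF hfin hid).W_append _ t _ _).2 ⟨_, hk, hself a⟩⟩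

theorem net_returns : (net hF hfin hid).Returns := by
  intro n u p w a b h
  set s := u.append (p.append w)
  have hs : (net hF hfin hid).W s a b := ((net hF hfin hid).W_append _ _ _ _).2
    ⟨a, W_refl_of_closed u a, ((net hF hfin hid).W_append _ _ _ _).2 ⟨b, h, W_refl_of_closed w b⟩⟩
  obtain ⟨k, hk⟩ := exists_pow_back s a b hs
  refine ⟨k, fun N hN => ?_⟩
  obtain ⟨m, rfl⟩ := Nat.exists_eq_add_of_le hN
  rw [Walk.pow_add]
  exact ((net hF hfin hid).W_append _ _ _ _).2 ⟨a, hk, W_refl_of_closed _ a⟩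

theorem exists_solution (hF : P.IsStrategy23 F) (hfin : ∀ v, Finite (P.dom v).carrier)
    (hid : ∀ v, (P.dom v).Idempotent) (hV : ∀ v, InV (P.dom v)) :
    ∃ φ : ∀ v, (P.dom v).carrier, P.IsSolution φ := by
  have := P.finV
  have := P.finCI
  obtain ⟨D, hne, hac, hs⟩ := Inst.exists_subsingleton_ac (V0 := Set.range Sum.inl) _
    (net hF hfin hid) le_rfl net_returns (by
      rintro _ ⟨v, rfl⟩
      exact (hV v).subalg (diagSet_closed v))
  choose φ hφ using hne
  refine ⟨fun v => netVal (φ (.inl v)), fun c => ?_⟩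
  have : ∀ j, netFun (φ (.inr c)) (P.scope c j) = netVal (φ (.inl (P.scope c j))) := by
    intro j
    obtain ⟨b, hb, h⟩ := hac (v := .inr c) (w := .inl (P.scope c j)) ⟨j, rfl⟩ _ (hφ (.inr c))
    rw [hs _ ⟨_, rfl⟩ (hφ (.inl (P.scope c j))) hb]
    exact h
  rw [← funext this]
  exact (netFun_mem (φ (.inr c))).1

end Returns

end Network

end BW

/-- every (2,3)-minimal instance of the CSP over a finite class
of finite similar idempotent affine free algebras omitting type 1 has a
solution. -/
theorem stmt_19 (σ : Signature) (K : Set (UAlgebra σ)) (hKfin : K.Finite)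
    (hfin : ∀ A ∈ K, Finite A.carrier) (hne : ∀ A ∈ K, Nonempty A.carrier)
    (hid : ∀ A ∈ K, A.Idempotent) (h1 : ∀ A ∈ K, A.OmitsType1)
    (haf : ∀ A ∈ K, A.AffineFree)
    (P : CSPInstance σ K)
    (hmin : ∃ F, P.IsStrategy23 F) :
    ∃ φ : ∀ v, (P.dom v).carrier, P.IsSolution φ := by
  obtain ⟨F, hF⟩ := hmin
  exact BW.exists_solution hF (fun v => hfin _ (P.dom_mem v)) (fun v => hid _ (P.dom_mem v))
    fun v => BW.inV_of_omits (h1 _ (P.dom_mem v)) (haf _ (P.dom_mem v))
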